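/- arXiv:1203.2723 — 6 statements merged into one kernel-verified Lean document; each statement's English description precedes it below -/
import Mathlib

section
/- For every real ε > 0 there exist δ > 0 and n₀ such that the following holds for all n ≥ n₀. Let G be a simple graph on n vertices with independence number at most 2 and t₄(G) ≤ (3/25 + δ)·C(n,4), and let V(G) = V₁ ∪ V₂ ∪ V₃ ∪ V₄ ∪ V₅ ∪ U be a partition (indices modulo 5) such that: (1) every vertex v ∈ V_i is nonadjacent to at most δ·n vertices of (V_{i−1} ∪ V_i ∪ V_{i+1}) ∖ {v} and adjacent to at most δ·n vertices of V_{i+2} ∪ V_{i+3}; (2) V₂ ∪ V₃, V₃ ∪ V₄ and V₄ ∪ V₅ are cliques in G; (3) ||V₁| − n/5| ≤ δ·n, ||V_i ∪ V_{i+1}| − 2n/5| ≤ δ·n for i = 2,3,4, and |U| ≤ δ·n. Then V_i ∪ V_{i+1} is a clique in G for every i ∈ {1,...,5}, and ||V_i| − n/5| ≤ ε·n for every i. -/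
/-- `G` has no independent set with more than `m` vertices, i.e. α(G) ≤ m. -/
def IndepBound {V : Type*} (G : SimpleGraph V) (m : ℕ) : Prop :=
  ∀ s : Finset V, (∀ u ∈ s, ∀ v ∈ s, u ≠ v → ¬ G.Adj u v) → s.card ≤ m

/-- the number of `k`-cliques of `G`. -/
noncomputable def cliqueCount {V : Type*} [Fintype V] (G : SimpleGraph V) (k : ℕ) : ℕ :=
  Nat.card {s : Finset V // s.card = k ∧ G.IsClique (s : Set V)}

theorem card_le_cliqueCount {α : Type*} [Fintype α] {G : SimpleGraph α} {k : ℕ}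
    (F : Finset (Finset α)) (hF : ∀ s ∈ F, s.card = k ∧ G.IsClique (s : Set α)) :
    F.card ≤ cliqueCount G k := by
  unfold cliqueCount
  rw [← Set.ncard_coe_finset]
  exact Set.ncard_le_ncard (t := {s : Finset α | s.card = k ∧ G.IsClique (s : Set α)}) hF
    (Set.toFinite _)

theorem choose_add_choose_le_cliqueCount {α : Type*} [Fintype α] [DecidableEq α]
    {G : SimpleGraph α} {k : ℕ} (hk : 0 < k) {A B : Finset α} (hAB : Disjoint A B)
    (hA : G.IsClique (A : Set α)) (hB : G.IsClique (B : Set α)) :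
    A.card.choose k + B.card.choose k ≤ cliqueCount G k := by
  rw [← Finset.card_powersetCard, ← Finset.card_powersetCard, ← Finset.card_union_of_disjoint]
  · refine card_le_cliqueCount _ fun s hs => ?_
    rw [Finset.mem_union, Finset.mem_powersetCard, Finset.mem_powersetCard] at hs
    rcases hs with ⟨h, hc⟩ | ⟨h, hc⟩
    · exact ⟨hc, hA.subset (Finset.coe_subset.2 h)⟩
    · exact ⟨hc, hB.subset (Finset.coe_subset.2 h)⟩
  · rw [Finset.disjoint_left]
    intro s hs ht
    rw [Finset.mem_powersetCard] at hs ht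
    obtain ⟨x, hx⟩ := Finset.card_pos.1 (hs.2 ▸ hk)
    exact Finset.disjoint_left.1 hAB (hs.1 hx) (ht.1 hx)

/-- Count the `k`-cliques inside the five cliques `V i ∪ V (i + 1)` of a cyclic arrangement;
those lying inside a single `V i` are counted once too often. -/
theorem sum_choose_le_cliqueCount_add {α : Type*} [Fintype α] [DecidableEq α]
    {G : SimpleGraph α} (k : ℕ) (V : Fin 5 → Finset α)
    (hV : ∀ i j, i ≠ j → Disjoint (V i) (V j))
    (hG : ∀ i, G.IsClique ((V i ∪ V (i + 1) : Finset α) : Set α)) :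
    ∑ i, (V i ∪ V (i + 1)).card.choose k ≤ cliqueCount G k + ∑ i, (V i).card.choose k := by
  have hmem : ∀ i j x, x ∈ V i → x ∈ V j → i = j := by
    intro i j x hi hj
    by_contra h
    exact Finset.disjoint_left.1 (hV i j h) hi hj
  let F : Fin 5 → Finset (Finset α) := fun i =>
    (V i ∪ V (i + 1)).powersetCard k \ (V i).powersetCard k
  have hF : ∀ i s, s ∈ F i →
      (s ⊆ V i ∪ V (i + 1) ∧ s.card = k) ∧ ∃ x ∈ s, x ∈ V (i + 1) := by
    intro i s hs
    simp only [F, Finset.mem_sdiff, Finset.mem_powersetCard] at hs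
    refine ⟨hs.1, ?_⟩
    by_contra! hne
    refine hs.2 ⟨fun x hx => ?_, hs.1.2⟩
    exact (Finset.mem_union.1 (hs.1.1 hx)).resolve_right (hne x hx)
  have hstep : ∀ i j s, i ≠ j → s ∈ F i → s ∈ F j → i + 1 = j := by
    intro i j s hij hi hj
    obtain ⟨x, hxs, hx⟩ := (hF i s hi).2
    rcases Finset.mem_union.1 ((hF j s hj).1.1 hxs) with h | h
    · exact hmem _ _ x hx h
    · exact absurd (add_right_cancel (hmem _ _ x hx h)) hij
  have hdisj : ∀ i j, i ≠ j → Disjoint (F i) (F j) := by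
    intro i j hij
    rw [Finset.disjoint_left]
    intro s hi hj
    have h₁ := hstep i j s hij hi hj
    have h₂ := hstep j i s hij.symm hj hi
    omega
  have hcount : ∑ i, (F i).card ≤ cliqueCount G k := by
    rw [← Finset.card_biUnion fun i _ j _ hij => hdisj i j hij]
    refine card_le_cliqueCount _ fun s hs => ?_
    obtain ⟨i, -, hi⟩ := Finset.mem_biUnion.1 hs
    exact ⟨(hF i s hi).1.2, (hG i).subset (Finset.coe_subset.2 (hF i s hi).1.1)⟩
  have hcard : ∀ i, (V i ∪ V (i + 1)).card.choose k = (F i).card + (V i).card.choose k := by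
    intro i
    rw [← Finset.card_powersetCard, ← Finset.card_powersetCard, Finset.card_sdiff_add_card_eq_card]
    exact Finset.powersetCard_mono Finset.subset_union_left
  rw [Finset.sum_congr rfl fun i _ => hcard i, Finset.sum_add_distrib]
  omega

/-- In a graph without independent triples, two distinct vertices whose neighbourhoods cover
only part of a set `W` avoiding them are adjacent. -/
theorem IndepBound.adj_of_lt_card {α : Type*} [Finite α] {G : SimpleGraph α}
    (hG : IndepBound G 2) {u v : α} (huv : u ≠ v) {W : Finset α} (hu : u ∉ W) (hv : v ∉ W)
    {S T : Set α} (hS : ∀ w ∈ W, G.Adj u w → w ∈ S) (hT : ∀ w ∈ W, G.Adj v w → w ∈ T)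
    (hW : S.ncard + T.ncard < W.card) : G.Adj u v := by
  classical
  by_contra hadj
  have hsub : (W : Set α) ⊆ S ∪ T := by
    intro w hw
    by_contra hST
    rw [Set.mem_union, not_or] at hST
    have huw : ¬ G.Adj u w := fun h => hST.1 (hS w hw h)
    have hvw : ¬ G.Adj v w := fun h => hST.2 (hT w hw h)
    have hne₁ : u ≠ w := fun h => hu (h ▸ hw)
    have hne₂ : v ≠ w := fun h => hv (h ▸ hw)
    have h := hG {u, v, w} (by
      intro a ha b hb hab
      simp only [Finset.mem_insert, Finset.mem_singleton] at ha hb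
      rcases ha with rfl | rfl | rfl <;> rcases hb with rfl | rfl | rfl <;>
        first
        | exact absurd rfl hab
        | assumption
        | exact fun h => hadj h.symm
        | exact fun h => huw h.symm
        | exact fun h => hvw h.symm)
    rw [Finset.card_eq_three.2 ⟨u, v, w, huv, hne₁, hne₂, rfl⟩] at h
    omega
  have h₁ := Set.ncard_le_ncard hsub (Set.toFinite _)
  have h₂ := Set.ncard_union_le S T
  rw [Set.ncard_coe_finset] at h₁
  omega

theorem cast_choose_four (m : ℕ) :
    (24 : ℝ) * m.choose 4 = m * (m - 1) * (m - 2) * (m - 3) := by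
  rw [Nat.cast_choose_eq_descPochhammer_div]
  simp [descPochhammer_succ_right, Nat.factorial]
  ring

theorem choose_four_le (m : ℕ) : (24 : ℝ) * m.choose 4 ≤ m ^ 4 := by
  have h := Nat.choose_le_pow_div (α := ℝ) 4 m
  norm_num [Nat.factorial] at h
  linarith

theorem le_choose_four (m : ℕ) : (m : ℝ) ^ 4 - 6 * m ^ 3 ≤ 24 * m.choose 4 := by
  rw [cast_choose_four]
  rcases Nat.eq_zero_or_pos m with rfl | hm
  · simp
  · have : (1 : ℝ) ≤ m := by exact_mod_cast hm
    nlinarith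

theorem pow_four_sub_le {δ p q : ℝ} (hp : |p| ≤ 1) (hq : |q| ≤ 1) (h : |p - q| ≤ δ) :
    q ^ 4 - 4 * δ ≤ p ^ 4 ∧ p ^ 4 ≤ q ^ 4 + 4 * δ := by
  have h₁ : |p ^ 4 - q ^ 4| ≤ 4 * δ := by
    have hfac : p ^ 4 - q ^ 4 = (p ^ 3 + p ^ 2 * q + p * q ^ 2 + q ^ 3) * (p - q) := by ring
    have hbd : |p ^ 3 + p ^ 2 * q + p * q ^ 2 + q ^ 3| ≤ 4 := by
      have hmul : ∀ i j : ℕ, |p ^ i * q ^ j| ≤ 1 := fun i j => by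
        rw [abs_mul, abs_pow, abs_pow]
        exact mul_le_one₀ (pow_le_one₀ (abs_nonneg _) hp) (by positivity)
          (pow_le_one₀ (abs_nonneg _) hq)
      have h₀ := abs_le.1 (hmul 3 0)
      have h₁ := abs_le.1 (hmul 2 1)
      have h₂ := abs_le.1 (hmul 1 2)
      have h₃ := abs_le.1 (hmul 0 3)
      simp only [pow_zero, pow_one, mul_one, one_mul] at h₀ h₁ h₂ h₃
      rw [abs_le]
      constructor <;> linarith
    rw [hfac, abs_mul]
    exact mul_le_mul hbd h (abs_nonneg _) (by norm_num)
  rw [abs_le] at h₁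
  constructor <;> linarith

set_option maxHeartbeats 800000 in
/-- If the weights of a `C₅` blow-up are determined, up to `δ`, by one free parameter, then an
almost extremal density of 4-cliques forces them to be almost balanced. -/
theorem balanced_of_density_le {a : Fin 5 → ℝ} {η δ : ℝ} (hη : 0 < η) (hη' : η ≤ 1 / 10)
    (hδ : δ = η ^ 2 / 1000) (ha : ∀ i, 0 ≤ a i)
    (h0 : |a 0 - 1 / 5| ≤ δ) (h1 : |a 1 + a 2 - 2 / 5| ≤ δ) (h2 : |a 2 + a 3 - 2 / 5| ≤ δ)
    (h3 : |a 3 + a 4 - 2 / 5| ≤ δ)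
    (hd : (a 0 + a 1) ^ 4 + (a 1 + a 2) ^ 4 + (a 2 + a 3) ^ 4 + (a 3 + a 4) ^ 4 +
      (a 4 + a 0) ^ 4 ≤ 3 / 25 + 2 * δ +
        (a 0 ^ 4 + a 1 ^ 4 + a 2 ^ 4 + a 3 ^ 4 + a 4 ^ 4)) (i : Fin 5) :
    |a i - 1 / 5| ≤ η := by
  have hδη : δ ≤ η / 10000 := by nlinarith
  have hδ0 : 0 ≤ δ := by rw [hδ]; positivity
  have ha1 := ha 1
  have ha2 := ha 2
  have ha3 := ha 3
  have ha4 := ha 4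
  rw [abs_le] at h0 h1 h2 h3
  obtain ⟨x, hx⟩ : ∃ x, x = a 1 - 1 / 5 := ⟨_, rfl⟩
  obtain ⟨P, hP⟩ : ∃ P : ℝ → ℝ, ∀ t, P t = t ^ 4 := ⟨_, fun _ => rfl⟩
  simp only [← hP] at hd
  have key : ∀ p q e : ℝ, -1 ≤ p → p ≤ 1 → -1 ≤ q → q ≤ 1 → -e ≤ p - q → p - q ≤ e →
      P q - 4 * e ≤ P p ∧ P p ≤ P q + 4 * e := fun p q e b₁ b₂ b₃ b₄ b₅ b₆ => by
    rw [hP, hP]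
    exact pow_four_sub_le (abs_le.2 ⟨b₁, b₂⟩) (abs_le.2 ⟨b₃, b₄⟩) (abs_le.2 ⟨b₅, b₆⟩)
  have c0 := (key (a 0) (1 / 5) δ (by linarith) (by linarith) (by linarith) (by linarith)
    (by linarith) (by linarith)).2
  have c1 := (key (a 1) (1 / 5 + x) 0 (by linarith) (by linarith) (by linarith) (by linarith)
    (by linarith) (by linarith)).2
  have c2 := (key (a 2) (1 / 5 - x) δ (by linarith) (by linarith) (by linarith) (by linarith)
    (by linarith) (by linarith)).2
  have c3 := (key (a 3) (1 / 5 + x) (2 * δ) (by linarith) (by linarith) (by linarith)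
    (by linarith) (by linarith) (by linarith)).2
  have c4 := (key (a 4) (1 / 5 - x) (3 * δ) (by linarith) (by linarith) (by linarith)
    (by linarith) (by linarith) (by linarith)).2
  have d0 := (key (a 0 + a 1) (2 / 5 + x) δ (by linarith) (by linarith) (by linarith)
    (by linarith) (by linarith) (by linarith)).1
  have d1 := (key (a 1 + a 2) (2 / 5) δ (by linarith) (by linarith) (by linarith)
    (by linarith) (by linarith) (by linarith)).1
  have d2 := (key (a 2 + a 3) (2 / 5) δ (by linarith) (by linarith) (by linarith)
    (by linarith) (by linarith) (by linarith)).1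
  have d3 := (key (a 3 + a 4) (2 / 5) δ (by linarith) (by linarith) (by linarith)
    (by linarith) (by linarith) (by linarith)).1
  have d4 := (key (a 4 + a 0) (2 / 5 - x) (4 * δ) (by linarith) (by linarith) (by linarith)
    (by linarith) (by linarith) (by linarith)).1
  have hpoly : 24 / 25 * x ^ 2 - 2 * x ^ 4 ≤ 62 * δ := by
    have hlin : P (2 / 5 + x) + 3 * P (2 / 5) + P (2 / 5 - x) ≤
        3 / 25 + 62 * δ + P (1 / 5) + 2 * P (1 / 5 + x) + 2 * P (1 / 5 - x) := by
      linarith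
    simp only [hP] at hlin
    linarith only [hlin]
  have hxb : x ^ 2 ≤ 9 / 100 := by
    have := mul_nonneg (by linarith : 0 ≤ x + 3 / 10) (by linarith : 0 ≤ 3 / 10 - x)
    linarith
  have hx2 : x ^ 2 ≤ (η / 2) ^ 2 := by
    have := mul_nonneg (sq_nonneg x) (sub_nonneg.2 hxb)
    have := sq_nonneg x
    have := sq_nonneg η
    linarith
  have hxη := abs_le.1 (abs_le_of_sq_le_sq hx2 (by linarith))
  rw [abs_le]
  fin_cases i <;> simp only [Fin.zero_eta, Fin.mk_one, Fin.reduceFinMk] <;>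
    constructor <;> linarith

/-- Stability: in a near-extremal graph for the (4,3)-problem, an approximate C₅
blow-up structure (conditions (1)–(3)) forces all five pairs of cyclically consecutive
parts to be genuine cliques, with all parts of size n/5 + o(n). -/
theorem erdos_43_c5_structure :
    ∀ ε : ℝ, 0 < ε → ∃ δ : ℝ, 0 < δ ∧ ∃ n₀ : ℕ, ∀ n : ℕ, n₀ ≤ n →
      ∀ G : SimpleGraph (Fin n), IndepBound G 2 →
      (cliqueCount G 4 : ℝ) ≤ (3/25 + δ) * (n.choose 4) →
      ∀ (V : Fin 5 → Finset (Fin n)) (U : Finset (Fin n)),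
        -- V₁,…,V₅,U is a partition of the vertex set
        (∀ i j : Fin 5, i ≠ j → Disjoint (V i) (V j)) →
        (∀ i : Fin 5, Disjoint (V i) U) →
        (Finset.univ.biUnion V ∪ U = Finset.univ) →
        -- (1): each v ∈ Vᵢ has few non-neighbours in V_{i−1} ∪ V_i ∪ V_{i+1} and few
        -- neighbours in V_{i+2} ∪ V_{i+3}
        (∀ i : Fin 5, ∀ v ∈ V i,
          (({u : Fin n | u ∈ V (i - 1) ∪ V i ∪ V (i + 1) ∧ u ≠ v ∧ ¬ G.Adj v u}).ncard : ℝ)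
              ≤ δ * n ∧
            (({u : Fin n | u ∈ V (i + 2) ∪ V (i + 3) ∧ G.Adj v u}).ncard : ℝ) ≤ δ * n) →
        -- (2): V₂ ∪ V₃, V₃ ∪ V₄, V₄ ∪ V₅ are cliques
        (G.IsClique ((V 1 ∪ V 2 : Finset (Fin n)) : Set (Fin n))) →
        (G.IsClique ((V 2 ∪ V 3 : Finset (Fin n)) : Set (Fin n))) →
        (G.IsClique ((V 3 ∪ V 4 : Finset (Fin n)) : Set (Fin n))) →
        -- (3): approximate sizes
        (|((V 0).card : ℝ) - n / 5| ≤ δ * n) →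
        (∀ i : Fin 5, i = 1 ∨ i = 2 ∨ i = 3 →
          |(((V i ∪ V (i + 1)).card : ℝ)) - 2 * n / 5| ≤ δ * n) →
        ((U.card : ℝ) ≤ δ * n) →
        -- conclusion
        ∀ i : Fin 5,
          G.IsClique ((V i ∪ V (i + 1) : Finset (Fin n)) : Set (Fin n)) ∧
            |((V i).card : ℝ) - n / 5| ≤ ε * n := by
  intro ε hε
  set η : ℝ := min ε (1 / 10) with hη_def
  have hη : 0 < η := lt_min hε (by norm_num)
  have hη' : η ≤ 1 / 10 := min_le_right _ _
  set δ : ℝ := η ^ 2 / 1000 with hδ_def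
  have hδ : 0 < δ := by positivity
  have hδ' : δ ≤ 1 / 100000 := by nlinarith
  refine ⟨δ, hδ, max 1 ⌈30 / δ⌉₊, ?_⟩
  intro n hn G hG hcount V U hV _ _ hnear hc1 hc2 hc3 hs0 hs _
  have hn1 : (1 : ℝ) ≤ n := by exact_mod_cast (le_max_left _ _).trans hn
  have hn0 : (0 : ℝ) < n := by linarith
  have hnδ : 30 ≤ δ * n := by
    have h : 30 / δ ≤ n := (Nat.le_ceil _).trans (by exact_mod_cast (le_max_right _ _).trans hn)
    rw [div_le_iff₀ hδ] at h
    linarith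
  have hclique : ∀ i, 2 * (δ * n) < (V (i + 3)).card →
      G.IsClique ((V i ∪ V (i + 1) : Finset (Fin n)) : Set (Fin n)) := by
    intro i hi
    have hfar : ∀ u ∈ V i ∪ V (i + 1), u ∉ V (i + 3) ∧ ∃ S : Set (Fin n),
        (∀ w ∈ V (i + 3), G.Adj u w → w ∈ S) ∧ (S.ncard : ℝ) ≤ δ * n := by
      intro u hu
      rcases Finset.mem_union.1 hu with hu | hu
      · exact ⟨Finset.disjoint_left.1 (hV _ _ (by omega)) hu,
          {w | w ∈ V (i + 2) ∪ V (i + 3) ∧ G.Adj u w},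
          fun w hw ha => ⟨Finset.mem_union_right _ hw, ha⟩, (hnear i u hu).2⟩
      · refine ⟨Finset.disjoint_left.1 (hV _ _ (by omega)) hu,
          {w | w ∈ V (i + 1 + 2) ∪ V (i + 1 + 3) ∧ G.Adj u w},
          fun w hw ha => ⟨Finset.mem_union_left _ ?_, ha⟩, (hnear (i + 1) u hu).2⟩
        rwa [show i + 1 + 2 = i + 3 by omega]
    intro u hu v hv huv
    obtain ⟨hu', S, hS, hSc⟩ := hfar u hu
    obtain ⟨hv', T, hT, hTc⟩ := hfar v hv
    refine hG.adj_of_lt_card huv hu' hv' hS hT ?_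
    have : (S.ncard : ℝ) + T.ncard < (V (i + 3)).card := by linarith
    exact_mod_cast this
  have hunion : ∀ i, (((V i ∪ V (i + 1)).card : ℕ) : ℝ) = (V i).card + (V (i + 1)).card := by
    intro i
    rw [Finset.card_union_of_disjoint (hV _ _ (by omega)), Nat.cast_add]
  obtain ⟨a, ha, han⟩ : ∃ a : Fin 5 → ℝ, (∀ i, 0 ≤ a i) ∧ ∀ i, ((V i).card : ℝ) = a i * n :=
    ⟨fun i => (V i).card / n, fun i => div_nonneg (Nat.cast_nonneg _) hn0.le,
      fun i => (div_mul_cancel₀ _ hn0.ne').symm⟩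
  have hscale : ∀ p q : ℝ, |p * n - q * n| ≤ δ * n → |p - q| ≤ δ := by
    intro p q h
    rw [← sub_mul, abs_mul, abs_of_pos hn0] at h
    exact le_of_mul_le_mul_right h hn0
  have h0 : |a 0 - 1 / 5| ≤ δ := hscale _ _ (by
    rw [← han]
    convert hs0 using 3
    ring)
  have hpair : ∀ i : Fin 5, i = 1 ∨ i = 2 ∨ i = 3 → |a i + a (i + 1) - 2 / 5| ≤ δ := by
    intro i hi
    refine hscale _ _ ?_
    rw [add_mul, ← han, ← han, ← hunion]
    convert hs i hi using 3
    ring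
  have h1 : |a 1 + a 2 - 2 / 5| ≤ δ := hpair 1 (by simp)
  have h2 : |a 2 + a 3 - 2 / 5| ≤ δ := hpair 2 (by simp)
  have h3 : |a 3 + a 4 - 2 / 5| ≤ δ := hpair 3 (by simp)
  have hupper : 24 * (cliqueCount G 4 : ℝ) ≤ (3 / 25 + δ) * n ^ 4 := by
    have := mul_le_mul_of_nonneg_left (choose_four_le n) (by linarith : (0 : ℝ) ≤ 3 / 25 + δ)
    linarith
  have herr : 30 * (n : ℝ) ^ 3 ≤ δ * n ^ 4 := by
    have := mul_le_mul_of_nonneg_right hnδ (by positivity : (0 : ℝ) ≤ (n : ℝ) ^ 3)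
    linarith
  have hlower : ∀ i, (a i + a (i + 1)) ^ 4 * n ^ 4 - 6 * n ^ 3 ≤
      24 * ((V i ∪ V (i + 1)).card.choose 4 : ℝ) := by
    intro i
    refine le_trans ?_ (le_choose_four _)
    have hle : ((V i ∪ V (i + 1)).card : ℝ) ≤ n := by
      have := (V i ∪ V (i + 1)).card_le_univ
      rw [Fintype.card_fin] at this
      exact_mod_cast this
    have := pow_le_pow_left₀ (Nat.cast_nonneg _) hle 3
    have heq : ((V i ∪ V (i + 1)).card : ℝ) = (a i + a (i + 1)) * n := by
      rw [hunion, han, han, add_mul]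
    rw [← mul_pow, ← heq]
    linarith
  have hn4 : (0 : ℝ) < (n : ℝ) ^ 4 := by positivity
  have htwo : ∀ i j : Fin 5, i ≠ j → i ≠ j + 1 → i + 1 ≠ j →
      G.IsClique ((V i ∪ V (i + 1) : Finset (Fin n)) : Set (Fin n)) →
      G.IsClique ((V j ∪ V (j + 1) : Finset (Fin n)) : Set (Fin n)) →
      (a i + a (i + 1)) ^ 4 + (a j + a (j + 1)) ^ 4 ≤ 3 / 25 + 2 * δ := by
    intro i j hij hij₁ hij₂ hci hcj
    have hdisj : Disjoint (V i ∪ V (i + 1)) (V j ∪ V (j + 1)) := by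
      rw [Finset.disjoint_union_left, Finset.disjoint_union_right, Finset.disjoint_union_right]
      exact ⟨⟨hV _ _ hij, hV _ _ hij₁⟩, hV _ _ hij₂, hV _ _ fun h => hij (add_right_cancel h)⟩
    have h : (((V i ∪ V (i + 1)).card.choose 4 : ℕ) : ℝ) + (V j ∪ V (j + 1)).card.choose 4 ≤
        cliqueCount G 4 := by
      exact_mod_cast choose_add_choose_le_cliqueCount (k := 4) (by norm_num) hdisj hci hcj
    have hli := hlower i
    have hlj := hlower j
    have hn3 : (0 : ℝ) ≤ (n : ℝ) ^ 3 := by positivity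
    refine le_of_mul_le_mul_right ?_ hn4
    linarith
  have hcontra : ∀ p q : ℝ, 39 / 100 ≤ p → 59 / 100 ≤ q → p ^ 4 + q ^ 4 ≤ 3 / 25 + 2 * δ →
      False := by
    intro p q hp hq h
    have hp4 := pow_le_pow_left₀ (by norm_num) hp 4
    have hq4 := pow_le_pow_left₀ (by norm_num) hq 4
    norm_num at hp4 hq4
    linarith
  have h0' := abs_le.1 h0
  have h1' := abs_le.1 h1
  have h2' := abs_le.1 h2
  have h3' := abs_le.1 h3
  have hclique' : ∀ i, 2 * δ < a (i + 3) →
      G.IsClique ((V i ∪ V (i + 1) : Finset (Fin n)) : Set (Fin n)) := by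
    intro i hi
    refine hclique i ?_
    rw [han, ← mul_assoc]
    exact mul_lt_mul_of_pos_right hi hn0
  have ha3 : 2 * δ < a 3 := by
    by_contra! h
    have hc4 := hclique' 4 (show 2 * δ < a 2 by linarith)
    have := htwo 2 4 (by decide) (by decide) (by decide) hc2 hc4
    exact hcontra (a 2 + a 3) (a 4 + a 0) (by linarith) (by linarith) this
  have ha2 : 2 * δ < a 2 := by
    by_contra! h
    have hc0 := hclique' 0 (show 2 * δ < a 3 by linarith)
    have := htwo 3 0 (by decide) (by decide) (by decide) hc3 hc0
    exact hcontra (a 3 + a 4) (a 0 + a 1) (by linarith) (by linarith) this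
  have hall : ∀ i, G.IsClique ((V i ∪ V (i + 1) : Finset (Fin n)) : Set (Fin n)) := by
    intro i
    fin_cases i
    · exact hclique' 0 ha3
    · exact hc1
    · exact hc2
    · exact hc3
    · exact hclique' 4 ha2
  have hdens : (a 0 + a 1) ^ 4 + (a 1 + a 2) ^ 4 + (a 2 + a 3) ^ 4 + (a 3 + a 4) ^ 4 +
      (a 4 + a 0) ^ 4 ≤ 3 / 25 + 2 * δ +
        (a 0 ^ 4 + a 1 ^ 4 + a 2 ^ 4 + a 3 ^ 4 + a 4 ^ 4) := by
    have hsum : (∑ i, ((V i ∪ V (i + 1)).card.choose 4 : ℝ)) ≤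
        cliqueCount G 4 + ∑ i, ((V i).card.choose 4 : ℝ) := by
      exact_mod_cast sum_choose_le_cliqueCount_add 4 V hV hall
    have hsingle : ∀ i, 24 * ((V i).card.choose 4 : ℝ) ≤ a i ^ 4 * n ^ 4 := by
      intro i
      rw [← mul_pow, ← han]
      exact choose_four_le _
    have hL := Finset.sum_le_sum fun i (_ : i ∈ Finset.univ) => hlower i
    have hR := Finset.sum_le_sum fun i (_ : i ∈ Finset.univ) => hsingle i
    rw [← Finset.mul_sum] at hL hR
    have hLR := hL.trans (mul_le_mul_of_nonneg_left hsum (by norm_num))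
    simp only [Fin.sum_univ_five (M := ℝ)] at hLR hR
    simp only [Fin.isValue, zero_add, Fin.reduceAdd] at hLR hR
    refine le_of_mul_le_mul_right ?_ hn4
    linarith
  intro i
  refine ⟨hall i, ?_⟩
  have hi := balanced_of_density_le hη hη' hδ_def ha h0 h1 h2 h3 hdens i
  have heq : ((V i).card : ℝ) - n / 5 = (a i - 1 / 5) * n := by
    rw [han]
    ring
  rw [heq, abs_mul, abs_of_pos hn0]
  exact mul_le_mul_of_nonneg_right (hi.trans (min_le_left _ _)) hn0.le
end

section
/- For every real ε > 0 there exist δ > 0 and n₀ such that the following holds for all n ≥ n₀. Let G be a simple graph on n vertices with independence number at most 2 such that t₄(G) = f(n,4,3) (i.e. G minimizes the number of 4-cliques among all such graphs), and let V(G) = V₁ ∪ V₂ ∪ V₃ ∪ V₄ ∪ V₅ ∪ U be a partition (indices modulo 5) such that V_i ∪ V_{i+1} is a clique for every i, ||V_i| − n/5| ≤ δ·n for every i, |U| ≤ δ·n, and every vertex of V_i is adjacent to at most δ·n vertices of V_{i+2} ∪ V_{i+3}. Then for every u ∈ U there exists an index i such that u is adjacent to every vertex of V_{i−1} ∪ V_i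 ∪ V_{i+1}, and u is adjacent to at most ε·n vertices of V_{i+2} ∪ V_{i+3}. -/
/-- `f(n,k,l)`: the minimum number of `k`-cliques over graphs on `n` vertices with
independence number at most `l − 1`. -/
noncomputable def minCliques (n k l : ℕ) : ℕ :=
  sInf {m | ∃ G : SimpleGraph (Fin n), IndepBound G (l - 1) ∧ cliqueCount G k = m}

open Finset

section CloneVertex

variable {V W : Type*}

/-- The blow-up of `G` along `φ`: the fibres of `φ` become cliques, and vertices in distinct fibres
are adjacent exactly when their images are. -/
def SimpleGraph.cliqueBlowUp (G : SimpleGraph W) (φ : V → W) : SimpleGraph V where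
  Adj a b := a ≠ b ∧ (φ a = φ b ∨ G.Adj (φ a) (φ b))
  symm := ⟨fun _ _ h => ⟨h.1.symm, h.2.imp Eq.symm fun h => h.symm⟩⟩
  loopless := ⟨fun _ h => h.1 rfl⟩

theorem IndepBound.cliqueBlowUp {G : SimpleGraph W} {m : ℕ} (hG : IndepBound G m) (φ : V → W) :
    IndepBound (G.cliqueBlowUp φ) m := by
  classical
  intro s hs
  have hinj : Set.InjOn φ s := fun a ha b hb hab => by
    by_contra hne
    exact hs a ha b hb hne ⟨hne, Or.inl hab⟩
  rw [← card_image_of_injOn hinj]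
  refine hG _ fun x hx y hy hne hab => ?_
  obtain ⟨a, ha, rfl⟩ := mem_image.1 hx
  obtain ⟨b, hb, rfl⟩ := mem_image.1 hy
  have hne' : a ≠ b := fun h => hne (congrArg φ h)
  exact hs a ha b hb hne' ⟨hne', Or.inr hab⟩

theorem IndepBound.adj_of_not_adj {G : SimpleGraph V} (hG : IndepBound G 2) {u a b : V}
    (hua : u ≠ a) (hub : u ≠ b) (hab : a ≠ b) (ha : ¬ G.Adj u a) (hb : ¬ G.Adj u b) :
    G.Adj a b := by
  classical
  by_contra h
  have h3 : ({u, a, b} : Finset V).card = 3 := card_eq_three.2 ⟨u, a, b, hua, hub, hab, rfl⟩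
  have h2 := hG {u, a, b} (by
    have := G.adj_comm
    simp only [mem_insert, mem_singleton]
    rintro x (rfl | rfl | rfl) y (rfl | rfl | rfl) hxy <;> simp_all)
  omega

theorem cliqueCount_eq_card_filter [Fintype V] [DecidableEq V] (G : SimpleGraph V) (k : ℕ)
    [DecidablePred fun s : Finset V => s.card = k ∧ G.IsClique (s : Set V)] :
    cliqueCount G k = #{s : Finset V | s.card = k ∧ G.IsClique (s : Set V)} := by
  rw [cliqueCount, Nat.card_eq_fintype_card, Fintype.card_subtype]

theorem card_filter_four_mem_inter_le [Fintype V] [DecidableEq V] (u : V) (Z : Finset V)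
    [DecidablePred fun s : Finset V => s.card = 4 ∧ u ∈ s ∧ ∃ z ∈ Z, z ≠ u ∧ z ∈ s] :
    #{s : Finset V | s.card = 4 ∧ u ∈ s ∧ ∃ z ∈ Z, z ≠ u ∧ z ∈ s}
      ≤ #Z * Fintype.card V ^ 2 := by
  calc _ ≤ #((Z ×ˢ (univ : Finset (V × V))).image
        fun p => ({u, p.1, p.2.1, p.2.2} : Finset V)) := by
        refine card_le_card fun s hs => ?_
        obtain ⟨h4, hu, z, hzZ, hzu, hz⟩ := (mem_filter.1 hs).2
        have hz' : z ∈ s.erase u := mem_erase.2 ⟨hzu, hz⟩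
        have h2 : #((s.erase u).erase z) = 2 := by
          rw [card_erase_of_mem hz', card_erase_of_mem hu, h4]
        obtain ⟨a, b, -, hab⟩ := card_eq_two.1 h2
        refine mem_image.2 ⟨(z, a, b), by simp [hzZ], ?_⟩
        change insert u (insert z {a, b}) = s
        rw [← hab, insert_erase hz', insert_erase hu]
    _ ≤ #(Z ×ˢ (univ : Finset (V × V))) := card_image_le
    _ = #Z * Fintype.card V ^ 2 := by
        rw [card_product, card_univ, Fintype.card_prod, sq]

theorem injOn_insert_insert [DecidableEq V] {u : V} {X Y : Finset V} (hXY : Disjoint X Y)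
    (huX : u ∉ X) (huY : u ∉ Y) :
    Set.InjOn (fun p : V × Finset V => insert u (insert p.1 p.2))
      (X ×ˢ Y.powersetCard 2 : Finset (V × Finset V)) := by
  rintro ⟨x, p⟩ hx ⟨y, q⟩ hy h
  simp only [coe_product, Set.mem_prod, mem_coe, mem_powersetCard] at hx hy
  obtain ⟨hx, hp, -⟩ := hx
  obtain ⟨hy, hq, -⟩ := hy
  have hmem : ∀ w, w = u ∨ w = x ∨ w ∈ p ↔ w = u ∨ w = y ∨ w ∈ q := fun w => by
    simpa using congrArg (w ∈ ·) h
  have hXY' := disjoint_left.1 hXY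
  have hxy : x = y := by
    have := (hmem x).1 (Or.inr (Or.inl rfl))
    grind
  subst hxy
  refine Prod.ext rfl (Finset.ext fun w => ?_)
  have := hmem w
  have := @hp w
  have := @hq w
  grind

/-- Replacing `u` by a twin of `v` in a graph minimizing the number of 4-cliques gains at most the
4-cliques through `u` and `Z`, and loses those spanned by `u`, a vertex of `X` and two of `Y`. -/
theorem card_mul_choose_two_le_of_twin [Fintype V] {G : SimpleGraph V} {m : ℕ}
    (hG : IndepBound G m)
    (hmin : ∀ G' : SimpleGraph V, IndepBound G' m → cliqueCount G 4 ≤ cliqueCount G' 4)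
    {u v : V} {X Y Z : Finset V}
    (hZ : ∀ w, w ≠ u → w = v ∨ G.Adj v w → w ∈ Z ∨ (G.Adj u w ∧ w ∉ X))
    (hX : ∀ w ∈ X, G.Adj u w) (hY : ∀ w ∈ Y, G.Adj u w) (hXY : Disjoint X Y)
    (hclique : G.IsClique (X ∪ Y : Set V)) :
    #X * (#Y).choose 2 ≤ #Z * Fintype.card V ^ 2 := by
  classical
  set φ : V → V := Function.update id u v
  have hφu : φ u = v := Function.update_self ..
  have hφ : ∀ w, w ≠ u → φ w = w := fun w hw => Function.update_of_ne hw ..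
  have hle := hmin _ (hG.cliqueBlowUp φ)
  rw [cliqueCount_eq_card_filter, cliqueCount_eq_card_filter] at hle
  set F : Finset (Finset V) := {s | s.card = 4 ∧ G.IsClique (s : Set V)}
  set F' : Finset (Finset V) := {s | s.card = 4 ∧ (G.cliqueBlowUp φ).IsClique (s : Set V)}
  set D : Finset (Finset V) := {s | s.card = 4 ∧ u ∈ s ∧ ∃ z ∈ Z, z ≠ u ∧ z ∈ s}
  set E : Finset (Finset V) :=
    (X ×ˢ Y.powersetCard 2).image fun p => insert u (insert p.1 p.2)
  have huX : u ∉ X := fun h => G.irrefl (hX u h)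
  have huY : u ∉ Y := fun h => G.irrefl (hY u h)
  have hE : #E = #X * (#Y).choose 2 := by
    rw [card_image_of_injOn (injOn_insert_insert hXY huX huY), card_product, card_powersetCard]
  have hD : #D ≤ #Z * Fintype.card V ^ 2 := card_filter_four_mem_inter_le u Z
  have hEF : E ⊆ F := by
    intro s hs
    obtain ⟨⟨x, p⟩, hxp, rfl⟩ := mem_image.1 hs
    obtain ⟨hx, hp⟩ := mem_product.1 hxp
    obtain ⟨hp, hp2⟩ := mem_powersetCard.1 hp
    have hxp : x ∉ p := fun h => disjoint_left.1 hXY hx (hp h)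
    have hu : u ∉ insert x p := by
      rw [mem_insert, not_or]
      exact ⟨fun h => huX (h ▸ hx), fun h => huY (hp h)⟩
    refine mem_filter.2 ⟨mem_univ _, ?_, ?_⟩
    · rw [card_insert_of_notMem hu, card_insert_of_notMem hxp]
      simp only at hp2
      omega
    · rw [coe_insert, SimpleGraph.isClique_insert]
      refine ⟨hclique.subset ?_, fun b hb _ => ?_⟩
      · rw [coe_insert]
        exact Set.insert_subset (Or.inl hx) fun w hw => Or.inr (hp hw)
      · rcases mem_insert.1 (mem_coe.1 hb) with rfl | hb
        exacts [hX _ hx, hY _ (hp hb)]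
  have hF' : F' ⊆ (F \ E) ∪ D := by
    intro s hs
    obtain ⟨-, h4, hs⟩ := mem_filter.1 hs
    by_cases hsD : s ∈ D
    · exact mem_union_right _ hsD
    refine mem_union_left _ (mem_sdiff.2 ⟨mem_filter.2 ⟨mem_univ _, h4, ?_⟩, ?_⟩)
    all_goals
      have key : u ∈ s → ∀ w ∈ s, w ≠ u → G.Adj u w ∧ w ∉ X := fun hu w hw hwu => by
        have hadj := (hs (mem_coe.2 hu) (mem_coe.2 hw) hwu.symm).2
        rw [hφu, hφ w hwu] at hadj
        exact (hZ w hwu (hadj.imp_left Eq.symm)).resolve_left fun hwZ =>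
          hsD (mem_filter.2 ⟨mem_univ _, h4, hu, w, hwZ, hwu, hw⟩)
    · intro a ha b hb hab
      by_cases hau : a = u
      · subst hau
        exact (key ha b hb hab.symm).1
      by_cases hbu : b = u
      · subst hbu
        exact (key hb a ha hab).1.symm
      have hadj := (hs ha hb hab).2
      rw [hφ a hau, hφ b hbu] at hadj
      exact hadj.resolve_left hab
    · intro hsE
      obtain ⟨⟨x, p⟩, hxp, rfl⟩ := mem_image.1 hsE
      have hx := (mem_product.1 hxp).1
      exact (key (mem_insert_self _ _) x (by simp) fun h => huX (h ▸ hx)).2 hx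
  have h1 := card_le_card hF'
  have h2 := card_union_le (F \ E) D
  have h3 := card_sdiff_add_card_eq_card hEF
  omega

end CloneVertex

theorem mul_sq_le_of_choose_two_le {x y z n : ℕ} (hn : 0 < n) (hy : (n : ℝ) / 10 ≤ y)
    (hy2 : 2 ≤ y) (h : x * y.choose 2 ≤ z * n ^ 2) : (x : ℝ) ≤ 400 * z := by
  have hn' : (0 : ℝ) < n := by exact_mod_cast hn
  have h' : (x : ℝ) * (y * (y - 1) / 2) ≤ z * n ^ 2 := by
    rw [← Nat.cast_choose_two]
    exact_mod_cast h
  have hy2' : (2 : ℝ) ≤ y := by exact_mod_cast hy2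
  have h1 : (n : ℝ) ^ 2 / 400 ≤ y * (y - 1) / 2 := by nlinarith
  have h2 : (x : ℝ) * (n ^ 2 / 400) ≤ z * n ^ 2 :=
    (mul_le_mul_of_nonneg_left h1 (Nat.cast_nonneg x)).trans h'
  refine le_of_mul_le_mul_right (a := (n : ℝ) ^ 2) ?_ (by positivity)
  linarith

/-- On the 5-cycle, if a large value at `j` forces zero at `j + 2` and `j + 3`, then three
consecutive values are not large. -/
theorem exists_three_consecutive_le {c : ℝ} {f : Fin 5 → ℝ} (hc : 0 ≤ c)
    (h2 : ∀ j, c < f j → f (j + 2) = 0) (h3 : ∀ j, c < f j → f (j + 3) = 0) :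
    ∃ i, f (i + 2) ≤ c ∧ f (i + 3) ≤ c ∧ f (i + 4) ≤ c := by
  by_cases h : ∃ j, c < f j
  · obtain ⟨j, hj⟩ := h
    by_cases hj1 : c < f (j + 1)
    · have := h3 _ hj1
      rw [show j + 1 + 3 = j + 4 by omega] at this
      exact ⟨j, (h2 j hj).trans_le hc, (h3 j hj).trans_le hc, this.trans_le hc⟩
    · refine ⟨j + 4, ?_⟩
      rw [show j + 4 + 2 = j + 1 by omega, show j + 4 + 3 = j + 2 by omega,
        show j + 4 + 4 = j + 3 by omega]
      exact ⟨not_lt.1 hj1, (h2 j hj).trans_le hc, (h3 j hj).trans_le hc⟩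
  · push Not at h
    exact ⟨0, h _, h _, h _⟩

/-- In an extremal graph for the (4,3)-problem with an approximate C₅-blow-up
partition V₁,…,V₅,U, every leftover vertex u ∈ U fits into some part: there is i such
that u is adjacent to all of V_{i−1} ∪ V_i ∪ V_{i+1} and has few neighbours in
V_{i+2} ∪ V_{i+3}. -/
theorem erdos_43_bad_vertices :
    ∀ ε : ℝ, 0 < ε → ∃ δ : ℝ, 0 < δ ∧ ∃ n₀ : ℕ, ∀ n : ℕ, n₀ ≤ n →
      ∀ G : SimpleGraph (Fin n), IndepBound G 2 →
      cliqueCount G 4 = minCliques n 4 3 →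
      ∀ (V : Fin 5 → Finset (Fin n)) (U : Finset (Fin n)),
        -- V₁,…,V₅,U is a partition of the vertex set
        (∀ i j : Fin 5, i ≠ j → Disjoint (V i) (V j)) →
        (∀ i : Fin 5, Disjoint (V i) U) →
        (Finset.univ.biUnion V ∪ U = Finset.univ) →
        -- each pair of cyclically consecutive parts is a clique
        (∀ i : Fin 5, G.IsClique ((V i ∪ V (i + 1) : Finset (Fin n)) : Set (Fin n))) →
        -- approximate sizes
        (∀ i : Fin 5, |((V i).card : ℝ) - n / 5| ≤ δ * n) →
        ((U.card : ℝ) ≤ δ * n) →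
        -- each vertex of Vᵢ has few neighbours in V_{i+2} ∪ V_{i+3}
        (∀ i : Fin 5, ∀ v ∈ V i,
          (({u : Fin n | u ∈ V (i + 2) ∪ V (i + 3) ∧ G.Adj v u}).ncard : ℝ) ≤ δ * n) →
        -- conclusion
        ∀ u ∈ U, ∃ i : Fin 5,
          (∀ w ∈ V (i - 1) ∪ V i ∪ V (i + 1), G.Adj u w) ∧
            (({w : Fin n | w ∈ V (i + 2) ∪ V (i + 3) ∧ G.Adj u w}).ncard : ℝ)
              ≤ ε * n := by
  classical
  intro ε hε
  have hε1 : 0 < min ε 1 := lt_min hε one_pos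
  refine ⟨min ε 1 / 20000, by positivity, ⌈20000 / min ε 1⌉₊, ?_⟩
  intro n hn G hG hmin V U hVV hVU hcover hclique hcard hU hfew u hu
  set δ : ℝ := min ε 1 / 20000 with hδ
  have hδε : 20000 * δ ≤ ε := by rw [hδ]; linarith [min_le_left ε 1]
  have hδ1 : δ ≤ 1 / 20000 := by rw [hδ]; linarith [min_le_right ε 1]
  have hδn : 1 ≤ δ * n := by
    have := (Nat.le_ceil _).trans (Nat.cast_le (α := ℝ).2 hn)
    rw [div_le_iff₀ hε1] at this
    rw [hδ]
    linarith
  have hn0 : 0 < n := Nat.pos_of_ne_zero fun h => by subst h; norm_num at hδn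
  have hnR : (0 : ℝ) < n := by exact_mod_cast hn0
  have hδn' : δ * n ≤ n / 20000 := by nlinarith
  have hmin' : ∀ G' : SimpleGraph (Fin n), IndepBound G' 2 → cliqueCount G 4 ≤ cliqueCount G' 4 :=
    fun G' hG' => hmin.trans_le (Nat.sInf_le ⟨G', hG', rfl⟩)
  have hne : ∀ j, ∀ w ∈ V j, u ≠ w := fun j w hw h => disjoint_left.1 (hVU j) (h ▸ hw) hu
  replace hfew : ∀ i, ∀ v ∈ V i, (#{w ∈ V (i + 2) ∪ V (i + 3) | G.Adj v w} : ℝ) ≤ δ * n :=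
    fun i v hv => by
      rw [← Set.ncard_coe_finset, coe_filter]
      exact hfew i v hv
  let N : Fin 5 → Finset (Fin n) := fun j => {w ∈ V j | ¬ G.Adj u w}
  let A : Fin 5 → Finset (Fin n) := fun j => {w ∈ V j | G.Adj u w}
  have hAN : ∀ j, (#(A j) : ℝ) + #(N j) = #(V j) := fun j => by
    exact_mod_cast card_filter_add_card_filter_not (s := V j) (G.Adj u ·)
  have hN : ∀ j k, j = k + 2 ∨ j = k + 3 → δ * n < #(N j) → N k = ∅ := by
    intro j k hjk hj
    by_contra hk
    obtain ⟨w, hw⟩ := nonempty_iff_ne_empty.2 hk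
    obtain ⟨hwV, hwu⟩ := mem_filter.1 hw
    refine absurd (hfew k w hwV) (not_le.2 (hj.trans_le ?_))
    refine Nat.cast_le.2 (card_le_card fun x hx => ?_)
    obtain ⟨hxV, hxu⟩ := mem_filter.1 hx
    have hkj : k ≠ j := by omega
    refine mem_filter.2 ⟨?_, hG.adj_of_not_adj (hne k w hwV) (hne j x hxV)
      (fun h => disjoint_left.1 (hVV k j hkj) hwV (h ▸ hxV)) hwu hxu⟩
    rcases hjk with rfl | rfl
    exacts [mem_union_left _ hxV, mem_union_right _ hxV]
  have hδn0 : 0 ≤ δ * n := zero_le_one.trans hδn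
  obtain ⟨i, hi2, hi3, hi4⟩ := exists_three_consecutive_le (f := fun j => (#(N j) : ℝ)) hδn0
    (fun j hj => by rw [hN j (j + 2) (by omega) hj]; simp)
    (fun j hj => by rw [hN j (j + 3) (by omega) hj]; simp)
  have hVlow : ∀ j, (n : ℝ) / 5 - δ * n ≤ #(V j) := fun j => by linarith [(abs_le.1 (hcard j)).1]
  obtain ⟨v, hv⟩ : (V (i + 3)).Nonempty := by
    rw [← card_pos, ← Nat.cast_pos (α := ℝ)]
    linarith [hVlow (i + 3)]
  let Z := {v} ∪ U ∪ {w ∈ V (i + 3 + 2) ∪ V (i + 3 + 3) | G.Adj v w}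
    ∪ (N (i + 2) ∪ N (i + 3) ∪ N (i + 4))
  have hZcard : (#Z : ℝ) ≤ 6 * (δ * n) := by
    have h : #Z ≤ 1 + #U + #{w ∈ V (i + 3 + 2) ∪ V (i + 3 + 3) | G.Adj v w}
        + (#(N (i + 2)) + #(N (i + 3)) + #(N (i + 4))) := by
      have h1 := card_union_le {v} U
      have h2 := card_union_le ({v} ∪ U) {w ∈ V (i + 3 + 2) ∪ V (i + 3 + 3) | G.Adj v w}
      have h3 := card_union_le (N (i + 2)) (N (i + 3))
      have h4 := card_union_le (N (i + 2) ∪ N (i + 3)) (N (i + 4))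
      have hv1 := card_singleton v
      refine (card_union_le _ _).trans ?_
      omega
    replace h := Nat.cast_le (α := ℝ).2 h
    push_cast at h
    linarith [hfew (i + 3) v hv]
  have hZ : ∀ j, j = i ∨ j = i + 1 → ∀ w, w ≠ u → w = v ∨ G.Adj v w →
      w ∈ Z ∨ (G.Adj u w ∧ w ∉ A j) := by
    intro j hj w hwu hwv
    by_contra! hcon
    obtain ⟨hwZ, hw⟩ := hcon
    simp only [Z, mem_union, mem_singleton, mem_filter, not_or] at hwZ
    obtain ⟨⟨⟨hwv', hwU⟩, hwB⟩, ⟨h2, h3⟩, h4⟩ := hwZ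
    have hwv := hwv.resolve_left hwv'
    rw [show i + 3 + 2 = i by omega, show i + 3 + 3 = i + 1 by omega] at hwB
    obtain ⟨k, hk⟩ : ∃ k, w ∈ V k := by
      have : w ∈ univ.biUnion V ∪ U := hcover ▸ mem_univ w
      simpa [hwU] using this
    have hki : k ≠ i := fun h => hwB ⟨Or.inl (h ▸ hk), hwv⟩
    have hki' : k ≠ i + 1 := fun h => hwB ⟨Or.inr (h ▸ hk), hwv⟩
    have hwuA : G.Adj u w := by
      by_contra hwuA
      have hwN : w ∈ N k := mem_filter.2 ⟨hk, hwuA⟩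
      have : k = i + 2 ∨ k = i + 3 ∨ k = i + 4 := by omega
      rcases this with rfl | rfl | rfl
      exacts [h2 hwN, h3 hwN, h4 hwN]
    have hkj : k ≠ j := by rcases hj with rfl | rfl <;> assumption
    exact disjoint_left.1 (hVV k j hkj) hk (mem_filter.1 (hw hwuA)).1
  have hA : ∀ j k, j = i ∨ j = i + 1 → (#(N k) : ℝ) ≤ δ * n → j ≠ k →
      G.IsClique (V j ∪ V k : Set (Fin n)) → (#(A j) : ℝ) ≤ 2400 * (δ * n) := by
    intro j k hj hk hjk hcl
    have hAk : (n : ℝ) / 10 ≤ #(A k) := by linarith [hAN k, hVlow k]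
    have h2 : 2 ≤ #(A k) := by
      rw [← Nat.cast_le (α := ℝ)]
      push_cast
      linarith
    have h := card_mul_choose_two_le_of_twin hG hmin' (X := A j) (Y := A k) (hZ j hj)
      (fun w hw => (mem_filter.1 hw).2) (fun w hw => (mem_filter.1 hw).2)
      (disjoint_filter_filter (hVV j k hjk))
      (hcl.subset (Set.union_subset_union (coe_subset.2 (filter_subset _ _))
        (coe_subset.2 (filter_subset _ _))))
    rw [Fintype.card_fin] at h
    linarith [mul_sq_le_of_choose_two_le hn0 hAk h2 h]
  have hAi : (#(A i) : ℝ) ≤ 2400 * (δ * n) := by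
    refine hA i (i + 4) (Or.inl rfl) hi4 (by omega) ?_
    have := hclique (i + 4)
    rw [show i + 4 + 1 = i by omega, coe_union] at this
    rwa [Set.union_comm]
  have hAi' : (#(A (i + 1)) : ℝ) ≤ 2400 * (δ * n) := by
    refine hA (i + 1) (i + 2) (Or.inr rfl) hi2 (by omega) ?_
    have := hclique (i + 1)
    rwa [show i + 1 + 1 = i + 2 by omega, coe_union] at this
  have hNi : δ * n < #(N i) := by linarith [hAN i, hVlow i]
  have hNi' : δ * n < #(N (i + 1)) := by linarith [hAN (i + 1), hVlow (i + 1)]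
  have hadj : ∀ k, N k = ∅ → ∀ w ∈ V k, G.Adj u w := fun k hk w hw => by
    by_contra h
    exact notMem_empty w (hk ▸ mem_filter.2 ⟨hw, h⟩)
  refine ⟨i + 3, fun w hw => ?_, ?_⟩
  · rw [show i + 3 - 1 = i + 2 by omega, show i + 3 + 1 = i + 4 by omega, mem_union,
      mem_union] at hw
    rcases hw with (hw | hw) | hw
    · exact hadj _ (hN i _ (by omega) hNi) w hw
    · exact hadj _ (hN i _ (by omega) hNi) w hw
    · exact hadj _ (hN (i + 1) _ (by omega) hNi') w hw
  · rw [show i + 3 + 2 = i by omega, show i + 3 + 3 = i + 1 by omega, ← coe_filter,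
      Set.ncard_coe_finset, filter_union]
    have h := Nat.cast_le (α := ℝ).2 (card_union_le (A i) (A (i + 1)))
    push_cast at h
    refine h.trans ?_
    nlinarith
end

section
/- For integers n and (y₁,...,y₅) define g(y₁,...,y₅) = Σ_{i=1}^{5} C(y_i,4) − Σ_{i=1}^{5} C(n − y_i − y_{i+1}, 4), indices modulo 5. There exists ε₀ > 0 such that for every ε ∈ (0, ε₀) there is n₀ with the following property for all n ≥ n₀: over all integer tuples (y₁,...,y₅) satisfying Σ_{i=1}^{5} y_i = 2n and |y_i − 2n/5| < ε·n for each i, the function g attains its minimum exactly at the cyclic rotations of the tuple (⌊2n/5⌋, ⌊(2n+1)/5⌋, ⌊(2n+2)/5⌋, ⌊(2n+3)/5⌋, ⌊(2n+4)/5⌋), i.e. at the tuples where the values ⌊2n/5⌋ and ⌈2n/5⌉ appear in ascending cyclic order. -/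
/-- g(y₁,…,y₅) = Σᵢ C(yᵢ,4) − Σᵢ C(n − yᵢ − yᵢ₊₁, 4), indices mod 5, where
C(m,4) = 0 for m < 4 (in particular for negative m). -/
def gOpt (n : ℕ) (y : Fin 5 → ℤ) : ℤ :=
  (∑ i : Fin 5, ((y i).toNat.choose 4 : ℤ))
    - ∑ i : Fin 5, (((n : ℤ) - y i - y (i + 1)).toNat.choose 4 : ℤ)

/-- The conjectured optimal tuple: yᵢ* = ⌊(2n + i)/5⌋, so that the values ⌊2n/5⌋ and
⌈2n/5⌉ appear in ascending order. -/
def yStar (n : ℕ) : Fin 5 → ℤ :=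
  fun i => ((2 * n + i.val) / 5 : ℕ)

theorem gOpt_comp_add_right (n : ℕ) (y : Fin 5 → ℤ) (r : Fin 5) :
    gOpt n (fun i => y (i + r)) = gOpt n y := by
  unfold gOpt
  congr 1
  · exact Fintype.sum_equiv (Equiv.addRight r) _ _ fun i => rfl
  · refine Fintype.sum_equiv (Equiv.addRight r) _ _ fun i => ?_
    simp only [Equiv.coe_addRight, add_right_comm i 1 r]

theorem cast_toNat_choose_four {m : ℤ} (hm : 0 ≤ m) :
    24 * ((m.toNat.choose 4 : ℕ) : ℝ) = m * (m - 1) * (m - 2) * (m - 3) := by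
  lift m to ℕ using hm
  rw [Int.toNat_natCast, Nat.cast_choose_eq_descPochhammer_div]
  simp [descPochhammer_succ_right, Nat.factorial]
  ring

/-- The part of `24 * gOpt n` that does not depend on the tuple. -/
noncomputable def gOptBase (n : ℝ) : ℝ :=
  5 * ((2 * n / 5) * (2 * n / 5 - 1) * (2 * n / 5 - 2) * (2 * n / 5 - 3)
    - (n / 5) * (n / 5 - 1) * (n / 5 - 2) * (n / 5 - 3))

/-- The exact Taylor expansion of `24 * gOpt n` around the constant tuple `2 * n / 5`. -/
theorem gOpt_expansion (n : ℕ) (y : Fin 5 → ℤ) (x : Fin 5 → ℝ)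
    (hx : ∀ i, (y i : ℝ) = 2 * n / 5 + x i) (hsum : ∑ i, x i = 0)
    (hy : ∀ i, 0 ≤ y i) (hz : ∀ i, 0 ≤ (n : ℤ) - y i - y (i + 1)) :
    24 * (gOpt n y : ℝ) = gOptBase n
      + (36 / 5 * n - 33) * ∑ i, x i ^ 2
      + (6 * (n / 5 - 3 / 2) ^ 2 - 5 / 2) * ∑ i, (x i - x (i + 1)) ^ 2
      + ∑ i, (4 * (2 * n / 5 - 3 / 2) * x i ^ 3 + x i ^ 4)
      + ∑ i, (4 * (n / 5 - 3 / 2) * (x i + x (i + 1)) ^ 3 - (x i + x (i + 1)) ^ 4) := by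
  have h1 : ∀ i, 24 * (((y i).toNat.choose 4 : ℕ) : ℝ) =
      (2 * n / 5 + x i) * (2 * n / 5 + x i - 1) * (2 * n / 5 + x i - 2)
        * (2 * n / 5 + x i - 3) := fun i => by
    rw [cast_toNat_choose_four (hy i), hx]
  have h2 : ∀ i, 24 * ((((n : ℤ) - y i - y (i + 1)).toNat.choose 4 : ℕ) : ℝ) =
      (n / 5 - (x i + x (i + 1))) * (n / 5 - (x i + x (i + 1)) - 1)
        * (n / 5 - (x i + x (i + 1)) - 2) * (n / 5 - (x i + x (i + 1)) - 3) := fun i => by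
    rw [cast_toNat_choose_four (hz i)]
    push_cast
    rw [hx, hx]
    ring
  unfold gOpt gOptBase
  push_cast
  rw [mul_sub, Finset.mul_sum, Finset.mul_sum]
  simp only [h1, h2]
  have e : x 4 = -(x 0 + x 1 + x 2 + x 3) := by
    simp only [Fin.sum_univ_five] at hsum
    linarith
  simp only [Fin.sum_univ_five, Fin.isValue, Fin.reduceAdd, e]
  ring

theorem sum_sq_le_sum_sq_sub (x : Fin 5 → ℝ) (hsum : ∑ i, x i = 0) :
    ∑ i, x i ^ 2 ≤ ∑ i, (x i - x (i + 1)) ^ 2 := by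
  have e : x 4 = -(x 0 + x 1 + x 2 + x 3) := by
    simp only [Fin.sum_univ_five] at hsum
    linarith
  simp only [Fin.sum_univ_five, Fin.isValue, Fin.reduceAdd, e]
  nlinarith [sq_nonneg (x 0), sq_nonneg (x 1), sq_nonneg (x 2), sq_nonneg (x 3)]

theorem sum_sq_add_le (x : Fin 5 → ℝ) :
    ∑ i, (x i + x (i + 1)) ^ 2 ≤ 4 * ∑ i, x i ^ 2 := by
  simp only [Fin.sum_univ_five, Fin.isValue, Fin.reduceAdd]
  nlinarith [sq_nonneg (x 0 - x 1), sq_nonneg (x 1 - x 2), sq_nonneg (x 2 - x 3),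
    sq_nonneg (x 3 - x 4), sq_nonneg (x 4 - x 0)]

set_option maxHeartbeats 1600000 in
theorem exists_rotation_of_sum_sq_sub_le_two (n : ℕ) (y : Fin 5 → ℤ)
    (hsum : ∑ i, y i = 2 * n) (hQ : ∑ i, (y i - y (i + 1)) ^ 2 ≤ 2) :
    ∃ r : Fin 5, ∀ i : Fin 5, y i = yStar n (i + r) := by
  have hd : ∀ i, -1 ≤ y i - y (i + 1) ∧ y i - y (i + 1) ≤ 1 := fun i => by
    have := Finset.single_le_sum (f := fun i => (y i - y (i + 1)) ^ 2)
      (fun i _ => sq_nonneg _) (Finset.mem_univ i)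
    constructor <;> nlinarith
  simp only [Fin.sum_univ_five, Fin.isValue, Fin.reduceAdd] at hsum hQ
  obtain ⟨l0, u0⟩ := hd 0
  obtain ⟨l1, u1⟩ := hd 1
  obtain ⟨l2, u2⟩ := hd 2
  obtain ⟨l3, u3⟩ := hd 3
  simp only [Fin.isValue, Fin.reduceAdd] at l0 u0 l1 u1 l2 u2 l3 u3
  obtain ⟨d0, hd0⟩ : ∃ d, y 0 - y 1 = d := ⟨_, rfl⟩
  obtain ⟨d1, hd1⟩ : ∃ d, y 1 - y 2 = d := ⟨_, rfl⟩
  obtain ⟨d2, hd2⟩ : ∃ d, y 2 - y 3 = d := ⟨_, rfl⟩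
  obtain ⟨d3, hd3⟩ : ∃ d, y 3 - y 4 = d := ⟨_, rfl⟩
  have hd4 : y 4 - y 0 = -(d0 + d1 + d2 + d3) := by omega
  rw [hd0, hd1, hd2, hd3, hd4] at hQ
  rw [hd0] at l0 u0
  rw [hd1] at l1 u1
  rw [hd2] at l2 u2
  rw [hd3] at l3 u3
  have key : ∀ r : Fin 5, (y 0 = yStar n (0 + r) ∧ y 1 = yStar n (1 + r) ∧ y 2 = yStar n (2 + r) ∧
      y 3 = yStar n (3 + r) ∧ y 4 = yStar n (4 + r)) → ∃ r : Fin 5, ∀ i, y i = yStar n (i + r) := by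
    rintro r ⟨k0, k1, k2, k3, k4⟩
    refine ⟨r, fun i => ?_⟩
    fin_cases i <;> assumption
  have k0 := key 0
  have k1 := key 1
  have k2 := key 2
  have k3 := key 3
  have k4 := key 4
  clear key hd
  simp only [yStar, Fin.isValue, Fin.reduceAdd, Fin.coe_ofNat_eq_mod,
    Nat.reduceMod] at k0 k1 k2 k3 k4
  interval_cases d0 <;> interval_cases d1 <;> interval_cases d2 <;> interval_cases d3 <;>
    first
    | (exfalso; revert hQ; norm_num; done)
    | exact k0 (by omega)
    | exact k1 (by omega)
    | exact k2 (by omega)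
    | exact k3 (by omega)
    | exact k4 (by omega)

theorem sum_yStar (n : ℕ) : ∑ i, yStar n i = 2 * n := by
  simp only [yStar, Fin.sum_univ_five, Fin.isValue, Fin.coe_ofNat_eq_mod, Nat.reduceMod]
  have : n % 5 < 5 := Nat.mod_lt _ (by norm_num)
  interval_cases h : n % 5 <;> omega

theorem sum_sq_sub_yStar_le (n : ℕ) :
    ∑ i, (yStar n i - yStar n (i + 1)) ^ 2 ≤ 2 := by
  have h0 : 0 ≤ yStar n 1 - yStar n 0 := by simp [yStar]; omega
  have h1 : 0 ≤ yStar n 2 - yStar n 1 := by simp [yStar]; omega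
  have h2 : 0 ≤ yStar n 3 - yStar n 2 := by simp [yStar]; omega
  have h3 : 0 ≤ yStar n 4 - yStar n 3 := by simp [yStar]; omega
  have h4 : yStar n 4 - yStar n 0 ≤ 1 := by simp [yStar]; omega
  simp only [Fin.sum_univ_five, Fin.isValue, Fin.reduceAdd]
  nlinarith [mul_nonneg h0 h1, mul_nonneg h0 h2, mul_nonneg h0 h3, mul_nonneg h1 h2,
    mul_nonneg h1 h3, mul_nonneg h2 h3]

theorem abs_yStar_sub_le (n : ℕ) (i : Fin 5) : |(yStar n i : ℝ) - 2 * n / 5| ≤ 1 := by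
  have h1 : 5 * yStar n i ≤ 2 * n + 5 := by
    have := i.isLt
    simp only [yStar]
    omega
  have h2 : 2 * (n : ℤ) ≤ 5 * yStar n i + 5 := by
    simp only [yStar]
    omega
  have h1' : 5 * (yStar n i : ℝ) ≤ 2 * n + 5 := by exact_mod_cast h1
  have h2' : 2 * (n : ℝ) ≤ 5 * yStar n i + 5 := by exact_mod_cast h2
  rw [abs_le]
  constructor <;> linarith

theorem nonneg_of_abs_sub_le {n : ℕ} {y : Fin 5 → ℤ}
    (h : ∀ i, |(y i : ℝ) - 2 * n / 5| ≤ n / 1000) :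
    (∀ i, 0 ≤ y i) ∧ ∀ i, 0 ≤ (n : ℤ) - y i - y (i + 1) := by
  have hn : (0 : ℝ) ≤ n := n.cast_nonneg
  refine ⟨fun i => ?_, fun i => ?_⟩
  · have := abs_le.1 (h i)
    have : (0 : ℝ) ≤ y i := by linarith
    exact_mod_cast this
  · have := abs_le.1 (h i)
    have := abs_le.1 (h (i + 1))
    have : (0 : ℝ) ≤ n - y i - y (i + 1) := by linarith
    exact_mod_cast this

theorem sum_sub_eq_zero {n : ℕ} {y : Fin 5 → ℤ} (hsum : ∑ i, y i = 2 * n) :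
    ∑ i, ((y i : ℝ) - 2 * n / 5) = 0 := by
  have : ((∑ i, y i : ℤ) : ℝ) = 2 * n := by rw [hsum]; push_cast; rfl
  push_cast at this
  rw [Finset.sum_sub_distrib, this]
  simp
  ring

theorem le_gOpt {n : ℕ} (hn : 1000 ≤ n) {y : Fin 5 → ℤ} (hsum : ∑ i, y i = 2 * n)
    (h : ∀ i, |(y i : ℝ) - 2 * n / 5| ≤ n / 1000) :
    gOptBase n + (11 / 50 * n ^ 2) * ((∑ i, (y i - y (i + 1)) ^ 2 : ℤ) : ℝ)
      - 11 * n * ((∑ i, (y i - y (i + 1)) ^ 2 : ℤ) : ℝ) ≤ 24 * (gOpt n y : ℝ) := by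
  obtain ⟨hy, hz⟩ := nonneg_of_abs_sub_le h
  have hn' : (1000 : ℝ) ≤ n := by exact_mod_cast hn
  set x : Fin 5 → ℝ := fun i => (y i : ℝ) - 2 * n / 5 with hx
  have hx0 : ∑ i, x i = 0 := sum_sub_eq_zero hsum
  rw [gOpt_expansion n y x (fun i => by simp [hx]) hx0 hy hz]
  have hQ : ((∑ i, (y i - y (i + 1)) ^ 2 : ℤ) : ℝ) = ∑ i, (x i - x (i + 1)) ^ 2 := by
    push_cast
    simp [hx]
  rw [hQ]
  have hXQ := sum_sq_le_sum_sq_sub x hx0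
  have hSX := sum_sq_add_le x
  have hX0 : 0 ≤ ∑ i, x i ^ 2 := Finset.sum_nonneg fun i _ => sq_nonneg _
  have h1 : -(16 / 10000 * n ^ 2) * ∑ i, x i ^ 2 ≤
      ∑ i, (4 * (2 * n / 5 - 3 / 2) * x i ^ 3 + x i ^ 4) := by
    rw [Finset.mul_sum]
    refine Finset.sum_le_sum fun i _ => ?_
    have hi : -(n / 1000 : ℝ) ≤ x i := (abs_le.1 (h i)).1
    have : -(16 / 10000 * n ^ 2 : ℝ) ≤ 4 * (2 * n / 5 - 3 / 2) * x i := by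
      nlinarith
    nlinarith [mul_le_mul_of_nonneg_right this (sq_nonneg (x i)), sq_nonneg (x i ^ 2)]
  have h2 : -(17 / 10000 * n ^ 2) * ∑ i, (x i + x (i + 1)) ^ 2 ≤
      ∑ i, (4 * (n / 5 - 3 / 2) * (x i + x (i + 1)) ^ 3 - (x i + x (i + 1)) ^ 4) := by
    rw [Finset.mul_sum]
    refine Finset.sum_le_sum fun i _ => ?_
    have hi := abs_le.1 (h i)
    have hi' := abs_le.1 (h (i + 1))
    have hs : -(2 * n / 1000 : ℝ) ≤ x i + x (i + 1) := by simp only [hx]; linarith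
    have hs' : x i + x (i + 1) ≤ 2 * n / 1000 := by simp only [hx]; linarith
    generalize x i + x (i + 1) = s at hs hs'
    have : -(17 / 10000 * n ^ 2 : ℝ) ≤ 4 * (n / 5 - 3 / 2) * s - s ^ 2 := by
      have h3 : -(16 / 10000 * n ^ 2 : ℝ) ≤ 4 * (n / 5 - 3 / 2) * s := by nlinarith
      have h4 : s ^ 2 ≤ (2 * n / 1000) ^ 2 := sq_le_sq' (by linarith) hs'
      nlinarith
    nlinarith [mul_le_mul_of_nonneg_right this (sq_nonneg s)]
  have h3 : 17 / 10000 * n ^ 2 * ∑ i, (x i + x (i + 1)) ^ 2 ≤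
      17 / 10000 * (n : ℝ) ^ 2 * (4 * ∑ i, x i ^ 2) := by gcongr
  have h4 : 84 / 10000 * (n : ℝ) ^ 2 * ∑ i, x i ^ 2 ≤
      84 / 10000 * (n : ℝ) ^ 2 * ∑ i, (x i - x (i + 1)) ^ 2 := by gcongr
  have h5 : 0 ≤ (36 / 5 * n - 33) * ∑ i, x i ^ 2 := mul_nonneg (by linarith) hX0
  have hQ0 := hX0.trans hXQ
  have h6 : 0 ≤ (n : ℝ) ^ 2 * ∑ i, (x i - x (i + 1)) ^ 2 := by positivity
  have h7 : 0 ≤ (n : ℝ) * ∑ i, (x i - x (i + 1)) ^ 2 := by positivity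
  linarith

theorem gOpt_yStar_le {n : ℕ} (hn : 1000 ≤ n) :
    24 * (gOpt n (yStar n) : ℝ) ≤ gOptBase n + 12 / 25 * n ^ 2 + 100 * n := by
  have hn' : (1000 : ℝ) ≤ n := by exact_mod_cast hn
  have h : ∀ i, |(yStar n i : ℝ) - 2 * n / 5| ≤ n / 1000 :=
    fun i => (abs_yStar_sub_le n i).trans (by linarith)
  obtain ⟨hy, hz⟩ := nonneg_of_abs_sub_le h
  set x : Fin 5 → ℝ := fun i => (yStar n i : ℝ) - 2 * n / 5 with hx
  have hx0 : ∑ i, x i = 0 := sum_sub_eq_zero (sum_yStar n)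
  rw [gOpt_expansion n (yStar n) x (fun i => by simp [hx]) hx0 hy hz]
  have hQ : ∑ i, (x i - x (i + 1)) ^ 2 ≤ 2 := by
    have : ((∑ i, (yStar n i - yStar n (i + 1)) ^ 2 : ℤ) : ℝ) ≤ 2 := by
      exact_mod_cast sum_sq_sub_yStar_le n
    push_cast at this
    simpa [hx] using this
  have hx1 : ∀ i, x i ≤ 1 := fun i => (abs_le.1 (abs_yStar_sub_le n i)).2
  have hx2 : ∀ i, -1 ≤ x i := fun i => (abs_le.1 (abs_yStar_sub_le n i)).1
  have hX : ∑ i, x i ^ 2 ≤ 2 := (sum_sq_le_sum_sq_sub x hx0).trans hQ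
  have h1 : ∑ i, (4 * (2 * n / 5 - 3 / 2) * x i ^ 3 + x i ^ 4) ≤
      ∑ i : Fin 5, (8 / 5 * n : ℝ) := by
    refine Finset.sum_le_sum fun i _ => ?_
    have h3 : x i ^ 3 ≤ 1 := by nlinarith [hx1 i, hx2 i, sq_nonneg (x i)]
    have h4 : x i ^ 4 ≤ 1 := by
      have : x i ^ 2 ≤ 1 := by nlinarith [hx1 i, hx2 i]
      nlinarith [sq_nonneg (x i)]
    nlinarith
  have h2 : ∑ i, (4 * (n / 5 - 3 / 2) * (x i + x (i + 1)) ^ 3 - (x i + x (i + 1)) ^ 4) ≤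
      ∑ i : Fin 5, (32 / 5 * n : ℝ) := by
    refine Finset.sum_le_sum fun i _ => ?_
    have hs : x i + x (i + 1) ≤ 2 := by linarith [hx1 i, hx1 (i + 1)]
    generalize x i + x (i + 1) = s at hs
    have h3 : s ^ 3 ≤ 8 := by nlinarith [sq_nonneg s, sq_nonneg (s + 1)]
    nlinarith [sq_nonneg (s ^ 2)]
  simp only [Finset.sum_const, Finset.card_univ, Fintype.card_fin, nsmul_eq_mul] at h1 h2
  have h3 : (36 / 5 * n - 33) * ∑ i, x i ^ 2 ≤ (36 / 5 * n - 33 : ℝ) * 2 :=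
    mul_le_mul_of_nonneg_left hX (by linarith)
  have h4 : (6 * (n / 5 - 3 / 2) ^ 2 - 5 / 2) * ∑ i, (x i - x (i + 1)) ^ 2 ≤
      (6 * (n / 5 - 3 / 2) ^ 2 - 5 / 2 : ℝ) * 2 :=
    mul_le_mul_of_nonneg_left hQ (by nlinarith)
  push_cast at h1 h2
  nlinarith

/-- For all sufficiently small ε > 0 and large n, over integer tuples with
Σᵢ yᵢ = 2n and |yᵢ − 2n/5| < ε·n, the function g attains its minimum exactly at the
cyclic rotations of (⌊2n/5⌋, ⌊(2n+1)/5⌋, ⌊(2n+2)/5⌋, ⌊(2n+3)/5⌋, ⌊(2n+4)/5⌋). -/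
theorem c5_integer_optimization :
    ∃ ε₀ : ℝ, 0 < ε₀ ∧ ∀ ε : ℝ, 0 < ε → ε < ε₀ →
      ∃ n₀ : ℕ, ∀ n : ℕ, n₀ ≤ n →
        ∀ y : Fin 5 → ℤ,
          (∑ i : Fin 5, y i) = 2 * n →
          (∀ i : Fin 5, |(y i : ℝ) - 2 * n / 5| < ε * n) →
          gOpt n (yStar n) ≤ gOpt n y ∧
            (gOpt n y = gOpt n (yStar n) ↔
              ∃ r : Fin 5, ∀ i : Fin 5, y i = yStar n (i + r)) := by
  refine ⟨1 / 1000, by norm_num, fun ε _ hε => ⟨1000, fun n hn y hsum hy => ?_⟩⟩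
  have hn' : (1000 : ℝ) ≤ n := by exact_mod_cast hn
  by_cases hQ : ∑ i, (y i - y (i + 1)) ^ 2 ≤ 2
  · obtain ⟨r, hr⟩ := exists_rotation_of_sum_sq_sub_le_two n y hsum hQ
    have hg : gOpt n y = gOpt n (yStar n) := by
      rw [funext hr, gOpt_comp_add_right]
    exact ⟨hg.ge, fun _ => ⟨r, hr⟩, fun _ => hg⟩
  · have hlt : gOpt n (yStar n) < gOpt n y := by
      have hle := le_gOpt hn hsum fun i => (hy i).le.trans (by nlinarith)
      have hup := gOpt_yStar_le hn
      have hQ' : (3 : ℝ) ≤ ((∑ i, (y i - y (i + 1)) ^ 2 : ℤ) : ℝ) := by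
        exact_mod_cast not_le.1 hQ
      have hmul := mul_le_mul_of_nonneg_left hQ'
        (show (0 : ℝ) ≤ 11 / 50 * n ^ 2 - 11 * n by nlinarith)
      have : (gOpt n (yStar n) : ℝ) < gOpt n y := by nlinarith
      exact_mod_cast this
    refine ⟨hlt.le, fun hg => absurd hg hlt.ne', ?_⟩
    rintro ⟨r, hr⟩
    rw [funext hr, gOpt_comp_add_right]
end

section
/- There exists a constant C > 0 such that for every n ≥ 3 and every simple graph G on n vertices with independence number at most 3, t₃(G)/C(n,3) − (47/(4036·n))·Σ_{v ∈ V(G)} (deg(v)/(n−1) − 1/3)² ≥ 1/9 − C/n. -/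
/-- the degree of the vertex `v` in `G`. -/
noncomputable def degCount {V : Type*} (G : SimpleGraph V) (v : V) : ℕ :=
  {u | G.Adj v u}.ncard

namespace FlagAlgebra

/-- How a vertex attaches to three labelled vertices. -/
abbrev Flag := Bool × Bool × Bool

/-- The function on flags with the given values, in binary order of the flags, the
attachment to the first labelled vertex being the lowest digit. -/
def flagVec (c₀ c₁ c₂ c₃ c₄ c₅ c₆ c₇ : ℤ) : Flag → ℤ
  | (false, false, false) => c₀
  | (true, false, false) => c₁
  | (false, true, false) => c₂
  | (true, true, false) => c₃
  | (false, false, true) => c₄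
  | (true, false, true) => c₅
  | (false, true, true) => c₆
  | (true, true, true) => c₇

/-- The quadratic form used over a labelled triple whose only edge joins the first two vertices. -/
def edgeForm (f g : Flag) : ℤ :=
  let u := flagVec (-10) (-15) (-15) (-20) 30 12 12 (-15)
  let v := flagVec (-30) (-5) (-5) 20 10 6 6 0
  let w := flagVec (-40) (-20) (-20) 0 40 18 18 (-15)
  let p := flagVec 0 1 (-1) 0 0 (-1) 1 0
  let q := flagVec 0 1 (-1) 0 0 0 0 0
  let r := flagVec 0 0 0 0 0 1 (-1) 0
  4713 * (u f * u g) + 1887 * (v f * v g) + 63 * (w f * w g) + 405000 * (p f * p g)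
    + 1365500 * (q f * q g) + 2345000 * (r f * r g)

/-- The quadratic form used over a labelled induced path centred at the first vertex. -/
def pathForm (f g : Flag) : ℤ :=
  let u := flagVec 17 20 (-8) (-9) (-8) (-9) (-5) (-3)
  let v := flagVec 3 (-2) 2 (-5) 2 (-5) 1 (-2)
  let w := flagVec 20 18 (-6) (-14) (-6) (-14) (-4) (-5)
  15035 * (u f * u g) + 63965 * (v f * v g) + 10 * (w f * w g)

/-- The quadratic form used over a labelled triangle. -/
def triangleForm (f g : Flag) : ℤ :=
  let u := flagVec (-5) (-2) (-2) 7 (-2) 7 7 10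
  let v := flagVec (-1) 0 0 2 0 2 2 2
  7747 * (u f * u g) + 57525 * (v f * v g)

/-- The quadratic form belonging to a labelled triple with prescribed edges `01`, `02`, `12`. -/
def typeForm : Bool → Bool → Bool → Flag → Flag → ℤ
  | true, false, false => edgeForm
  | true, true, false => pathForm
  | true, true, true => triangleForm
  | _, _, _ => fun _ _ => 0

/-- The contribution of a labelled triple to the triangle count, minus its contribution to
the degree variance and to the constant term. -/
def tripleTerm (a b c : Bool) : ℤ :=
  1137600 * (a && b && c).toInt - 126400 - 1600 * ((3 * a.toInt - 1) * (3 * b.toInt - 1))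

/-- The integrand of the flag algebra certificate. -/
def integrand (a b c : Bool) (f g : Flag) : ℤ :=
  tripleTerm a b c - typeForm a b c f g

/-- The integrand summed over the cyclic relabellings of the triple. -/
def cyclicSum (a b c f₀ f₁ f₂ g₀ g₁ g₂ : Bool) : ℤ :=
  integrand a b c (f₀, f₁, f₂) (g₀, g₁, g₂)
    + integrand c a b (f₁, f₂, f₀) (g₁, g₂, g₀)
    + integrand b c a (f₂, f₀, f₁) (g₂, g₀, g₁)

theorem cyclicSum_total_nonneg : ∀ a₀₁ a₀₂ a₀₃ a₀₄ a₁₂ a₁₃ a₁₄ a₂₃ a₂₄ a₃₄ : Bool,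
    (a₀₁ || a₀₂ || a₀₃ || a₁₂ || a₁₃ || a₂₃) = true →
    (a₀₁ || a₀₂ || a₀₄ || a₁₂ || a₁₄ || a₂₄) = true →
    (a₀₁ || a₀₃ || a₀₄ || a₁₃ || a₁₄ || a₃₄) = true →
    (a₀₂ || a₀₃ || a₀₄ || a₂₃ || a₂₄ || a₃₄) = true →
    (a₁₂ || a₁₃ || a₁₄ || a₂₃ || a₂₄ || a₃₄) = true →
    0 ≤ cyclicSum a₀₁ a₀₂ a₁₂ a₀₃ a₁₃ a₂₃ a₀₄ a₁₄ a₂₄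
      + cyclicSum a₀₁ a₀₃ a₁₃ a₀₂ a₁₂ a₂₃ a₀₄ a₁₄ a₃₄
      + cyclicSum a₀₁ a₀₄ a₁₄ a₀₂ a₁₂ a₂₄ a₀₃ a₁₃ a₃₄
      + cyclicSum a₀₂ a₀₃ a₂₃ a₀₁ a₁₂ a₁₃ a₀₄ a₂₄ a₃₄
      + cyclicSum a₀₂ a₀₄ a₂₄ a₀₁ a₁₂ a₁₄ a₀₃ a₂₃ a₃₄
      + cyclicSum a₀₃ a₀₄ a₃₄ a₀₁ a₁₃ a₁₄ a₀₂ a₂₃ a₂₄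
      + cyclicSum a₁₂ a₁₃ a₂₃ a₀₁ a₀₂ a₀₃ a₁₄ a₂₄ a₃₄
      + cyclicSum a₁₂ a₁₄ a₂₄ a₀₁ a₀₂ a₀₄ a₁₃ a₂₃ a₃₄
      + cyclicSum a₁₃ a₁₄ a₃₄ a₀₁ a₀₃ a₀₄ a₁₂ a₂₃ a₂₄
      + cyclicSum a₂₃ a₂₄ a₃₄ a₀₂ a₀₃ a₀₄ a₁₂ a₁₃ a₁₄ := by
  decide +kernel

section Averaging

variable {V : Type*}

theorem sum_comp_injective [Fintype V] {k : ℕ} (φ : (Fin k → V) → ℤ) {s : Fin k → Fin k}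
    (hs : Function.Injective s) : ∑ x : Fin k → V, φ (x ∘ s) = ∑ x : Fin k → V, φ x := by
  let e := Equiv.ofBijective s (Finite.injective_iff_bijective.mp hs)
  exact Equiv.sum_comp (e.symm.arrowCongr (Equiv.refl V)) φ

theorem sum_fin_five [Fintype V] (φ : V → V → V → V → V → ℤ) :
    ∑ x : Fin 5 → V, φ (x 0) (x 1) (x 2) (x 3) (x 4) =
      ∑ a, ∑ b, ∑ c, ∑ d, ∑ e, φ a b c d e := by
  let e : (Fin 5 → V) ≃ V × V × V × V × V :=
    { toFun := fun x => (x 0, x 1, x 2, x 3, x 4)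
      invFun := fun p => ![p.1, p.2.1, p.2.2.1, p.2.2.2.1, p.2.2.2.2]
      left_inv := fun x => by ext i; fin_cases i <;> rfl
      right_inv := fun _ => rfl }
  refine (Fintype.sum_equiv e _ (fun p => φ p.1 p.2.1 p.2.2.1 p.2.2.2.1 p.2.2.2.2)
    fun _ => rfl).trans ?_
  simp only [Fintype.sum_prod_type]

/-- The integrand at five vertices, the first three of which form the labelled triple. -/
def integrandAt (r : V → V → Bool) (x : Fin 5 → V) : ℤ :=
  integrand (r (x 0) (x 1)) (r (x 0) (x 2)) (r (x 1) (x 2))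
    (r (x 0) (x 3), r (x 1) (x 3), r (x 2) (x 3)) (r (x 0) (x 4), r (x 1) (x 4), r (x 2) (x 4))

theorem cyclicSum_eq {r : V → V → Bool} (hr : ∀ u v, r u v = r v u) (x : Fin 5 → V) :
    cyclicSum (r (x 0) (x 1)) (r (x 0) (x 2)) (r (x 1) (x 2)) (r (x 0) (x 3)) (r (x 1) (x 3))
        (r (x 2) (x 3)) (r (x 0) (x 4)) (r (x 1) (x 4)) (r (x 2) (x 4)) =
      integrandAt r x + integrandAt r (x ∘ ![1, 2, 0, 3, 4])
        + integrandAt r (x ∘ ![2, 0, 1, 3, 4]) := by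
  simp [cyclicSum, integrandAt, hr (x 1) (x 0), hr (x 2) (x 0), hr (x 2) (x 1)]

theorem sum_cyclicSum [Fintype V] {r : V → V → Bool} (hr : ∀ u v, r u v = r v u)
    {s : Fin 5 → Fin 5} (hs : Function.Injective s) :
    ∑ x : Fin 5 → V, cyclicSum (r (x (s 0)) (x (s 1))) (r (x (s 0)) (x (s 2)))
        (r (x (s 1)) (x (s 2))) (r (x (s 0)) (x (s 3))) (r (x (s 1)) (x (s 3)))
        (r (x (s 2)) (x (s 3))) (r (x (s 0)) (x (s 4))) (r (x (s 1)) (x (s 4)))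
        (r (x (s 2)) (x (s 4))) =
      3 * ∑ x, integrandAt r x := by
  refine (Finset.sum_congr rfl fun x _ => cyclicSum_eq hr (x ∘ s)).trans ?_
  rw [sum_comp_injective (fun y => integrandAt r y + integrandAt r (y ∘ ![1, 2, 0, 3, 4])
        + integrandAt r (y ∘ ![2, 0, 1, 3, 4])) hs,
    Finset.sum_add_distrib, Finset.sum_add_distrib, sum_comp_injective _ (by decide),
    sum_comp_injective _ (by decide)]
  ring

theorem sum_integrandAt_nonneg [Fintype V] {r : V → V → Bool} (hr : ∀ u v, r u v = r v u)
    (h : ∀ a b c d, (r a b || r a c || r a d || r b c || r b d || r c d) = true) :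
    0 ≤ ∑ x, integrandAt r x := by
  have key := Finset.sum_nonneg (s := Finset.univ) fun (x : Fin 5 → V) _ =>
    cyclicSum_total_nonneg (r (x 0) (x 1)) (r (x 0) (x 2)) (r (x 0) (x 3)) (r (x 0) (x 4))
      (r (x 1) (x 2)) (r (x 1) (x 3)) (r (x 1) (x 4)) (r (x 2) (x 3)) (r (x 2) (x 4))
      (r (x 3) (x 4)) (h _ _ _ _) (h _ _ _ _) (h _ _ _ _) (h _ _ _ _) (h _ _ _ _)
  have e₁ := sum_cyclicSum hr (s := ![0, 1, 2, 3, 4]) (by decide)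
  have e₂ := sum_cyclicSum hr (s := ![0, 1, 3, 2, 4]) (by decide)
  have e₃ := sum_cyclicSum hr (s := ![0, 1, 4, 2, 3]) (by decide)
  have e₄ := sum_cyclicSum hr (s := ![0, 2, 3, 1, 4]) (by decide)
  have e₅ := sum_cyclicSum hr (s := ![0, 2, 4, 1, 3]) (by decide)
  have e₆ := sum_cyclicSum hr (s := ![0, 3, 4, 1, 2]) (by decide)
  have e₇ := sum_cyclicSum hr (s := ![1, 2, 3, 0, 4]) (by decide)
  have e₈ := sum_cyclicSum hr (s := ![1, 2, 4, 0, 3]) (by decide)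
  have e₉ := sum_cyclicSum hr (s := ![1, 3, 4, 0, 2]) (by decide)
  have e₁₀ := sum_cyclicSum hr (s := ![2, 3, 4, 0, 1]) (by decide)
  have swap : ∀ (x : Fin 5 → V) (i j : Fin 5), r (x i) (x j) = r (x j) (x i) :=
    fun x i j => hr _ _
  simp only [Matrix.cons_val, swap _ 1 0, swap _ 2 0, swap _ 3 0, swap _ 4 0, swap _ 2 1,
    swap _ 3 1, swap _ 4 1, swap _ 3 2, swap _ 4 2, swap _ 4 3] at e₁ e₂ e₃ e₄ e₅ e₆ e₇ e₈ e₉ e₁₀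
  simp only [Finset.sum_add_distrib, e₁, e₂, e₃, e₄, e₅, e₆, e₇, e₈, e₉, e₁₀] at key
  linarith

theorem sum_typeForm_nonneg [Fintype V] (a b c : Bool) (f : V → Flag) :
    0 ≤ ∑ d, ∑ e, typeForm a b c (f d) (f e) := by
  rcases a <;> rcases b <;> rcases c <;>
    simp only [typeForm, edgeForm, pathForm, triangleForm, Finset.sum_const_zero, le_refl,
      Finset.sum_add_distrib, ← Finset.mul_sum, ← Finset.sum_mul, ← sq] <;>
    positivity

theorem sum_tripleTerm_nonneg [Fintype V] {r : V → V → Bool} (hr : ∀ u v, r u v = r v u)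
    (h : ∀ a b c d, (r a b || r a c || r a d || r b c || r b d || r c d) = true) :
    0 ≤ ∑ a, ∑ b, ∑ c, tripleTerm (r a b) (r a c) (r b c) := by
  rcases isEmpty_or_nonempty V with _ | _
  · simp
  have key := sum_integrandAt_nonneg hr h
  simp only [integrandAt] at key
  rw [sum_fin_five fun a b c d e => integrand (r a b) (r a c) (r b c)
    (r a d, r b d, r c d) (r a e, r b e, r c e)] at key
  have bound : ∀ a b c, ∑ d, ∑ e, integrand (r a b) (r a c) (r b c)
      (r a d, r b d, r c d) (r a e, r b e, r c e) ≤
      (Fintype.card V : ℤ) ^ 2 * tripleTerm (r a b) (r a c) (r b c) := fun a b c => by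
    have := sum_typeForm_nonneg (r a b) (r a c) (r b c) fun d => (r a d, r b d, r c d)
    simp only [integrand, Finset.sum_sub_distrib, Finset.sum_const, Finset.card_univ,
      nsmul_eq_mul]
    linarith
  have := key.trans (Finset.sum_le_sum fun a _ => Finset.sum_le_sum fun b _ =>
    Finset.sum_le_sum fun c _ => bound a b c)
  simp only [← Finset.mul_sum] at this
  exact nonneg_of_mul_nonneg_right this (by positivity)

theorem sum_tripleTerm [Fintype V] (r : V → V → Bool) :
    ∑ a, ∑ b, ∑ c, tripleTerm (r a b) (r a c) (r b c) =
      1137600 * ∑ a, ∑ b, ∑ c, (r a b && r a c && r b c).toInt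
        - 126400 * (Fintype.card V : ℤ) ^ 3
        - 1600 * ∑ a, (3 * ∑ b, (r a b).toInt - (Fintype.card V : ℤ)) ^ 2 := by
  have inner : ∀ a, 3 * ∑ b, (r a b).toInt - (Fintype.card V : ℤ) =
      ∑ b, (3 * (r a b).toInt - 1) := fun a => by
    simp [Finset.mul_sum]
  simp only [inner, sq (∑ b, _), Finset.sum_mul_sum]
  simp only [tripleTerm, Finset.sum_sub_distrib, Finset.mul_sum, Finset.sum_const,
    Finset.card_univ, nsmul_eq_mul]
  ring

end Averaging

end FlagAlgebra

section Transfer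

open Finset

variable {V : Type*}

theorem card_triangle_tuples_le [Fintype V] [DecidableEq V] (G : SimpleGraph V)
    [DecidableRel G.Adj] :
    #{p : V × V × V | G.Adj p.1 p.2.1 ∧ G.Adj p.1 p.2.2 ∧ G.Adj p.2.1 p.2.2} ≤
      6 * #(G.cliqueFinset 3) := by
  refine card_le_mul_card_image_of_maps_to (f := fun p => {p.1, p.2.1, p.2.2}) ?_ 6 ?_
  · rintro ⟨a, b, c⟩ h
    simp only [mem_filter, mem_univ, true_and] at h
    simpa [SimpleGraph.mem_cliqueFinset_iff, SimpleGraph.is3Clique_triple_iff] using h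
  · intro s hs
    obtain ⟨x, y, z, -, -, -, rfl⟩ := SimpleGraph.is3Clique_iff.mp
      ((SimpleGraph.mem_cliqueFinset_iff ..).mp hs)
    refine (card_le_card (t := {(x, y, z), (x, z, y), (y, x, z), (y, z, x), (z, x, y),
      (z, y, x)}) ?_).trans card_le_six
    rintro ⟨a, b, c⟩ h
    simp only [mem_filter, mem_univ, true_and] at h
    obtain ⟨⟨hab, hac, hbc⟩, h⟩ := h
    have ha : a ∈ ({x, y, z} : Finset V) := by simp [← h]
    have hb : b ∈ ({x, y, z} : Finset V) := by simp [← h]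
    have hc : c ∈ ({x, y, z} : Finset V) := by simp [← h]
    have := hab.ne
    have := hac.ne
    have := hbc.ne
    simp only [mem_insert, mem_singleton, Prod.mk.injEq] at ha hb hc ⊢
    clear h hs
    grind

/-- The reflexive closure of adjacency, as a Boolean relation. -/
def reflAdj [DecidableEq V] (G : SimpleGraph V) [DecidableRel G.Adj] (u v : V) : Bool :=
  decide (u = v ∨ G.Adj u v)

theorem sum_reflAdj [Fintype V] [DecidableEq V] (G : SimpleGraph V) [DecidableRel G.Adj] (v : V) :
    ∑ u, (reflAdj G v u).toInt = G.degree v + 1 := by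
  have split : ∀ u, (reflAdj G v u).toInt =
      (if G.Adj v u then 1 else 0) + (if v = u then 1 else 0) := fun u => by
    by_cases h : v = u <;> by_cases h' : G.Adj v u <;> simp_all [reflAdj]
  simp [split, sum_add_distrib, ← SimpleGraph.card_neighborFinset_eq_degree,
    SimpleGraph.neighborFinset_eq_filter]

theorem sum_reflAdj_triangles_le [Fintype V] [DecidableEq V] (G : SimpleGraph V)
    [DecidableRel G.Adj] :
    ∑ a, ∑ b, ∑ c, (reflAdj G a b && reflAdj G a c && reflAdj G b c).toInt ≤
      6 * #(G.cliqueFinset 3) + 3 * (Fintype.card V : ℤ) ^ 2 := by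
  have bound : ∀ a b c, (reflAdj G a b && reflAdj G a c && reflAdj G b c).toInt ≤
      (if G.Adj a b ∧ G.Adj a c ∧ G.Adj b c then 1 else 0) + (if a = b then 1 else 0)
        + (if a = c then 1 else 0) + (if b = c then 1 else 0) := fun a b c => by
    grind [reflAdj, Bool.toInt]
  have count : ∑ a, ∑ b, ∑ c, (if G.Adj a b ∧ G.Adj a c ∧ G.Adj b c then (1 : ℤ) else 0) ≤
      6 * #(G.cliqueFinset 3) := by
    have := card_triangle_tuples_le G
    rw [card_filter, Fintype.sum_prod_type] at this
    simp only [Fintype.sum_prod_type] at this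
    exact_mod_cast this
  calc _ ≤ _ := sum_le_sum fun a _ => sum_le_sum fun b _ => sum_le_sum fun c _ => bound a b c
    _ ≤ _ := by
      simp only [sum_add_distrib, sum_ite_eq, mem_univ, if_true, sum_const, card_univ,
        nsmul_eq_mul, mul_one]
      simp only [← mul_sum, sum_ite_eq, mem_univ, if_true, sum_const, card_univ,
        nsmul_eq_mul, mul_one]
      linarith

theorem reflAdj_of_indepBound [DecidableEq V] {G : SimpleGraph V} [DecidableRel G.Adj]
    (hG : IndepBound G 3) (a b c d : V) :
    (reflAdj G a b || reflAdj G a c || reflAdj G a d || reflAdj G b c || reflAdj G b d ||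
      reflAdj G c d) = true := by
  by_contra h
  simp only [reflAdj, Bool.or_eq_true, decide_eq_true_eq, not_or] at h
  obtain ⟨⟨⟨⟨⟨hab, hac⟩, had⟩, hbc⟩, hbd⟩, hcd⟩ := h
  have := hG {a, b, c, d} (by simp [G.adj_comm, *])
  rw [card_insert_of_notMem (by simp [*]), card_insert_of_notMem (by simp [*]),
    card_pair hcd.1] at this
  omega

theorem triangle_degree_inequality [Fintype V] [DecidableEq V] {G : SimpleGraph V}
    [DecidableRel G.Adj] (hG : IndepBound G 3) :
    79 * (Fintype.card V : ℤ) ^ 3 + ∑ v, (3 * ((G.degree v : ℤ) + 1) - Fintype.card V) ^ 2 ≤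
      711 * (6 * #(G.cliqueFinset 3) + 3 * (Fintype.card V : ℤ) ^ 2) := by
  have key := FlagAlgebra.sum_tripleTerm_nonneg (r := reflAdj G)
    (fun u v => by simp [reflAdj, G.adj_comm, eq_comm]) (reflAdj_of_indepBound hG)
  rw [FlagAlgebra.sum_tripleTerm] at key
  simp only [sum_reflAdj] at key
  linarith [sum_reflAdj_triangles_le G]

theorem cliqueCount_eq [Fintype V] [DecidableEq V] (G : SimpleGraph V) [DecidableRel G.Adj]
    (k : ℕ) :
    cliqueCount G k = #(G.cliqueFinset k) := by
  rw [cliqueCount, Nat.card_eq_fintype_card, Fintype.card_subtype]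
  congr 1
  ext s
  simp [SimpleGraph.mem_cliqueFinset_iff, SimpleGraph.isNClique_iff, and_comm]

theorem degCount_eq [Fintype V] (G : SimpleGraph V) [DecidableRel G.Adj] (v : V) :
    degCount G v = G.degree v := by
  rw [degCount, ← SimpleGraph.card_neighborFinset_eq_degree,
    SimpleGraph.neighborFinset_eq_filter, ← Set.ncard_coe_finset]
  simp

end Transfer

/-- There is C > 0 such that every graph G on n ≥ 3 vertices with α(G) ≤ 3 satisfies
t₃(G)/C(n,3) − (47/(4036n))·Σ_v (deg(v)/(n−1) − 1/3)² ≥ 1/9 − C/n. -/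
theorem erdos_34_flag_inequality :
    ∃ C : ℝ, 0 < C ∧ ∀ n : ℕ, 3 ≤ n →
      ∀ G : SimpleGraph (Fin n), IndepBound G 3 →
        (cliqueCount G 3 : ℝ) / (n.choose 3)
            - (47 / (4036 * n))
              * ∑ v : Fin n, ((degCount G v : ℝ) / (n - 1) - 1/3) ^ 2
          ≥ 1/9 - C / n := by
  classical
  refine ⟨10, by norm_num, fun n hn G hG => ?_⟩
  have key := triangle_degree_inequality hG
  simp only [← degCount_eq, ← cliqueCount_eq, Fintype.card_fin] at key
  have key' : 79 * (n : ℝ) ^ 3 + ∑ v, (3 * ((degCount G v : ℝ) + 1) - n) ^ 2 ≤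
      711 * (6 * cliqueCount G 3 + 3 * (n : ℝ) ^ 2) := by exact_mod_cast key
  have hn' : (3 : ℝ) ≤ n := by exact_mod_cast hn
  have shift : 9 * ((n : ℝ) - 1) ^ 2 * ∑ v, ((degCount G v : ℝ) / (n - 1) - 1 / 3) ^ 2
      - 8 * (n : ℝ) ^ 2 ≤ ∑ v, (3 * ((degCount G v : ℝ) + 1) - n) ^ 2 := by
    have pointwise : ∀ v, 9 * ((n : ℝ) - 1) ^ 2 * ((degCount G v : ℝ) / (n - 1) - 1 / 3) ^ 2
        - 8 * n ≤ (3 * ((degCount G v : ℝ) + 1) - n) ^ 2 := fun v => by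
      have hd : (0 : ℝ) ≤ degCount G v := Nat.cast_nonneg _
      have : 9 * ((n : ℝ) - 1) ^ 2 * ((degCount G v : ℝ) / (n - 1) - 1 / 3) ^ 2 =
          (3 * degCount G v - (n - 1)) ^ 2 := by
        have : (n : ℝ) - 1 ≠ 0 := by linarith
        field_simp
        ring
      nlinarith
    have := Finset.sum_le_sum fun v (_ : v ∈ Finset.univ) => pointwise v
    simp only [Finset.sum_sub_distrib, ← Finset.mul_sum, Finset.sum_const, Finset.card_univ,
      Fintype.card_fin, nsmul_eq_mul] at this
    linarith
  have hS : 0 ≤ ∑ v, ((degCount G v : ℝ) / (n - 1) - 1 / 3) ^ 2 :=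
    Finset.sum_nonneg fun _ _ => sq_nonneg _
  have ht : (0 : ℝ) ≤ cliqueCount G 3 := Nat.cast_nonneg _
  have hc : (0 : ℝ) < n.choose 3 := by exact_mod_cast Nat.choose_pos hn
  have hc' : 6 * (n.choose 3 : ℝ) ≤ n * (n - 1) ^ 2 := by
    obtain ⟨k, rfl⟩ := Nat.exists_eq_add_of_le' hn
    have := Nat.descFactorial_eq_factorial_mul_choose (k + 3) 3
    simp only [Nat.descFactorial, Nat.factorial, Nat.reduceSubDiff, tsub_zero] at this
    have : ((k + 3) * (k + 2) * (k + 1) : ℝ) = 6 * (k + 3).choose 3 := by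
      norm_cast
      linarith
    push_cast at *
    nlinarith
  generalize (cliqueCount G 3 : ℝ) = t at *
  generalize ∑ v, ((degCount G v : ℝ) / (n - 1) - 1 / 3) ^ 2 = S at *
  generalize (n.choose 3 : ℝ) = c at *
  suffices h : 1 / 9 - 10 / n + 47 / (4036 * n) * S ≤ t / c by linarith
  rw [le_div_iff₀ hc]
  rcases le_total (1 / 9 - 10 / n + 47 / (4036 * n) * S) 0 with hR | hR
  · exact (mul_nonpos_of_nonpos_of_nonneg hR hc.le).trans ht
  have h₁ := mul_le_mul_of_nonneg_left hc' hR
  have h₂ : (1 / 9 - 10 / n + 47 / (4036 * n) * S) * (n * (n - 1) ^ 2) =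
      (n - 1) ^ 2 * (n / 9 - 10 + 47 / 4036 * S) := by
    field_simp
  nlinarith [mul_nonneg (sq_nonneg ((n : ℝ) - 1)) hS]
end

section
/- For every real ε with 0 < ε < 1/30 there exists n₀ = n₀(ε) such that the following holds for all n ≥ n₀. If G is a simple graph on n vertices with independence number at most 3 and t₃(G) < (1/9 + ε⁵)·C(n,3), then there exist pairwise disjoint sets C₁, C₂, C₃ ⊆ V(G), each a clique in G, such that |C₁ ∪ C₂ ∪ C₃| ≥ (1 − 100ε³)·n, each C_i satisfies (1/3 − 3ε)·n ≤ |C_i| ≤ (1/3 + ε)·n, and every vertex of C_i is adjacent to at most 4ε·n vertices of (C₁ ∪ C₂ ∪ C₃) ∖ C_i. -/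
namespace Erdos34

/-- The integer value of an adjacency bit. -/
def bit : Bool → ℤ
  | true => 1
  | false => 0

def edgeVec (x y z : Bool) : Fin 4 → ℤ :=
  match x, y, z with
  | true, true, true => ![1, 0, 0, 0]
  | true, true, false => ![0, 1, 0, 0]
  | true, false, true => ![0, 1, 0, 0]
  | false, true, true => ![0, 0, 1, 1]
  | false, false, false => ![0, 0, -1, 1]
  | true, false, false => ![0, 0, 0, -2]
  | false, true, false => ![0, 0, 0, 1]
  | false, false, true => ![0, 0, 0, 1]

def edgeSkewVec (x y z : Bool) : Fin 2 → ℤ :=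
  match x, y, z with
  | true, true, false => ![0, 1]
  | true, false, true => ![0, -1]
  | false, true, false => ![1, 0]
  | false, false, true => ![-1, 0]
  | _, _, _ => ![0, 0]

/-- Here `z` is the centre of the path. -/
def pathVec (x y z : Bool) : Fin 5 → ℤ :=
  match x, y, z with
  | false, false, true => ![1, 0, 0, 0, 0]
  | true, true, false => ![0, 1, 0, 0, 0]
  | true, true, true => ![0, 0, 1, 0, 0]
  | false, false, false => ![0, 0, 0, 1, 1]
  | true, false, false => ![0, 0, 0, -1, 0]
  | false, true, false => ![0, 0, 0, -1, 0]
  | true, false, true => ![0, 0, 0, 0, -1]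
  | false, true, true => ![0, 0, 0, 0, -1]

def triVec (x y z : Bool) : Fin 3 → ℤ :=
  match x, y, z with
  | true, true, true => ![0, 0, 2]
  | false, false, false => ![0, 0, -1]
  | true, true, false => ![0, 1, 0]
  | true, false, true => ![0, 1, 0]
  | false, true, true => ![0, 1, 0]
  | true, false, false => ![1, 0, 0]
  | false, true, false => ![1, 0, 0]
  | false, false, true => ![1, 0, 0]

def edgeMat : Fin 4 → Fin 4 → ℤ :=
  ![![360, -234, 132, 198], ![-234, 216, -36, -186], ![132, -36, 210, 15], ![198, -186, 15, 180]]

def edgeSkewMat : Fin 2 → Fin 2 → ℤ := ![![270, -36], ![-36, 558]]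

def pathMat : Fin 5 → Fin 5 → ℤ :=
  ![![1224, -612, -72, 450, 396], ![-612, 756, -234, -270, 72], ![-72, -234, 324, 36, -306],
    ![450, -270, 36, 198, 72], ![396, 72, -306, 72, 438]]

def triMat : Fin 3 → Fin 3 → ℤ := ![![36, -54, -28], ![-54, 90, 36], ![-28, 36, 40]]

/-- The bilinear form with matrix `M`. -/
def form {k : ℕ} (M : Fin k → Fin k → ℤ) (f g : Fin k → ℤ) : ℤ := ∑ i, ∑ j, M i j * f i * g j

/-- Whether at least two of three bits are set. -/
def maj (x y z : Bool) : Bool := (x && y) || (x && z) || (y && z)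

/-- The flag-algebra weight of a labelled reflexive graph on five vertices. -/
def weight (ij ik jk il jl kl im jm km lm : Bool) : ℤ :=
  180 * bit (ij && ik && jk) - 20
    - 6 * bit (!ij && !ik && !jk && maj il jl kl && maj im jm km)
    - 6 * bit (!jk && jl && kl && jm && km && lm)
    - bit (!ij && !ik && jk) * (form edgeMat (edgeVec il jl kl) (edgeVec im jm km)
        + form edgeSkewMat (edgeSkewVec il jl kl) (edgeSkewVec im jm km))
    - bit (ij && ik && !jk) * form pathMat (pathVec jl kl il) (pathVec jm km im)
    - bit (ij && ik && jk) * form triMat (triVec il jl kl) (triVec im jm km)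

/-- `weight` at five vertices of a relation. -/
def relWeight {V : Type*} (A : V → V → Bool) (i j k l m : V) : ℤ :=
  weight (A i j) (A i k) (A j k) (A i l) (A j l) (A k l) (A i m) (A j m) (A k m) (A l m)

/-- Evaluation of a function of bits that presents it with literal arguments only. -/
def force {α : Type} (f : Bool → α) (b : Bool) : α :=
  match b with
  | true => f true
  | false => f false

/-- The positive part of `weight`. -/
def posWeight (a b c d e g h i j k : Bool) : ℕ := (weight a b c d e g h i j k).toNat

/-- The negative part of `weight`. -/
def negWeight (a b c d e g h i j k : Bool) : ℕ := (-weight a b c d e g h i j k).toNat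

/-- The sum of `w` over thirty labellings of the five-vertex graph with the given adjacency bits. -/
def sumLab (w : Bool → Bool → Bool → Bool → Bool → Bool → Bool → Bool → Bool → Bool → ℕ)
    (b01 b02 b03 b04 b12 b13 b14 b23 b24 b34 : Bool) : ℕ :=
  w b01 b02 b12 b03 b13 b23 b04 b14 b24 b34 +
  w b01 b03 b13 b02 b12 b23 b04 b14 b34 b24 +
  w b01 b04 b14 b02 b12 b24 b03 b13 b34 b23 +
  w b02 b03 b23 b01 b12 b13 b04 b24 b34 b14 +
  w b02 b04 b24 b01 b12 b14 b03 b23 b34 b13 +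
  w b03 b04 b34 b01 b13 b14 b02 b23 b24 b12 +
  w b01 b12 b02 b13 b03 b23 b14 b04 b24 b34 +
  w b01 b13 b03 b12 b02 b23 b14 b04 b34 b24 +
  w b01 b14 b04 b12 b02 b24 b13 b03 b34 b23 +
  w b12 b13 b23 b01 b02 b03 b14 b24 b34 b04 +
  w b12 b14 b24 b01 b02 b04 b13 b23 b34 b03 +
  w b13 b14 b34 b01 b03 b04 b12 b23 b24 b02 +
  w b02 b12 b01 b23 b03 b13 b24 b04 b14 b34 +
  w b02 b23 b03 b12 b01 b13 b24 b04 b34 b14 +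
  w b02 b24 b04 b12 b01 b14 b23 b03 b34 b13 +
  w b12 b23 b13 b02 b01 b03 b24 b14 b34 b04 +
  w b12 b24 b14 b02 b01 b04 b23 b13 b34 b03 +
  w b23 b24 b34 b02 b03 b04 b12 b13 b14 b01 +
  w b03 b13 b01 b23 b02 b12 b34 b04 b14 b24 +
  w b03 b23 b02 b13 b01 b12 b34 b04 b24 b14 +
  w b03 b34 b04 b13 b01 b14 b23 b02 b24 b12 +
  w b13 b23 b12 b03 b01 b02 b34 b14 b24 b04 +
  w b13 b34 b14 b03 b01 b04 b23 b12 b24 b02 +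
  w b23 b34 b24 b03 b02 b04 b13 b12 b14 b01 +
  w b04 b14 b01 b24 b02 b12 b34 b03 b13 b23 +
  w b04 b24 b02 b14 b01 b12 b34 b03 b23 b13 +
  w b04 b34 b03 b14 b01 b13 b24 b02 b23 b12 +
  w b14 b24 b12 b04 b01 b02 b34 b13 b23 b03 +
  w b14 b34 b13 b04 b01 b03 b24 b12 b23 b02 +
  w b24 b34 b23 b04 b02 b03 b14 b12 b13 b01

/-- Whether `f` holds for both bits. -/
def allBits (f : Bool → Bool) : Bool := f true && f false

/-- Whether every four of the five vertices span an edge. -/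
def hasEdges (b01 b02 b03 b04 b12 b13 b14 b23 b24 b34 : Bool) : Bool :=
  (b01 || b02 || b03 || b12 || b13 || b23) &&
  (b01 || b02 || b04 || b12 || b14 || b24) &&
  (b01 || b03 || b04 || b13 || b14 || b34) &&
  (b02 || b03 || b04 || b23 || b24 || b34) &&
  (b12 || b13 || b14 || b23 || b24 || b34)

/-- The positive part of the symmetrized weight dominates the negative part. -/
def check (b01 b02 b03 b04 b12 b13 b14 b23 b24 b34 : Bool) : Bool :=
  !hasEdges b01 b02 b03 b04 b12 b13 b14 b23 b24 b34 ||
    Nat.ble (sumLab negWeight b01 b02 b03 b04 b12 b13 b14 b23 b24 b34)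
      (sumLab posWeight b01 b02 b03 b04 b12 b13 b14 b23 b24 b34)

set_option maxRecDepth 100000 in
theorem check_all : (
    allBits <| force fun b01 => allBits <| force fun b02 => allBits <| force fun b03 =>
    allBits <| force fun b04 => allBits <| force fun b12 => allBits <| force fun b13 =>
    allBits <| force fun b14 => allBits <| force fun b23 => allBits <| force fun b24 =>
    allBits <| force fun b34 => check b01 b02 b03 b04 b12 b13 b14 b23 b24 b34) = true := by
  decide +kernel

theorem of_allBits_force {f : Bool → Bool} (h : allBits (force f) = true) (b : Bool) :
    f b = true := by
  simp only [allBits, force, Bool.and_eq_true] at h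
  cases b
  exacts [h.2, h.1]

theorem sumLab_negWeight_le (b01 b02 b03 b04 b12 b13 b14 b23 b24 b34 : Bool)
    (h : hasEdges b01 b02 b03 b04 b12 b13 b14 b23 b24 b34 = true) :
    sumLab negWeight b01 b02 b03 b04 b12 b13 b14 b23 b24 b34 ≤
      sumLab posWeight b01 b02 b03 b04 b12 b13 b14 b23 b24 b34 := by
  have hc := of_allBits_force (of_allBits_force (of_allBits_force (of_allBits_force
    (of_allBits_force (of_allBits_force (of_allBits_force (of_allBits_force (of_allBits_force
    (of_allBits_force check_all b01) b02) b03) b04) b12) b13) b14) b23) b24) b34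
  rw [check, h] at hc
  exact Nat.le_of_ble_eq_true hc

section Core

variable {V : Type*} [Fintype V]

theorem sum_relabel (f : (Fin 5 → V) → ℕ) (σ : Fin 5 → Fin 5)
    (hσ : Function.Injective σ) : ∑ x, f (x ∘ σ) = ∑ x, f x := by
  classical
  have hb : Function.Bijective σ := Finite.injective_iff_bijective.1 hσ
  exact Fintype.sum_equiv ((Equiv.ofBijective σ hb).symm.arrowCongr (Equiv.refl V)) _ _
    fun x => by congr 1

/-- `w` evaluated at the adjacency bits of five vertices. -/
def atVertices {α : Type*} (w : Bool → Bool → Bool → Bool → Bool → Bool → Bool → Bool → Bool → Bool → α)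
    (A : V → V → Bool) (x : Fin 5 → V) : α :=
  w (A (x 0) (x 1)) (A (x 0) (x 2)) (A (x 1) (x 2)) (A (x 0) (x 3)) (A (x 1) (x 3))
    (A (x 2) (x 3)) (A (x 0) (x 4)) (A (x 1) (x 4)) (A (x 2) (x 4)) (A (x 3) (x 4))

theorem sum_sumLab (w : Bool → Bool → Bool → Bool → Bool → Bool → Bool → Bool → Bool → Bool → ℕ)
    (A : V → V → Bool) (hA : ∀ a b, A a b = A b a) :
    ∑ x : Fin 5 → V, sumLab w (A (x 0) (x 1)) (A (x 0) (x 2)) (A (x 0) (x 3)) (A (x 0) (x 4))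
      (A (x 1) (x 2)) (A (x 1) (x 3)) (A (x 1) (x 4)) (A (x 2) (x 3)) (A (x 2) (x 4))
      (A (x 3) (x 4)) = 30 * ∑ x : Fin 5 → V, atVertices w A x := by
  set W := atVertices w A with hW
  have key : ∀ x : Fin 5 → V, sumLab w (A (x 0) (x 1)) (A (x 0) (x 2)) (A (x 0) (x 3)) (A (x 0) (x 4))
      (A (x 1) (x 2)) (A (x 1) (x 3)) (A (x 1) (x 4)) (A (x 2) (x 3)) (A (x 2) (x 4))
      (A (x 3) (x 4)) = W (x ∘ ![0, 1, 2, 3, 4]) +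
      W (x ∘ ![0, 1, 3, 2, 4]) +
      W (x ∘ ![0, 1, 4, 2, 3]) +
      W (x ∘ ![0, 2, 3, 1, 4]) +
      W (x ∘ ![0, 2, 4, 1, 3]) +
      W (x ∘ ![0, 3, 4, 1, 2]) +
      W (x ∘ ![1, 0, 2, 3, 4]) +
      W (x ∘ ![1, 0, 3, 2, 4]) +
      W (x ∘ ![1, 0, 4, 2, 3]) +
      W (x ∘ ![1, 2, 3, 0, 4]) +
      W (x ∘ ![1, 2, 4, 0, 3]) +
      W (x ∘ ![1, 3, 4, 0, 2]) +
      W (x ∘ ![2, 0, 1, 3, 4]) +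
      W (x ∘ ![2, 0, 3, 1, 4]) +
      W (x ∘ ![2, 0, 4, 1, 3]) +
      W (x ∘ ![2, 1, 3, 0, 4]) +
      W (x ∘ ![2, 1, 4, 0, 3]) +
      W (x ∘ ![2, 3, 4, 0, 1]) +
      W (x ∘ ![3, 0, 1, 2, 4]) +
      W (x ∘ ![3, 0, 2, 1, 4]) +
      W (x ∘ ![3, 0, 4, 1, 2]) +
      W (x ∘ ![3, 1, 2, 0, 4]) +
      W (x ∘ ![3, 1, 4, 0, 2]) +
      W (x ∘ ![3, 2, 4, 0, 1]) +
      W (x ∘ ![4, 0, 1, 2, 3]) +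
      W (x ∘ ![4, 0, 2, 1, 3]) +
      W (x ∘ ![4, 0, 3, 1, 2]) +
      W (x ∘ ![4, 1, 2, 0, 3]) +
      W (x ∘ ![4, 1, 3, 0, 2]) +
      W (x ∘ ![4, 2, 3, 0, 1]) := by
    intro x
    simp [hW, atVertices, sumLab, hA (x 1) (x 0), hA (x 2) (x 0), hA (x 3) (x 0), hA (x 4) (x 0), hA (x 2) (x 1),
      hA (x 3) (x 1), hA (x 4) (x 1), hA (x 3) (x 2), hA (x 4) (x 2), hA (x 4) (x 3)]
  simp_rw [key, Finset.sum_add_distrib]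
  rw [sum_relabel W ![0, 1, 2, 3, 4] (by decide),
    sum_relabel W ![0, 1, 3, 2, 4] (by decide),
    sum_relabel W ![0, 1, 4, 2, 3] (by decide),
    sum_relabel W ![0, 2, 3, 1, 4] (by decide),
    sum_relabel W ![0, 2, 4, 1, 3] (by decide),
    sum_relabel W ![0, 3, 4, 1, 2] (by decide),
    sum_relabel W ![1, 0, 2, 3, 4] (by decide),
    sum_relabel W ![1, 0, 3, 2, 4] (by decide),
    sum_relabel W ![1, 0, 4, 2, 3] (by decide),
    sum_relabel W ![1, 2, 3, 0, 4] (by decide),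
    sum_relabel W ![1, 2, 4, 0, 3] (by decide),
    sum_relabel W ![1, 3, 4, 0, 2] (by decide),
    sum_relabel W ![2, 0, 1, 3, 4] (by decide),
    sum_relabel W ![2, 0, 3, 1, 4] (by decide),
    sum_relabel W ![2, 0, 4, 1, 3] (by decide),
    sum_relabel W ![2, 1, 3, 0, 4] (by decide),
    sum_relabel W ![2, 1, 4, 0, 3] (by decide),
    sum_relabel W ![2, 3, 4, 0, 1] (by decide),
    sum_relabel W ![3, 0, 1, 2, 4] (by decide),
    sum_relabel W ![3, 0, 2, 1, 4] (by decide),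
    sum_relabel W ![3, 0, 4, 1, 2] (by decide),
    sum_relabel W ![3, 1, 2, 0, 4] (by decide),
    sum_relabel W ![3, 1, 4, 0, 2] (by decide),
    sum_relabel W ![3, 2, 4, 0, 1] (by decide),
    sum_relabel W ![4, 0, 1, 2, 3] (by decide),
    sum_relabel W ![4, 0, 2, 1, 3] (by decide),
    sum_relabel W ![4, 0, 3, 1, 2] (by decide),
    sum_relabel W ![4, 1, 2, 0, 3] (by decide),
    sum_relabel W ![4, 1, 3, 0, 2] (by decide),
    sum_relabel W ![4, 2, 3, 0, 1] (by decide)]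
  ring

theorem sum_cons {n : ℕ} (f : (Fin (n + 1) → V) → ℤ) :
    ∑ x, f x = ∑ a, ∑ y : Fin n → V, f (Fin.cons a y) := by
  rw [← Fintype.sum_prod_type']
  exact (Fintype.sum_equiv (Fin.consEquiv fun _ => V) _ _ fun x => rfl).symm

theorem sum_fin_five (f : V → V → V → V → V → ℤ) :
    ∑ x : Fin 5 → V, f (x 0) (x 1) (x 2) (x 3) (x 4) =
      ∑ i, ∑ j, ∑ k, ∑ l, ∑ m, f i j k l m := by
  rw [sum_cons]
  refine Finset.sum_congr rfl fun i _ => ?_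
  rw [sum_cons]
  refine Finset.sum_congr rfl fun j _ => ?_
  rw [sum_cons]
  refine Finset.sum_congr rfl fun k _ => ?_
  rw [sum_cons]
  refine Finset.sum_congr rfl fun l _ => ?_
  rw [sum_cons]
  refine Finset.sum_congr rfl fun m _ => ?_
  rw [Fintype.sum_unique]
  rfl

theorem sum_relWeight_nonneg (A : V → V → Bool) (hA : ∀ a b, A a b = A b a)
    (hi : ∀ a b c d, (A a b || A a c || A a d || A b c || A b d || A c d) = true) :
    0 ≤ ∑ i, ∑ j, ∑ k, ∑ l, ∑ m, relWeight A i j k l m := by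
  have h1 := Finset.sum_le_sum (s := Finset.univ) fun (x : Fin 5 → V) _ =>
    sumLab_negWeight_le (A (x 0) (x 1)) (A (x 0) (x 2)) (A (x 0) (x 3)) (A (x 0) (x 4))
      (A (x 1) (x 2)) (A (x 1) (x 3)) (A (x 1) (x 4)) (A (x 2) (x 3)) (A (x 2) (x 4))
      (A (x 3) (x 4)) (by simp only [hasEdges, hi, Bool.and_self])
  rw [sum_sumLab _ _ hA, sum_sumLab _ _ hA] at h1
  have h2 : ∑ x : Fin 5 → V, atVertices negWeight A x ≤ ∑ x : Fin 5 → V, atVertices posWeight A x := by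
    omega
  rw [← sum_fin_five]
  have h3 : ∀ x : Fin 5 → V, relWeight A (x 0) (x 1) (x 2) (x 3) (x 4) =
      ((atVertices posWeight A x : ℕ) : ℤ) - ((atVertices negWeight A x : ℕ) : ℤ) := fun x => by
    simp only [relWeight, atVertices, posWeight, negWeight, Int.toNat_sub_toNat_neg]
  simp_rw [h3, Finset.sum_sub_distrib]
  rw [sub_nonneg]
  exact_mod_cast h2

theorem bit_and (a b : Bool) : bit (a && b) = bit a * bit b := by
  cases a <;> cases b <;> rfl

theorem bit_nonneg (a : Bool) : 0 ≤ bit a := by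
  cases a <;> decide

theorem form_edgeMat_nonneg (f : Fin 4 → ℤ) : 0 ≤ form edgeMat f f := by
  simp only [form, edgeMat, Fin.sum_univ_four, Matrix.cons_val]
  generalize f 0 = a, f 1 = b, f 2 = c, f 3 = d
  have h : (0 : ℚ) ≤ 360 * (a - 13 / 20 * b + 11 / 30 * c + 11 / 20 * d) ^ 2
      + 180 * (71 / 200) * (b + 166 / 213 * c - 191 / 213 * d) ^ 2
      + 180 * (1453 / 2130) * (c - 919 / 8718 * d) ^ 2
      + 180 * (160009 / 1569240) * (d : ℚ) ^ 2 := by positivity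
  qify
  linarith

theorem form_edgeSkewMat_nonneg (f : Fin 2 → ℤ) : 0 ≤ form edgeSkewMat f f := by
  simp only [form, edgeSkewMat, Fin.sum_univ_two, Matrix.cons_val]
  generalize f 0 = a, f 1 = b
  have h : (0 : ℚ) ≤ 270 * (a - 2 / 15 * b) ^ 2 + 180 * (461 / 150) * (b : ℚ) ^ 2 := by positivity
  qify
  linarith

theorem form_pathMat_nonneg (f : Fin 5 → ℤ) : 0 ≤ form pathMat f f := by
  simp only [form, pathMat, Fin.sum_univ_five, Matrix.cons_val]
  generalize f 0 = a, f 1 = b, f 2 = c, f 3 = d, f 4 = e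
  have h : (0 : ℚ) ≤ 1224 * (a - 1 / 2 * b - 1 / 17 * c + 25 / 68 * d + 11 / 34 * e) ^ 2
      + 450 * (b - 3 / 5 * c - 1 / 10 * d + 3 / 5 * e) ^ 2
      + 180 * (149 / 170) * (c + 67 / 298 * d - 114 / 149 * e) ^ 2
      + 180 * (133 / 1192) * (d - 92 / 95 * e) ^ 2
      + 180 * (581 / 2850) * (e : ℚ) ^ 2 := by positivity
  qify
  linarith

theorem form_triMat_nonneg (f : Fin 3 → ℤ) : 0 ≤ form triMat f f := by
  simp only [form, triMat, Fin.sum_univ_three, Matrix.cons_val]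
  generalize f 0 = a, f 1 = b, f 2 = c
  have h : (0 : ℚ) ≤ 36 * (a - 3 / 2 * b - 7 / 9 * c) ^ 2 + 9 * (b - 2 / 3 * c) ^ 2
      + 180 * (32 / 405) * (c : ℚ) ^ 2 := by positivity
  qify
  linarith

theorem sum_form {k : ℕ} (M : Fin k → Fin k → ℤ) (f : V → Fin k → ℤ) :
    ∑ l, ∑ m, form M (f l) (f m) = form M (∑ l, f l) (∑ m, f m) := by
  simp only [form, Finset.sum_apply, Finset.mul_sum, Finset.sum_mul]
  simp_rw [Finset.sum_comm (s := (Finset.univ : Finset V)) (t := (Finset.univ : Finset (Fin k)))]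
  refine Finset.sum_congr rfl fun i _ => Finset.sum_congr rfl fun j _ => ?_
  rw [Finset.sum_comm]

theorem mul_sum_form_nonneg {k : ℕ} {M : Fin k → Fin k → ℤ} (hM : ∀ f, 0 ≤ form M f f)
    (b : Bool) (f : V → Fin k → ℤ) : 0 ≤ ∑ l, ∑ m, bit b * form M (f l) (f m) := by
  simp_rw [← Finset.mul_sum]
  rw [sum_form]
  exact mul_nonneg (bit_nonneg b) (hM _)

/-- Ordered triples that are cliques of a reflexive relation. -/
def triples (A : V → V → Bool) : ℤ := ∑ i, ∑ j, ∑ k, bit (A i j && A i k && A j k)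

/-- The number of vertices with at least two neighbours among three given vertices. -/
def majCount (A : V → V → Bool) (i j k : V) : ℤ := ∑ l, bit (maj (A i l) (A j l) (A k l))

/-- The defect of independent triples, summed over all ordered triples. -/
def majDefect (A : V → V → Bool) : ℤ :=
  ∑ i, ∑ j, ∑ k, bit (!A i j && !A i k && !A j k) * majCount A i j k ^ 2

/-- The number of ordered diamonds with nonadjacent pair `(j, k)`. -/
def diamonds (A : V → V → Bool) : ℤ :=
  ∑ j, ∑ k, ∑ l, ∑ m, bit (!A j k && A j l && A k l && A j m && A k m && A l m)

theorem triples_lower_bound (A : V → V → Bool) (hA : ∀ a b, A a b = A b a)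
    (hi : ∀ a b c d, (A a b || A a c || A a d || A b c || A b d || A c d) = true) :
    10 * (Fintype.card V : ℤ) ^ 5 + 3 * majDefect A + 3 * Fintype.card V * diamonds A ≤
      90 * (Fintype.card V : ℤ) ^ 2 * triples A := by
  have h0 := sum_relWeight_nonneg A hA hi
  have h1 : ∀ i j k, ∑ l, ∑ m, relWeight A i j k l m ≤
      180 * (Fintype.card V : ℤ) ^ 2 * bit (A i j && A i k && A j k) - 20 * (Fintype.card V : ℤ) ^ 2
        - 6 * (bit (!A i j && !A i k && !A j k) * majCount A i j k ^ 2)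
        - 6 * ∑ l, ∑ m, bit (!A j k && A j l && A k l && A j m && A k m && A l m) := by
    intro i j k
    have e1 := mul_sum_form_nonneg form_edgeMat_nonneg (!A i j && !A i k && A j k)
      fun l => edgeVec (A i l) (A j l) (A k l)
    have e2 := mul_sum_form_nonneg form_edgeSkewMat_nonneg (!A i j && !A i k && A j k)
      fun l => edgeSkewVec (A i l) (A j l) (A k l)
    have e3 := mul_sum_form_nonneg form_pathMat_nonneg (A i j && A i k && !A j k)
      fun l => pathVec (A j l) (A k l) (A i l)
    have e4 := mul_sum_form_nonneg form_triMat_nonneg (A i j && A i k && A j k)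
      fun l => triVec (A i l) (A j l) (A k l)
    have e5 : ∑ l, ∑ m, bit (!A i j && !A i k && !A j k && maj (A i l) (A j l) (A k l)
        && maj (A i m) (A j m) (A k m)) = bit (!A i j && !A i k && !A j k) * majCount A i j k ^ 2 := by
      rw [majCount, sq, Finset.sum_mul_sum, Finset.mul_sum]
      refine Finset.sum_congr rfl fun l _ => ?_
      rw [Finset.mul_sum]
      refine Finset.sum_congr rfl fun m _ => ?_
      rw [bit_and _ (maj (A i m) _ _), bit_and _ (maj (A i l) _ _), mul_assoc]
    simp only [relWeight, weight, Finset.sum_sub_distrib, mul_add, Finset.sum_add_distrib,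
      ← Finset.mul_sum _ _ (6 : ℤ), e5]
    simp only [Finset.sum_const, Finset.card_univ, nsmul_eq_mul]
    linarith
  have h2 := h0.trans (Finset.sum_le_sum fun i _ => Finset.sum_le_sum fun j _ =>
    Finset.sum_le_sum fun k _ => h1 i j k)
  simp only [Finset.sum_sub_distrib, ← Finset.mul_sum] at h2
  simp only [Finset.sum_const, Finset.card_univ, nsmul_eq_mul] at h2
  rw [← triples, ← majDefect, ← diamonds] at h2
  linarith

end Core

section Counting

/-- The number of neighbours of `v` in `S`. -/
def degOn {V : Type*} (A : V → V → Bool) (S : Finset V) (v : V) : ℕ := (S.filter fun w => A v w).card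

theorem sum_bit {V : Type*} (A : V → V → Bool) (S : Finset V) (v : V) : ∑ w ∈ S, bit (A v w) = degOn A S v := by
  rw [degOn, Finset.card_filter]
  push_cast
  refine Finset.sum_congr rfl fun w _ => ?_
  cases A v w <;> rfl

variable {V : Type*} [Fintype V]

theorem majDefect_nonneg (A : V → V → Bool) : 0 ≤ majDefect A :=
  Finset.sum_nonneg fun _ _ => Finset.sum_nonneg fun _ _ => Finset.sum_nonneg fun _ _ =>
    mul_nonneg (bit_nonneg _) (sq_nonneg _)

theorem diamonds_nonneg (A : V → V → Bool) : 0 ≤ diamonds A :=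
  Finset.sum_nonneg fun _ _ => Finset.sum_nonneg fun _ _ => Finset.sum_nonneg fun _ _ =>
    Finset.sum_nonneg fun _ _ => bit_nonneg _

theorem card_pow_three_le_triples (A : V → V → Bool) (hA : ∀ a b, A a b = A b a)
    (hi : ∀ a b c d, (A a b || A a c || A a d || A b c || A b d || A c d) = true) :
    (Fintype.card V : ℤ) ^ 3 ≤ 9 * triples A := by
  rcases (Nat.cast_nonneg (α := ℤ) (Fintype.card V)).eq_or_lt with h | h
  · rw [← h]
    have : 0 ≤ triples A := Finset.sum_nonneg fun _ _ => Finset.sum_nonneg fun _ _ =>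
      Finset.sum_nonneg fun _ _ => bit_nonneg _
    linarith
  · have h1 := triples_lower_bound A hA hi
    have h2 := majDefect_nonneg A
    have h3 := mul_nonneg h.le (diamonds_nonneg A)
    have h4 : (0 : ℤ) < 10 * (Fintype.card V : ℤ) ^ 2 := by positivity
    refine le_of_mul_le_mul_left ?_ h4
    linarith

/-- Triangles of a reflexive relation with all vertices in `S`, counted as ordered triples. -/
def triplesOn (A : V → V → Bool) (S : Finset V) : ℤ :=
  ∑ i ∈ S, ∑ j ∈ S, ∑ k ∈ S, bit (A i j && A i k && A j k)

theorem card_pow_three_le_triplesOn {V : Type*} (A : V → V → Bool) (hA : ∀ a b, A a b = A b a)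
    (hi : ∀ a b c d, (A a b || A a c || A a d || A b c || A b d || A c d) = true)
    (S : Finset V) : (S.card : ℤ) ^ 3 ≤ 9 * triplesOn A S := by
  have h := card_pow_three_le_triples (fun a b : S => A a b) (fun a b => hA a b)
    fun a b c d => hi a b c d
  rw [Fintype.card_coe] at h
  refine h.trans_eq ?_
  simp only [triples, triplesOn, ← Finset.sum_coe_sort S]

theorem sum_parts_le {P : Fin 3 → Finset V} (hP : ∀ i j, i ≠ j → Disjoint (P i) (P j))
    {f : V → ℤ} (hf : ∀ v, 0 ≤ f v) : ∑ i, ∑ v ∈ P i, f v ≤ ∑ v, f v := by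
  classical
  rw [← Finset.sum_biUnion fun i _ j _ h => hP i j h]
  exact Finset.sum_le_sum_of_subset_of_nonneg (Finset.subset_univ _) fun v _ _ => hf v

theorem sum_card_pow_three_le {A : V → V → Bool} {P : Fin 3 → Finset V}
    (hP : ∀ i j, i ≠ j → Disjoint (P i) (P j))
    (hc : ∀ i, ∀ u ∈ P i, ∀ v ∈ P i, A u v = true) :
    ∑ i, ((P i).card : ℤ) ^ 3 ≤ triples A := by
  refine le_trans (Finset.sum_le_sum fun i _ => ?_) (sum_parts_le hP fun v =>
    Finset.sum_nonneg fun j _ => Finset.sum_nonneg fun k _ => bit_nonneg (A v j && A v k && A j k))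
  have h : ∀ v ∈ P i, ((P i).card : ℤ) ^ 2 ≤ ∑ j, ∑ k, bit (A v j && A v k && A j k) := by
    intro v hv
    calc ((P i).card : ℤ) ^ 2 = ∑ j ∈ P i, ∑ k ∈ P i, bit (A v j && A v k && A j k) := by
          rw [Finset.sum_congr rfl fun j hj => Finset.sum_congr rfl fun k hk => by
            rw [hc i v hv j hj, hc i v hv k hk, hc i j hj k hk]]
          simp [bit, sq]
      _ ≤ ∑ j ∈ P i, ∑ k, bit (A v j && A v k && A j k) := Finset.sum_le_sum fun j _ =>
          Finset.sum_le_sum_of_subset_of_nonneg (Finset.subset_univ _) fun _ _ _ => bit_nonneg _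
      _ ≤ _ := Finset.sum_le_sum_of_subset_of_nonneg (Finset.subset_univ _) fun _ _ _ =>
          Finset.sum_nonneg fun _ _ => bit_nonneg _
  calc ((P i).card : ℤ) ^ 3 = ∑ v ∈ P i, ((P i).card : ℤ) ^ 2 := by
        rw [Finset.sum_const, nsmul_eq_mul]; ring
    _ ≤ _ := Finset.sum_le_sum h

/-- Ordered diamonds in which `v` is one of the two nonadjacent vertices. -/
def diamondsAt (A : V → V → Bool) (v : V) : ℤ :=
  ∑ k, ∑ l, ∑ m, bit (!A v k && A v l && A k l && A v m && A k m && A l m)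

theorem sum_degOn_sq_mul_le {A : V → V → Bool} {P : Fin 3 → Finset V}
    (hP : ∀ i j, i ≠ j → Disjoint (P i) (P j))
    (hc : ∀ i, ∀ u ∈ P i, ∀ v ∈ P i, A u v = true) (v : V) :
    ∑ i, (degOn A (P i) v : ℤ) ^ 2 * ((P i).card - degOn A (P i) v) ≤ diamondsAt A v := by
  refine le_trans (Finset.sum_le_sum fun i _ => ?_) (sum_parts_le hP fun k =>
    Finset.sum_nonneg fun l _ => Finset.sum_nonneg fun m _ =>
      bit_nonneg (!A v k && A v l && A k l && A v m && A k m && A l m))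
  have h : ∀ k ∈ P i, (degOn A (P i) v : ℤ) ^ 2 * (1 - bit (A v k)) ≤
      ∑ l, ∑ m, bit (!A v k && A v l && A k l && A v m && A k m && A l m) := by
    intro k hk
    calc (degOn A (P i) v : ℤ) ^ 2 * (1 - bit (A v k))
        = ∑ l ∈ P i, ∑ m ∈ P i, bit (!A v k && A v l && A k l && A v m && A k m && A l m) := by
          rw [← sum_bit, sq, Finset.sum_mul_sum, Finset.sum_mul]
          refine Finset.sum_congr rfl fun l hl => ?_
          rw [Finset.sum_mul]
          refine Finset.sum_congr rfl fun m hm => ?_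
          rw [hc i k hk l hl, hc i k hk m hm, hc i l hl m hm]
          cases A v k <;> cases A v l <;> cases A v m <;> rfl
      _ ≤ ∑ l ∈ P i, ∑ m, bit (!A v k && A v l && A k l && A v m && A k m && A l m) :=
          Finset.sum_le_sum fun j _ =>
            Finset.sum_le_sum_of_subset_of_nonneg (Finset.subset_univ _) fun _ _ _ => bit_nonneg _
      _ ≤ _ := Finset.sum_le_sum_of_subset_of_nonneg (Finset.subset_univ _) fun _ _ _ =>
          Finset.sum_nonneg fun _ _ => bit_nonneg _
  refine le_trans (le_of_eq ?_) (Finset.sum_le_sum h)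
  rw [← Finset.mul_sum, Finset.sum_sub_distrib, sum_bit]
  simp

theorem card_indep_triples {A : V → V → Bool} (hA : ∀ a b, A a b = A b a) :
    (Fintype.card V : ℤ) ^ 3 ≤
      4 * (∑ i, ∑ j, ∑ k, bit (!A i j && !A i k && !A j k)) + 4 * triples A := by
  set n : ℤ := (Fintype.card V : ℤ) with hn
  let d : V → ℤ := fun v => ∑ w, bit (A v w)
  have key : (∑ i, ∑ j, ∑ k, bit (!A i j && !A i k && !A j k)) + triples A =
      ∑ v, (n ^ 2 - 3 * n * d v + 3 * d v ^ 2) := by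
    have h1 : ∀ i j k, bit (!A i j && !A i k && !A j k) + bit (A i j && A i k && A j k) =
        1 - bit (A i j) - bit (A i k) - bit (A j k) + bit (A i j) * bit (A i k)
          + bit (A j i) * bit (A j k) + bit (A k i) * bit (A k j) := by
      intro i j k
      rw [hA j i, hA k i, hA k j]
      cases A i j <;> cases A i k <;> cases A j k <;> rfl
    simp only [triples, ← Finset.sum_add_distrib, h1]
    have e1 : ∑ i, ∑ j, ∑ k : V, bit (A i j) = n * ∑ v, d v := by
      simp [d, hn, Finset.mul_sum]
    have e2 : ∑ i, ∑ j : V, ∑ k, bit (A i k) = n * ∑ v, d v := by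
      simp [d, hn, Finset.mul_sum]
    have e3 : ∑ i : V, ∑ j, ∑ k, bit (A j k) = n * ∑ v, d v := by
      simp [d, hn]
    have e4 : ∑ i, ∑ j, ∑ k, bit (A i j) * bit (A i k) = ∑ v, d v ^ 2 := by
      simp [d, sq, Finset.sum_mul_sum]
    have e5 : ∑ i, ∑ j, ∑ k, bit (A j i) * bit (A j k) = ∑ v, d v ^ 2 := by
      rw [Finset.sum_comm]
      exact e4
    have e6 : ∑ i, ∑ j, ∑ k, bit (A k i) * bit (A k j) = ∑ v, d v ^ 2 := by
      simp_rw [fun i => Finset.sum_comm (s := Finset.univ) (t := Finset.univ)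
        (f := fun j k => bit (A k i) * bit (A k j))]
      exact e5
    simp only [Finset.sum_add_distrib, Finset.sum_sub_distrib, e1, e2, e3, e4, e5, e6]
    simp only [Finset.sum_const, Finset.card_univ, nsmul_eq_mul, ← Finset.mul_sum]
    ring
  have h2 : ∑ v : V, n ^ 2 ≤ ∑ v, 4 * (n ^ 2 - 3 * n * d v + 3 * d v ^ 2) :=
    Finset.sum_le_sum fun v _ => by nlinarith [sq_nonneg (n - 2 * d v)]
  rw [← Finset.mul_sum, ← key, Finset.sum_const, Finset.card_univ, nsmul_eq_mul, ← hn] at h2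
  linarith

/-- Splitting off a set `X` of vertices, the triangles with exactly one vertex in `X` count three times. -/
theorem triplesOn_compl_add_le [DecidableEq V] {A : V → V → Bool} (hA : ∀ a b, A a b = A b a)
    (X : Finset V) :
    triplesOn A Xᶜ + 3 * ∑ v ∈ X, ∑ j ∈ Xᶜ, ∑ k ∈ Xᶜ, bit (A v j && A v k && A j k) ≤
      triples A := by
  set t := fun i j k => bit (A i j && A i k && A j k) with ht
  have split : ∀ f : V → ℤ, ∑ v, f v = ∑ v ∈ X, f v + ∑ v ∈ Xᶜ, f v := fun f =>
    (Finset.sum_add_sum_compl X f).symm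
  have nonneg : ∀ S S' S'' : Finset V, 0 ≤ ∑ i ∈ S, ∑ j ∈ S', ∑ k ∈ S'', t i j k := fun S S' S'' =>
    Finset.sum_nonneg fun _ _ => Finset.sum_nonneg fun _ _ => Finset.sum_nonneg fun _ _ =>
      bit_nonneg _
  have swap1 : ∀ i j k, t i j k = t j i k := fun i j k => by
    simp only [ht, hA j i]
    cases A i j <;> cases A i k <;> cases A j k <;> rfl
  have swap2 : ∀ i j k, t i j k = t k j i := fun i j k => by
    simp only [ht, hA k j, hA k i, hA j i]
    cases A i j <;> cases A i k <;> cases A j k <;> rfl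
  have e1 : ∑ i ∈ Xᶜ, ∑ j ∈ X, ∑ k ∈ Xᶜ, t i j k = ∑ v ∈ X, ∑ j ∈ Xᶜ, ∑ k ∈ Xᶜ, t v j k := by
    rw [Finset.sum_comm]
    simp_rw [swap1]
  have e2 : ∑ i ∈ Xᶜ, ∑ j ∈ Xᶜ, ∑ k ∈ X, t i j k = ∑ v ∈ X, ∑ j ∈ Xᶜ, ∑ k ∈ Xᶜ, t v j k := by
    simp_rw [fun i => Finset.sum_comm (s := Xᶜ) (t := X) (f := fun j k => t i j k)]
    rw [Finset.sum_comm]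
    refine Finset.sum_congr rfl fun v _ => ?_
    rw [Finset.sum_comm]
    refine Finset.sum_congr rfl fun j _ => Finset.sum_congr rfl fun k _ => ?_
    rw [swap2]
  have e : triples A = ∑ i, ∑ j, ∑ k, t i j k := rfl
  rw [e]
  simp only [split, Finset.sum_add_distrib]
  have h1 := nonneg X X X
  have h2 := nonneg X X Xᶜ
  have h3 := nonneg X Xᶜ X
  have h4 := nonneg Xᶜ X X
  have e0 : triplesOn A Xᶜ = ∑ i ∈ Xᶜ, ∑ j ∈ Xᶜ, ∑ k ∈ Xᶜ, t i j k := rfl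
  rw [e0]
  linarith

theorem sum_degOn_sdiff_sq_le [DecidableEq V] {A : V → V → Bool} {P : Fin 3 → Finset V}
    (hP : ∀ i j, i ≠ j → Disjoint (P i) (P j))
    (hc : ∀ i, ∀ u ∈ P i, ∀ v ∈ P i, A u v = true) (X : Finset V) (v : V) :
    ∑ i, (degOn A (P i \ X) v : ℤ) ^ 2 ≤ ∑ j ∈ Xᶜ, ∑ k ∈ Xᶜ, bit (A v j && A v k && A j k) := by
  have h : ∀ i, ∀ j ∈ P i \ X, bit (A v j) * degOn A (P i \ X) v ≤
      ∑ k ∈ Xᶜ, bit (A v j && A v k && A j k) := by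
    intro i j hj
    have hs : P i \ X ⊆ Xᶜ := fun w hw => Finset.mem_compl.2 (Finset.mem_sdiff.1 hw).2
    refine le_trans (le_of_eq ?_) (Finset.sum_le_sum_of_subset_of_nonneg hs fun _ _ _ => bit_nonneg _)
    rw [← sum_bit, Finset.mul_sum]
    refine Finset.sum_congr rfl fun k hk => ?_
    rw [hc i j (Finset.mem_sdiff.1 hj).1 k (Finset.mem_sdiff.1 hk).1, Bool.and_true, bit_and]
  calc ∑ i, (degOn A (P i \ X) v : ℤ) ^ 2
      = ∑ i, ∑ j ∈ P i \ X, bit (A v j) * degOn A (P i \ X) v := by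
        refine Finset.sum_congr rfl fun i _ => ?_
        rw [← Finset.sum_mul, sum_bit, sq]
    _ ≤ ∑ i, ∑ j ∈ P i \ X, ∑ k ∈ Xᶜ, bit (A v j && A v k && A j k) :=
        Finset.sum_le_sum fun i _ => Finset.sum_le_sum (h i)
    _ ≤ _ := by
        rw [← Finset.sum_biUnion fun i _ j _ hij => (hP i j hij).mono Finset.sdiff_subset Finset.sdiff_subset]
        refine Finset.sum_le_sum_of_subset_of_nonneg ?_ fun _ _ _ =>
          Finset.sum_nonneg fun _ _ => bit_nonneg _
        intro w hw
        obtain ⟨i, -, hw⟩ := Finset.mem_biUnion.1 hw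
        exact Finset.mem_compl.2 (Finset.mem_sdiff.1 hw).2

end Counting

section Stability

variable {V : Type*} [Fintype V] {A : V → V → Bool} {ε : ℝ}

/-- A large reflexive graph without independent sets of size four and with few triangles. -/
structure NearExtremal (A : V → V → Bool) (ε : ℝ) : Prop where
  symm : ∀ a b, A a b = A b a
  four : ∀ a b c d, (A a b || A a c || A a d || A b c || A b d || A c d) = true
  pos : 0 < ε
  lt : ε < 1 / 30
  large : 30 ≤ ε ^ 5 * Fintype.card V
  few : (triples A : ℝ) ≤ (1 / 9 + 11 / 10 * ε ^ 5) * (Fintype.card V : ℝ) ^ 3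

/-- Three disjoint cliques that cover almost all vertices. -/
structure NearPartition (A : V → V → Bool) (ε : ℝ) (P : Fin 3 → Finset V) : Prop where
  disj : ∀ i j, i ≠ j → Disjoint (P i) (P j)
  clique : ∀ i, ∀ u ∈ P i, ∀ v ∈ P i, A u v = true
  cover : (1 - ε / 10) * (Fintype.card V : ℝ) ≤ ∑ i, ((P i).card : ℝ)

namespace NearExtremal

variable (h : NearExtremal A ε)
include h

theorem card_pos : 0 < (Fintype.card V : ℝ) := by
  have := h.large
  have := pow_pos h.pos 5
  by_contra hn
  nlinarith

theorem pow_five_le : ε ^ 5 ≤ 1 / 27000 * ε ^ 2 := by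
  have h3 : ε ^ 3 ≤ (1 / 30) ^ 3 := pow_le_pow_left₀ h.pos.le h.lt.le 3
  nlinarith [sq_nonneg ε]

theorem pow_five_le' : ε ^ 5 ≤ 1 / 24300000 := by
  have h3 : ε ^ 5 ≤ (1 / 30) ^ 5 := pow_le_pow_left₀ h.pos.le h.lt.le 5
  linarith

theorem majDefect_and_diamonds_le : (majDefect A : ℝ) ≤ 33 * ε ^ 5 * (Fintype.card V : ℝ) ^ 5 ∧
    (diamonds A : ℝ) ≤ 33 * ε ^ 5 * (Fintype.card V : ℝ) ^ 4 := by
  have hn := h.card_pos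
  have h1 : (10 * (Fintype.card V : ℝ) ^ 5 + 3 * majDefect A + 3 * Fintype.card V * diamonds A) ≤
      90 * (Fintype.card V : ℝ) ^ 2 * triples A := by
    exact_mod_cast triples_lower_bound A h.symm h.four
  have h2 := mul_le_mul_of_nonneg_left h.few (by positivity : 0 ≤ 90 * (Fintype.card V : ℝ) ^ 2)
  have h3 : (0 : ℝ) ≤ majDefect A := by exact_mod_cast majDefect_nonneg A
  have h4 : (0 : ℝ) ≤ diamonds A := by exact_mod_cast diamonds_nonneg A
  have h5 := mul_nonneg hn.le h4
  constructor
  · linarith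
  · refine le_of_mul_le_mul_left ?_ hn
    linarith

theorem exists_indep_triple : ∃ x y z, A x y = false ∧ A x z = false ∧ A y z = false ∧
    (majCount A x y z : ℝ) ≤ ε / 10 * Fintype.card V := by
  by_contra! hc
  have hn := h.card_pos
  set n : ℝ := (Fintype.card V : ℝ) with hn'
  have h1 : ∀ x y z, (ε / 10 * n) ^ 2 * (bit (!A x y && !A x z && !A y z) : ℝ) ≤
      (bit (!A x y && !A x z && !A y z) * majCount A x y z ^ 2 : ℤ) := by
    intro x y z
    have hε := h.pos
    have := hc x y z
    cases h1 : A x y <;> cases h2 : A x z <;> cases h3 : A y z <;> simp [bit]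
    exact pow_le_pow_left₀ (by positivity) (this h1 h2 h3).le 2
  have h2 : (ε / 10 * n) ^ 2 * ((∑ i, ∑ j, ∑ k, bit (!A i j && !A i k && !A j k) : ℤ) : ℝ) ≤
      majDefect A := by
    rw [majDefect]
    push_cast
    simp only [Finset.mul_sum]
    refine Finset.sum_le_sum fun i _ => Finset.sum_le_sum fun j _ => Finset.sum_le_sum fun k _ => ?_
    exact_mod_cast h1 i j k
  have h3 : n ^ 3 ≤ 4 * ((∑ i, ∑ j, ∑ k, bit (!A i j && !A i k && !A j k) : ℤ) : ℝ) +
      4 * triples A := by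
    rw [hn']
    exact_mod_cast card_indep_triples h.symm
  generalize (∑ i, ∑ j, ∑ k, bit (!A i j && !A i k && !A j k) : ℤ) = I at h2 h3
  have h4 := h.majDefect_and_diamonds_le.1
  have h5 := h.few
  rw [← hn'] at h4 h5
  have h6 := h.pow_five_le'
  have h7 := h.pow_five_le
  have hn3 : 0 < n ^ 3 := by positivity
  have h8 : n ^ 3 / 8 < I := by nlinarith
  have h9 : 0 < (ε / 10 * n) ^ 2 := by have := h.pos; positivity
  have h10 := mul_lt_mul_of_pos_left h8 h9
  have h11 : 0 < n ^ 5 := by positivity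
  have h12 := mul_le_mul_of_nonneg_right h7 h11.le
  have h13 : 0 < ε ^ 2 * n ^ 5 := by have := h.pos; positivity
  have h14 : (ε / 10 * n) ^ 2 * (n ^ 3 / 8) = ε ^ 2 * n ^ 5 / 800 := by ring
  linarith

theorem exists_nearPartition : ∃ P, NearPartition A ε P := by
  classical
  obtain ⟨x, y, z, hxy, hxz, hyz, hW⟩ := h.exists_indep_triple
  have hyx : A y x = false := by rw [h.symm, hxy]
  have hzx : A z x = false := by rw [h.symm, hxz]
  have hzy : A z y = false := by rw [h.symm, hyz]
  refine ⟨![Finset.univ.filter fun v => A x v = true ∧ A y v = false ∧ A z v = false,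
    Finset.univ.filter fun v => A x v = false ∧ A y v = true ∧ A z v = false,
    Finset.univ.filter fun v => A x v = false ∧ A y v = false ∧ A z v = true], ?_, ?_, ?_⟩
  · intro i j hij
    rw [Finset.disjoint_left]
    intro v
    fin_cases i <;> fin_cases j <;> simp_all
  · intro i u hu v hv
    have h1 := h.four y z u v
    have h2 := h.four x z u v
    have h3 := h.four x y u v
    fin_cases i <;> simp at hu hv <;> simp_all
  · have h1 : ∀ v, (1 : ℤ) = bit (A x v && !A y v && !A z v) + bit (!A x v && A y v && !A z v) +
        bit (!A x v && !A y v && A z v) + bit (maj (A x v) (A y v) (A z v)) := by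
      intro v
      have := h.four x y z v
      rw [hxy, hxz, hyz] at this
      revert this
      cases A x v <;> cases A y v <;> cases A z v <;> decide
    have h2 := Finset.sum_congr (rfl : (Finset.univ : Finset V) = Finset.univ) fun v _ => h1 v
    simp only [Finset.sum_add_distrib] at h2
    rw [← majCount] at h2
    have h3 : ∀ p : V → Bool, ∑ v, bit (p v) = ((Finset.univ.filter fun v => p v = true).card : ℤ) :=
      fun p => sum_bit (fun _ => p) Finset.univ x
    rw [h3, h3, h3] at h2
    simp only [Bool.and_eq_true, Bool.not_eq_true', and_assoc, Finset.sum_const, Finset.card_univ,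
      nsmul_eq_mul, mul_one] at h2
    have h4 := congrArg (Int.cast : ℤ → ℝ) h2
    push_cast at h4
    rw [Fin.sum_univ_three]
    simp only [Matrix.cons_val]
    linarith

end NearExtremal

theorem tangent_pow_three {p x : ℝ} (hp : 0 ≤ p) (hx : 0 ≤ x) :
    3 * p ^ 2 * x - 2 * p ^ 3 ≤ x ^ 3 := by
  nlinarith [mul_nonneg (by linarith : 0 ≤ x + 2 * p) (sq_nonneg (x - p))]

theorem exists_distinct : ∀ i : Fin 3, ∃ j k, i ≠ j ∧ i ≠ k ∧ j ≠ k := by decide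

theorem sum_eq_of_distinct {i j k : Fin 3} (hij : i ≠ j) (hik : i ≠ k) (hjk : j ≠ k) (f : Fin 3 → ℝ) :
    ∑ l, f l = f i + f j + f k := by
  rw [Fin.sum_univ_three]
  fin_cases i <;> fin_cases j <;> fin_cases k <;> simp at hij hik hjk ⊢ <;> ring

theorem degOn_le_card {V : Type*} (A : V → V → Bool) (S : Finset V) (v : V) : degOn A S v ≤ S.card :=
  Finset.card_filter_le _ _

/-- A typical vertex lies in few diamonds and has many neighbours in at most one part. -/
structure Typical (A : V → V → Bool) (ε : ℝ) (P : Fin 3 → Finset V) (v : V) : Prop where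
  diamonds_le : (diamondsAt A v : ℝ) ≤ ε ^ 2 / 2 * (Fintype.card V : ℝ) ^ 3
  single : ∀ i j, i ≠ j → 255 / 1000 * (Fintype.card V : ℝ) ≤ degOn A (P i) v →
    (degOn A (P j) v : ℝ) < 255 / 1000 * Fintype.card V

namespace NearExtremal

variable (h : NearExtremal A ε) {P : Fin 3 → Finset V} (hP : NearPartition A ε P)
include h hP

theorem card_part_lower (i : Fin 3) : 285 / 1000 * (Fintype.card V : ℝ) ≤ (P i).card := by
  obtain ⟨j, k, hij, hik, hjk⟩ := exists_distinct i
  have hn := h.card_pos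
  have h1 : ∑ l, ((P l).card : ℝ) ^ 3 ≤ triples A := by
    exact_mod_cast sum_card_pow_three_le hP.disj hP.clique
  have h2 := hP.cover
  have h3 := h.few
  have h4 := h.pow_five_le'
  have h5 := h.lt
  rw [sum_eq_of_distinct hij hik hjk] at h1 h2
  set n : ℝ := (Fintype.card V : ℝ) with hn'
  by_contra! hc
  have t1 := tangent_pow_three (p := 285 / 1000 * n) (by positivity) (Nat.cast_nonneg (α := ℝ) (P i).card)
  have t2 := tangent_pow_three (p := 356 / 1000 * n) (by positivity) (Nat.cast_nonneg (α := ℝ) (P j).card)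
  have t3 := tangent_pow_three (p := 356 / 1000 * n) (by positivity) (Nat.cast_nonneg (α := ℝ) (P k).card)
  have hn2 : 0 < n ^ 2 := by positivity
  have hn3 : 0 < n ^ 3 := by positivity
  have h6 : (1 - 1 / 300) * n ≤ (P i).card + (P j).card + (P k).card := by nlinarith
  have h7 := mul_le_mul_of_nonneg_left h6 hn2.le
  have h8 := mul_le_mul_of_nonneg_left hc.le hn2.le
  have h9 := mul_le_mul_of_nonneg_right h4 hn3.le
  nlinarith

theorem degOn_dichotomy {v : V} (hv : Typical A ε P v) (i : Fin 3) :
    (degOn A (P i) v : ℝ) ^ 2 * (285 / 1000) ≤ ε ^ 2 * (Fintype.card V : ℝ) ^ 2 ∨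
      255 / 1000 * (Fintype.card V : ℝ) ≤ degOn A (P i) v := by
  have hn := h.card_pos
  have hs := h.card_part_lower hP i
  have h1 : ∑ i, (degOn A (P i) v : ℝ) ^ 2 * ((P i).card - degOn A (P i) v) ≤ diamondsAt A v := by
    exact_mod_cast sum_degOn_sq_mul_le hP.disj hP.clique v
  have h2 : (degOn A (P i) v : ℝ) ^ 2 * ((P i).card - degOn A (P i) v) ≤
      ∑ i, (degOn A (P i) v : ℝ) ^ 2 * ((P i).card - degOn A (P i) v) :=
    Finset.single_le_sum (f := fun i => (degOn A (P i) v : ℝ) ^ 2 * ((P i).card - degOn A (P i) v))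
      (fun i _ => mul_nonneg (sq_nonneg _) (sub_nonneg.2 (by exact_mod_cast degOn_le_card A (P i) v)))
      (Finset.mem_univ i)
  have h3 := hv.diamonds_le
  have h4 := (h2.trans h1).trans h3
  have ha : (degOn A (P i) v : ℝ) ≤ (P i).card := by exact_mod_cast degOn_le_card A (P i) v
  have hε := h.pos
  have hε' := h.lt
  generalize (degOn A (P i) v : ℝ) = a at *
  generalize ((P i).card : ℝ) = s at *
  set n : ℝ := (Fintype.card V : ℝ) with hn'
  rcases le_total a (s / 2) with has | has
  · left
    have h5 : a ^ 2 * (285 / 2000 * n) ≤ a ^ 2 * (s - a) :=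
      mul_le_mul_of_nonneg_left (by linarith) (sq_nonneg a)
    refine le_of_mul_le_mul_right ?_ hn
    linarith
  · right
    by_contra! hc
    have h5 : (285 / 2000 * n) ^ 2 * (30 / 1000 * n) ≤ a ^ 2 * (s - a) :=
      mul_le_mul (pow_le_pow_left₀ (by positivity) (by linarith) 2) (by linarith) (by positivity)
        (sq_nonneg a)
    have h6 : ε ^ 2 ≤ (1 / 30) ^ 2 := pow_le_pow_left₀ hε.le hε'.le 2
    have hn3 : 0 < n ^ 3 := by positivity
    nlinarith

theorem degOn_small {v : V} (hv : Typical A ε P v) {i : Fin 3}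
    (hi : (degOn A (P i) v : ℝ) < 255 / 1000 * Fintype.card V) :
    (degOn A (P i) v : ℝ) ≤ 19 / 10 * ε * Fintype.card V := by
  have hn := h.card_pos
  have hε := h.pos
  rcases h.degOn_dichotomy hP hv i with h1 | h1
  · refine abs_le_of_sq_le_sq' ?_ (by positivity) |>.2
    have : 0 < ε ^ 2 * (Fintype.card V : ℝ) ^ 2 := by positivity
    nlinarith
  · linarith

end NearExtremal

theorem degOn_le_degOn_sdiff_add {V : Type*} [DecidableEq V] (A : V → V → Bool) (S X : Finset V) (v : V) :
    degOn A S v ≤ degOn A (S \ X) v + X.card := by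
  rw [degOn, degOn, ← Finset.card_union_of_disjoint]
  · refine Finset.card_le_card fun w hw => ?_
    simp only [Finset.mem_filter, Finset.mem_union, Finset.mem_sdiff] at hw ⊢
    tauto
  · rw [Finset.disjoint_left]
    intro w hw
    exact (Finset.mem_sdiff.1 (Finset.mem_filter.1 hw).1).2

namespace NearExtremal

variable (h : NearExtremal A ε) {P : Fin 3 → Finset V} (hP : NearPartition A ε P)
include h

theorem card_diamonds_large (S : Finset V)
    (hS : ∀ v ∈ S, ε ^ 2 / 2 * (Fintype.card V : ℝ) ^ 3 < diamondsAt A v) :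
    (S.card : ℝ) ≤ 66 * ε ^ 3 * Fintype.card V := by
  have hn := h.card_pos
  have hε := h.pos
  have h1 : ∑ v ∈ S, (diamondsAt A v : ℝ) ≤ diamonds A := by
    have : ∑ v ∈ S, diamondsAt A v ≤ diamonds A :=
      Finset.sum_le_sum_of_subset_of_nonneg (Finset.subset_univ _) fun _ _ _ =>
        Finset.sum_nonneg fun _ _ => Finset.sum_nonneg fun _ _ => Finset.sum_nonneg fun _ _ =>
          bit_nonneg _
    exact_mod_cast this
  have h2 := Finset.card_nsmul_le_sum S (fun v => (diamondsAt A v : ℝ)) _ fun v hv => (hS v hv).le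
  rw [nsmul_eq_mul] at h2
  have h3 := (h2.trans h1).trans h.majDefect_and_diamonds_le.2
  refine le_of_mul_le_mul_right ?_ (by positivity : 0 < ε ^ 2 / 2 * (Fintype.card V : ℝ) ^ 3)
  linarith

include hP

theorem card_double_of_small [DecidableEq V] (X : Finset V)
    (hX : ∀ v ∈ X, ∃ i j, i ≠ j ∧ 255 / 1000 * (Fintype.card V : ℝ) ≤ degOn A (P i) v ∧
      255 / 1000 * (Fintype.card V : ℝ) ≤ degOn A (P j) v)
    (hs : (X.card : ℝ) ≤ 5 / 1000 * Fintype.card V) :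
    (X.card : ℝ) ≤ 27 * ε ^ 5 * Fintype.card V := by
  have hn := h.card_pos
  have h1 : ∀ v ∈ X, 2 * (25 / 100 * (Fintype.card V : ℝ)) ^ 2 ≤
      ((∑ j ∈ Xᶜ, ∑ k ∈ Xᶜ, bit (A v j && A v k && A j k) : ℤ) : ℝ) := by
    intro v hv
    obtain ⟨i, j, hij, hi, hj⟩ := hX v hv
    have e1 : ∑ i, (degOn A (P i \ X) v : ℝ) ^ 2 ≤
        ((∑ j ∈ Xᶜ, ∑ k ∈ Xᶜ, bit (A v j && A v k && A j k) : ℤ) : ℝ) := by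
      exact_mod_cast sum_degOn_sdiff_sq_le hP.disj hP.clique X v
    have e2 : (degOn A (P i \ X) v : ℝ) ^ 2 + (degOn A (P j \ X) v : ℝ) ^ 2 ≤
        ∑ i, (degOn A (P i \ X) v : ℝ) ^ 2 :=
      Finset.add_le_sum (f := fun i => (degOn A (P i \ X) v : ℝ) ^ 2) (fun _ _ => sq_nonneg _)
        (Finset.mem_univ i) (Finset.mem_univ j) hij
    have e3 : ∀ i, 255 / 1000 * (Fintype.card V : ℝ) ≤ degOn A (P i) v →
        (25 / 100 * (Fintype.card V : ℝ)) ^ 2 ≤ (degOn A (P i \ X) v : ℝ) ^ 2 := by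
      intro i hi
      have : (degOn A (P i) v : ℝ) ≤ degOn A (P i \ X) v + X.card := by
        exact_mod_cast degOn_le_degOn_sdiff_add A (P i) X v
      exact pow_le_pow_left₀ (by positivity) (by linarith) 2
    linarith [e3 i hi, e3 j hj]
  have h2 := Finset.card_nsmul_le_sum X _ _ h1
  rw [nsmul_eq_mul] at h2
  have h3 : (triplesOn A Xᶜ : ℝ) + 3 * ∑ v ∈ X,
      ((∑ j ∈ Xᶜ, ∑ k ∈ Xᶜ, bit (A v j && A v k && A j k) : ℤ) : ℝ) ≤ triples A := by
    exact_mod_cast triplesOn_compl_add_le h.symm X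
  have h4 : ((Xᶜ : Finset V).card : ℝ) ^ 3 ≤ 9 * triplesOn A Xᶜ := by
    exact_mod_cast card_pow_three_le_triplesOn A h.symm h.four Xᶜ
  have h5 : ((Xᶜ : Finset V).card : ℝ) = Fintype.card V - X.card := by
    rw [Finset.card_compl, Nat.cast_sub (Finset.card_le_univ X)]
  rw [h5] at h4
  have h6 := h.few
  have hx := Nat.cast_nonneg (α := ℝ) X.card
  generalize (X.card : ℝ) = x at *
  set n : ℝ := (Fintype.card V : ℝ) with hn'
  have h7 : n ^ 3 - 3 * n ^ 2 * x ≤ (n - x) ^ 3 := by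
    have : 0 ≤ x ^ 2 * (3 * n - x) := mul_nonneg (sq_nonneg x) (by linarith)
    linarith
  have h8 : 0 < ε ^ 5 * n ^ 3 := mul_pos (pow_pos h.pos 5) (by positivity)
  refine le_of_mul_le_mul_right ?_ (by positivity : 0 < n ^ 2)
  linarith

theorem card_double [DecidableEq V] (X : Finset V)
    (hX : ∀ v ∈ X, ∃ i j, i ≠ j ∧ 255 / 1000 * (Fintype.card V : ℝ) ≤ degOn A (P i) v ∧
      255 / 1000 * (Fintype.card V : ℝ) ≤ degOn A (P j) v) :
    (X.card : ℝ) ≤ 27 * ε ^ 5 * Fintype.card V := by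
  rcases le_total (X.card : ℝ) (5 / 1000 * Fintype.card V) with hs | hs
  · exact h.card_double_of_small hP X hX hs
  · exfalso
    have hn := h.card_pos
    have h1 : ⌊5 / 1000 * (Fintype.card V : ℝ)⌋₊ ≤ X.card := Nat.floor_le_of_le hs
    obtain ⟨Y, hYX, hY⟩ := Finset.exists_subset_card_eq h1
    have h2 : (Y.card : ℝ) ≤ 5 / 1000 * Fintype.card V := by
      rw [hY]
      exact Nat.floor_le (by positivity)
    have h3 := h.card_double_of_small hP Y (fun v hv => hX v (hYX hv)) h2
    have h4 := Nat.lt_floor_add_one (5 / 1000 * (Fintype.card V : ℝ))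
    rw [← hY] at h4
    have h5 := h.pow_five_le'
    have h6 := h.large
    nlinarith

theorem exists_typical : ∃ T : Finset V, (∀ v ∈ T, Typical A ε P v) ∧
    (1 - 67 * ε ^ 3) * (Fintype.card V : ℝ) ≤ T.card := by
  classical
  let D := Finset.univ.filter fun v => ε ^ 2 / 2 * (Fintype.card V : ℝ) ^ 3 < diamondsAt A v
  let X := Finset.univ.filter fun v => ∃ i j, i ≠ j ∧
    255 / 1000 * (Fintype.card V : ℝ) ≤ degOn A (P i) v ∧
      255 / 1000 * (Fintype.card V : ℝ) ≤ degOn A (P j) v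
  have hD := h.card_diamonds_large D fun v hv => (Finset.mem_filter.1 hv).2
  have hX := h.card_double hP X fun v hv => (Finset.mem_filter.1 hv).2
  refine ⟨(D ∪ X)ᶜ, fun v hv => ?_, ?_⟩
  · simp only [D, X, Finset.mem_compl, Finset.mem_union, Finset.mem_filter, Finset.mem_univ,
      true_and, not_or, not_lt, not_exists, not_and] at hv
    exact ⟨hv.1, fun i j hij hi => not_le.1 (hv.2 i j hij hi)⟩
  · have h1 : ((D ∪ X).card : ℝ) ≤ D.card + X.card := by exact_mod_cast Finset.card_union_le D X
    rw [Finset.card_compl, Nat.cast_sub (Finset.card_le_univ _)]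
    have hε := h.pos
    have h2 : ε ^ 2 ≤ (1 / 30) ^ 2 := pow_le_pow_left₀ hε.le h.lt.le 2
    have h3 : 27 * ε ^ 5 ≤ ε ^ 3 := by nlinarith [pow_pos hε 3]
    have h4 := mul_le_mul_of_nonneg_right h3 h.card_pos.le
    linarith

end NearExtremal

theorem degOn_eq_card {V : Type*} {A : V → V → Bool} {S : Finset V} {v : V}
    (hv : ∀ w ∈ S, A v w = true) : degOn A S v = S.card := by
  rw [degOn, Finset.filter_true_of_mem hv]

namespace NearExtremal

variable (h : NearExtremal A ε) {P : Fin 3 → Finset V} (hP : NearPartition A ε P)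
include h hP

theorem degOn_own_part {v : V} {i : Fin 3} (hv : v ∈ P i) :
    255 / 1000 * (Fintype.card V : ℝ) ≤ degOn A (P i) v := by
  rw [degOn_eq_card fun w hw => hP.clique i v hv w hw]
  linarith [h.card_part_lower hP i, h.card_pos]

omit hP in
theorem exists_avoiding [DecidableEq V] {T S : Finset V}
    (hT : (1 - 67 * ε ^ 3) * (Fintype.card V : ℝ) ≤ T.card)
    (hS : 285 / 1000 * (Fintype.card V : ℝ) ≤ S.card) (u v w : V)
    (hu : (degOn A S u : ℝ) ≤ 19 / 10 * ε * Fintype.card V)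
    (hv : (degOn A S v : ℝ) ≤ 19 / 10 * ε * Fintype.card V)
    (hw : (degOn A S w : ℝ) ≤ 19 / 10 * ε * Fintype.card V) :
    ∃ y ∈ S, y ∈ T ∧ A u y = false ∧ A v y = false ∧ A w y = false := by
  by_contra! hc
  have h1 : S ⊆ Tᶜ ∪ S.filter (fun y => A u y) ∪ S.filter (fun y => A v y) ∪
      S.filter (fun y => A w y) := by
    intro y hy
    have := hc y hy
    simp only [Finset.mem_union, Finset.mem_filter, Finset.mem_compl, hy, true_and]
    by_cases hyT : y ∈ T <;> cases e1 : A u y <;> cases e2 : A v y <;> cases e3 : A w y <;> simp_all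
  have h2 : S.card ≤ Tᶜ.card + degOn A S u + degOn A S v + degOn A S w :=
    (Finset.card_le_card h1).trans <| (Finset.card_union_le _ _).trans <| Nat.add_le_add_right
      ((Finset.card_union_le _ _).trans <| Nat.add_le_add_right (Finset.card_union_le _ _) _) _
  rw [Finset.card_compl] at h2
  have h3 : (S.card : ℝ) ≤ ((Fintype.card V - T.card : ℕ) : ℝ) + degOn A S u + degOn A S v + degOn A S w := by
    exact_mod_cast h2
  rw [Nat.cast_sub (Finset.card_le_univ T)] at h3
  have hn := h.card_pos
  have hε := h.pos
  have hε' := h.lt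
  have h4 : ε ^ 3 ≤ (1 / 30) ^ 3 := pow_le_pow_left₀ h.pos.le h.lt.le 3
  have h5 := mul_le_mul_of_nonneg_right h4 hn.le
  have h6 := mul_le_mul_of_nonneg_right hε'.le hn.le
  linarith

theorem adj_of_degOn_small [DecidableEq V] {T : Finset V} (hT : ∀ v ∈ T, Typical A ε P v)
    (hc : (1 - 67 * ε ^ 3) * (Fintype.card V : ℝ) ≤ T.card) {j k : Fin 3} (hjk : j ≠ k) {u v : V}
    (hu : u ∈ T) (hv : v ∈ T)
    (huj : (degOn A (P j) u : ℝ) < 255 / 1000 * Fintype.card V)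
    (huk : (degOn A (P k) u : ℝ) < 255 / 1000 * Fintype.card V)
    (hvj : (degOn A (P j) v : ℝ) < 255 / 1000 * Fintype.card V)
    (hvk : (degOn A (P k) v : ℝ) < 255 / 1000 * Fintype.card V) : A u v = true := by
  have huj := h.degOn_small hP (hT u hu) huj
  have huk := h.degOn_small hP (hT u hu) huk
  have hvj := h.degOn_small hP (hT v hv) hvj
  have hvk := h.degOn_small hP (hT v hv) hvk
  obtain ⟨y, hy, hyT, h1, h2, -⟩ :=
    h.exists_avoiding hc (h.card_part_lower hP j) u v v huj hvj hvj
  have hyk := h.degOn_small hP (hT y hyT) ((hT y hyT).single j k hjk (h.degOn_own_part hP hy))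
  obtain ⟨z, -, -, h3, h4, h5⟩ :=
    h.exists_avoiding hc (h.card_part_lower hP k) u v y huk hvk hyk
  simpa [h1, h2, h3, h4, h5] using h.four u v y z

theorem exists_degOn_large [DecidableEq V] {T : Finset V} (hT : ∀ v ∈ T, Typical A ε P v)
    (hc : (1 - 67 * ε ^ 3) * (Fintype.card V : ℝ) ≤ T.card) {v : V} (hv : v ∈ T) :
    ∃ i, 255 / 1000 * (Fintype.card V : ℝ) ≤ degOn A (P i) v := by
  by_contra! hs
  have h0 := h.degOn_small hP (hT v hv) (hs 0)
  obtain ⟨x, hx, hxT, h1, -, -⟩ := h.exists_avoiding hc (h.card_part_lower hP 0) v v v h0 h0 h0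
  have hx0 := h.degOn_own_part hP hx
  have h2 := h.adj_of_degOn_small hP hT hc (j := 1) (k := 2) (by decide) hv hxT (hs 1) (hs 2)
    ((hT x hxT).single 0 1 (by decide) hx0) ((hT x hxT).single 0 2 (by decide) hx0)
  rw [h1] at h2
  exact absurd h2 (by decide)

omit hP in
theorem card_clique_le {C : Fin 3 → Finset V} (hd : ∀ i j, i ≠ j → Disjoint (C i) (C j))
    (hq : ∀ i, ∀ u ∈ C i, ∀ v ∈ C i, A u v = true)
    (hc : (1 - 67 * ε ^ 3) * (Fintype.card V : ℝ) ≤ ∑ i, ((C i).card : ℝ)) (i : Fin 3) :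
    ((C i).card : ℝ) ≤ (1 / 3 + ε) * Fintype.card V := by
  obtain ⟨j, k, hij, hik, hjk⟩ := exists_distinct i
  have hn := h.card_pos
  have hε := h.pos
  have hε' := h.lt
  have h1 : ∑ l, ((C l).card : ℝ) ^ 3 ≤ triples A := by
    exact_mod_cast sum_card_pow_three_le hd hq
  have h3 := h.few
  rw [sum_eq_of_distinct hij hik hjk] at h1 hc
  set n : ℝ := (Fintype.card V : ℝ) with hn'
  by_contra! hlt
  have hq0 : 0 ≤ 1 / 3 - ε / 2 := by linarith
  have t1 := tangent_pow_three (p := (1 / 3 + ε) * n) (by positivity) (Nat.cast_nonneg (α := ℝ) (C i).card)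
  have t2 := tangent_pow_three (p := (1 / 3 - ε / 2) * n) (by positivity) (Nat.cast_nonneg (α := ℝ) (C j).card)
  have t3 := tangent_pow_three (p := (1 / 3 - ε / 2) * n) (by positivity) (Nat.cast_nonneg (α := ℝ) (C k).card)
  generalize ((C i).card : ℝ) = a at *
  generalize ((C j).card : ℝ) = b at *
  generalize ((C k).card : ℝ) = c at *
  have h4 := mul_le_mul_of_nonneg_left hc (by positivity : 0 ≤ 3 * ((1 / 3 - ε / 2) * n) ^ 2)
  have h5 := mul_le_mul_of_nonneg_left hlt.le
    (by positivity : 0 ≤ 3 * (ε + 3 / 4 * ε ^ 2) * n ^ 2)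
  have h6 : (1 / 9 + 3 / 2 * ε ^ 2 + 3 / 4 * ε ^ 3 - 3 * (1 / 3 - ε / 2) ^ 2 * (67 * ε ^ 3)) * n ^ 3 ≤
      (1 / 9 + 11 / 10 * ε ^ 5) * n ^ 3 := by linarith
  have h7 := le_of_mul_le_mul_right h6 (by positivity)
  have h8 : (1 / 3 - ε / 2) ^ 2 ≤ 1 / 9 := by nlinarith
  have h9 := mul_le_mul_of_nonneg_right h8 (by positivity : 0 ≤ ε ^ 3)
  have h10 := h.pow_five_le
  have h11 : ε ^ 3 ≤ 1 / 30 * ε ^ 2 := by nlinarith [sq_nonneg ε]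
  have h12 : 0 < ε ^ 2 := by positivity
  have h13 : 0 < ε ^ 3 := by positivity
  linarith

omit hP in
theorem exists_cliques [DecidableEq V] : ∃ C : Fin 3 → Finset V,
    (∀ i j, i ≠ j → Disjoint (C i) (C j)) ∧
    (∀ i, ∀ u ∈ C i, ∀ v ∈ C i, A u v = true) ∧
    (1 - 100 * ε ^ 3) * (Fintype.card V : ℝ) ≤ (Finset.univ.biUnion C).card ∧
    (∀ i, (1 / 3 - 3 * ε) * (Fintype.card V : ℝ) ≤ (C i).card ∧
      ((C i).card : ℝ) ≤ (1 / 3 + ε) * Fintype.card V) ∧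
    (∀ i, ∀ v ∈ C i, (((Finset.univ.biUnion C \ C i).filter fun u => A v u = true).card : ℝ) ≤
      4 * ε * Fintype.card V) := by
  obtain ⟨P, hP⟩ := h.exists_nearPartition
  obtain ⟨T, hT, hc⟩ := h.exists_typical hP
  have hn := h.card_pos
  have hε := h.pos
  have hε' := h.lt
  let C : Fin 3 → Finset V := fun i =>
    T.filter fun v => 255 / 1000 * (Fintype.card V : ℝ) ≤ degOn A (P i) v
  have hmem : ∀ i v, v ∈ C i ↔ v ∈ T ∧ 255 / 1000 * (Fintype.card V : ℝ) ≤ degOn A (P i) v :=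
    fun i v => Finset.mem_filter
  have small : ∀ {i j v}, i ≠ j → v ∈ C i → (degOn A (P j) v : ℝ) < 255 / 1000 * Fintype.card V :=
    fun {i j v} hij hv => (hT v ((hmem i v).1 hv).1).single i j hij ((hmem i v).1 hv).2
  have hd : ∀ i j, i ≠ j → Disjoint (C i) (C j) := by
    intro i j hij
    rw [Finset.disjoint_left]
    exact fun v hi hj => absurd ((hmem j v).1 hj).2 (not_le.2 (small hij hi))
  have hq : ∀ i, ∀ u ∈ C i, ∀ v ∈ C i, A u v = true := by
    intro i u hu v hv
    obtain ⟨j, k, hij, hik, hjk⟩ := exists_distinct i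
    exact h.adj_of_degOn_small hP hT hc hjk ((hmem i u).1 hu).1 ((hmem i v).1 hv).1 (small hij hu)
      (small hik hu) (small hij hv) (small hik hv)
  have hU : Finset.univ.biUnion C = T := by
    ext v
    simp only [Finset.mem_biUnion, Finset.mem_univ, true_and, hmem]
    constructor
    · rintro ⟨i, hv, -⟩
      exact hv
    · intro hv
      obtain ⟨i, hi⟩ := h.exists_degOn_large hP hT hc hv
      exact ⟨i, hv, hi⟩
  have hs : (1 - 67 * ε ^ 3) * (Fintype.card V : ℝ) ≤ ∑ i, ((C i).card : ℝ) := by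
    rw [← Nat.cast_sum, ← Finset.card_biUnion fun i _ j _ hij => hd i j hij, hU]
    exact hc
  have hup := h.card_clique_le hd hq hs
  have hε3 : 0 < ε ^ 3 * (Fintype.card V : ℝ) := by positivity
  refine ⟨C, hd, hq, ?_, fun i => ⟨?_, hup i⟩, fun i v hv => ?_⟩
  · rw [hU]
    linarith
  · obtain ⟨j, k, hij, hik, hjk⟩ := exists_distinct i
    rw [sum_eq_of_distinct hij hik hjk] at hs
    have h1 : 67 * ε ^ 3 ≤ ε := by
      have h2 : ε ^ 2 ≤ (1 / 30) ^ 2 := pow_le_pow_left₀ hε.le hε'.le 2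
      nlinarith
    have h2 := mul_le_mul_of_nonneg_right h1 hn.le
    linarith [hup j, hup k]
  · obtain ⟨j, k, hij, hik, hjk⟩ := exists_distinct i
    have h1 : ((Finset.univ.biUnion C \ C i).filter fun u => A v u = true) ⊆
        (P j).filter (fun u => A v u) ∪ (P k).filter (fun u => A v u) ∪ (Finset.univ.biUnion P)ᶜ := by
      intro u hu
      obtain ⟨hu, hvu⟩ := Finset.mem_filter.1 hu
      obtain ⟨huT, hui⟩ := Finset.mem_sdiff.1 hu
      rw [hU] at huT
      simp only [Finset.mem_union, Finset.mem_filter, Finset.mem_compl, Finset.mem_biUnion,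
        Finset.mem_univ, true_and, hvu, and_true]
      by_contra! hno
      obtain ⟨⟨hj, hk⟩, l, hl⟩ := hno
      have : l = i := by
        by_contra hli
        have hl3 : ∀ i j k l : Fin 3, i ≠ j → i ≠ k → j ≠ k → l ≠ i → l = j ∨ l = k := by decide
        rcases hl3 i j k l hij hik hjk hli with rfl | rfl
        exacts [hj hl, hk hl]
      subst this
      exact hui ((hmem l u).2 ⟨huT, h.degOn_own_part hP hl⟩)
    have h2 := (Finset.card_le_card h1).trans <| (Finset.card_union_le _ _).trans <|
      Nat.add_le_add_right (Finset.card_union_le _ _) _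
    rw [Finset.card_compl, Finset.card_biUnion fun i _ j _ hij => hP.disj i j hij] at h2
    have h3 : (((Finset.univ.biUnion C \ C i).filter fun u => A v u = true).card : ℝ) ≤
        degOn A (P j) v + degOn A (P k) v + ((Fintype.card V - ∑ l, (P l).card : ℕ) : ℝ) := by
      exact_mod_cast h2
    have h4 : ∑ l, (P l).card ≤ Fintype.card V := by
      rw [← Finset.card_biUnion fun i _ j _ hij => hP.disj i j hij]
      exact Finset.card_le_univ _
    rw [Nat.cast_sub h4, Nat.cast_sum] at h3
    have h5 := h.degOn_small hP (hT v ((hmem i v).1 hv).1) (small hij hv)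
    have h6 := h.degOn_small hP (hT v ((hmem i v).1 hv).1) (small hik hv)
    have h7 := hP.cover
    have h8 : 0 < ε * (Fintype.card V : ℝ) := by positivity
    linarith

end NearExtremal
end Stability

section Graph

open Classical in
/-- Adjacency or equality, as a bit. -/
noncomputable def adjOrEq {V : Type*} (G : SimpleGraph V) (u v : V) : Bool := decide (u = v ∨ G.Adj u v)

theorem adjOrEq_eq_true {V : Type*} {G : SimpleGraph V} {u v : V} :
    adjOrEq G u v = true ↔ u = v ∨ G.Adj u v := by
  simp [adjOrEq]

variable {V : Type*} [Fintype V] [DecidableEq V]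

theorem card_ordered_triangles_le (G : SimpleGraph V) (S : Finset (V × V × V))
    (hS : ∀ t ∈ S, G.Adj t.1 t.2.1 ∧ G.Adj t.1 t.2.2 ∧ G.Adj t.2.1 t.2.2) :
    S.card ≤ 6 * cliqueCount G 3 := by
  classical
  let C : Finset (Finset V) := Finset.univ.filter fun s => s.card = 3 ∧ G.IsClique (s : Set V)
  have hC : cliqueCount G 3 = C.card := by
    rw [cliqueCount, Nat.card_eq_fintype_card, Fintype.card_subtype]
  rw [hC]
  refine Finset.card_le_mul_card_image_of_maps_to (f := fun t => {t.1, t.2.1, t.2.2}) ?_ 6 ?_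
  · intro t ht
    obtain ⟨h1, h2, h3⟩ := hS t ht
    refine Finset.mem_filter.2 ⟨Finset.mem_univ _, ?_⟩
    have := SimpleGraph.is3Clique_triple_iff.2 ⟨h1, h2, h3⟩
    exact ⟨this.card_eq, this.isClique⟩
  · intro s hs
    obtain ⟨a, b, c, -, -, -, rfl⟩ := Finset.card_eq_three.1 (Finset.mem_filter.1 hs).2.1
    refine (Finset.card_le_card (t := {(a, b, c), (a, c, b), (b, a, c), (b, c, a), (c, a, b), (c, b, a)})
      ?_).trans Finset.card_le_six
    rintro ⟨x, y, z⟩ ht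
    obtain ⟨ht, he⟩ := Finset.mem_filter.1 ht
    obtain ⟨h1, h2, h3⟩ := hS _ ht
    have hx : x ∈ ({a, b, c} : Finset V) := by simp [← he]
    have hy : y ∈ ({a, b, c} : Finset V) := by simp [← he]
    have hz : z ∈ ({a, b, c} : Finset V) := by simp [← he]
    have h1 := h1.ne
    have h2 := h2.ne
    have h3 := h3.ne
    simp only [Finset.mem_insert, Finset.mem_singleton] at hx hy hz
    rcases hx with rfl | rfl | rfl <;> rcases hy with rfl | rfl | rfl <;>
      rcases hz with rfl | rfl | rfl <;> simp_all

theorem triples_adjOrEq_le (G : SimpleGraph V) :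
    triples (adjOrEq G) ≤ 6 * cliqueCount G 3 + 3 * (Fintype.card V : ℤ) ^ 2 := by
  classical
  let S : Finset (V × V × V) := Finset.univ.filter fun t =>
    G.Adj t.1 t.2.1 ∧ G.Adj t.1 t.2.2 ∧ G.Adj t.2.1 t.2.2
  have h1 : (S.card : ℤ) ≤ 6 * cliqueCount G 3 := by
    exact_mod_cast card_ordered_triangles_le G S fun t ht => (Finset.mem_filter.1 ht).2
  have h2 : (S.card : ℤ) = ∑ i, ∑ j, ∑ k, if G.Adj i j ∧ G.Adj i k ∧ G.Adj j k then 1 else 0 := by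
    rw [Finset.card_filter]
    push_cast
    rw [Fintype.sum_prod_type]
    simp_rw [Fintype.sum_prod_type]
  have h3 : ∀ i j k, bit (adjOrEq G i j && adjOrEq G i k && adjOrEq G j k) ≤
      (if G.Adj i j ∧ G.Adj i k ∧ G.Adj j k then 1 else 0) + (if i = j then 1 else 0) +
        (if i = k then 1 else 0) + if j = k then 1 else 0 := by
    intro i j k
    by_cases e1 : i = j
    · simp only [e1, if_true]
      cases (adjOrEq G j j && adjOrEq G j k && adjOrEq G j k) <;> simp only [bit] <;> split_ifs <;> decide
    by_cases e2 : i = k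
    · simp only [e2, if_true]
      cases (adjOrEq G k j && adjOrEq G k k && adjOrEq G j k) <;> simp only [bit] <;> split_ifs <;> decide
    by_cases e3 : j = k
    · simp only [e3, if_true]
      cases (adjOrEq G i k && adjOrEq G i k && adjOrEq G k k) <;> simp only [bit] <;> split_ifs <;> decide
    by_cases e4 : G.Adj i j <;> by_cases e5 : G.Adj i k <;> by_cases e6 : G.Adj j k <;>
      simp [adjOrEq, bit, e1, e2, e3, e4, e5, e6]
  have h4 := Finset.sum_le_sum fun i (_ : i ∈ Finset.univ) => Finset.sum_le_sum
    fun j (_ : j ∈ Finset.univ) => Finset.sum_le_sum fun k (_ : k ∈ Finset.univ) => h3 i j k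
  simp only [Finset.sum_add_distrib, ← h2] at h4
  rw [← triples] at h4
  simp only [Finset.sum_ite_eq, Finset.mem_univ, if_true, Finset.sum_const, Finset.card_univ,
    nsmul_eq_mul, mul_one, mul_ite, mul_zero] at h4
  linarith

theorem four_adjOrEq {V : Type*} [DecidableEq V] {G : SimpleGraph V} (hG : IndepBound G 3) (a b c d : V) :
    (adjOrEq G a b || adjOrEq G a c || adjOrEq G a d || adjOrEq G b c || adjOrEq G b d ||
      adjOrEq G c d) = true := by
  by_contra hn
  simp only [Bool.or_eq_true, adjOrEq_eq_true, not_or] at hn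
  obtain ⟨⟨⟨⟨⟨⟨h1, g1⟩, h2, g2⟩, h3, g3⟩, h4, g4⟩, h5, g5⟩, h6, g6⟩ := hn
  have h7 : ({a, b, c, d} : Finset V).card = 4 := by
    rw [Finset.card_insert_of_notMem (by simp [h1, h2, h3]),
      Finset.card_insert_of_notMem (by simp [h4, h5]), Finset.card_pair h6]
  have h8 := hG {a, b, c, d} (by
    intro u hu v hv huv
    simp only [Finset.mem_insert, Finset.mem_singleton] at hu hv
    rcases hu with rfl | rfl | rfl | rfl <;> rcases hv with rfl | rfl | rfl | rfl <;>
      first | exact absurd rfl huv | assumption | (rw [G.adj_comm]; assumption))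
  omega

theorem nearExtremal_adjOrEq {G : SimpleGraph V} {ε : ℝ} (hε : 0 < ε) (hε' : ε < 1 / 30)
    (hn : 30 ≤ ε ^ 5 * Fintype.card V) (hG : IndepBound G 3)
    (ht : (cliqueCount G 3 : ℝ) < (1 / 9 + ε ^ 5) * (Fintype.card V).choose 3) :
    NearExtremal (adjOrEq G) ε where
  symm a b := by
    rw [Bool.eq_iff_iff, adjOrEq_eq_true, adjOrEq_eq_true, eq_comm, G.adj_comm]
  four := four_adjOrEq hG
  pos := hε
  lt := hε'
  large := hn
  few := by
    have h1 : (triples (adjOrEq G) : ℝ) ≤ 6 * cliqueCount G 3 + 3 * (Fintype.card V : ℝ) ^ 2 := by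
      exact_mod_cast triples_adjOrEq_le G
    have h2 : 6 * ((Fintype.card V).choose 3 : ℝ) ≤ (Fintype.card V : ℝ) ^ 3 := by
      have := Nat.choose_le_pow_div (α := ℝ) 3 (Fintype.card V)
      norm_num [Nat.factorial] at this
      linarith
    have h3 := mul_le_mul_of_nonneg_left h2 (by positivity : 0 ≤ 1 / 9 + ε ^ 5)
    have h4 := mul_le_mul_of_nonneg_right hn (sq_nonneg (Fintype.card V : ℝ))
    linarith

end Graph
end Erdos34

/-- Stability for the (3,4)-problem: for 0 < ε < 1/30 and large n, any graph on n
vertices with α(G) ≤ 3 and t₃(G) < (1/9 + ε⁵)·C(n,3) contains three disjoint cliques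
covering all but 100ε³·n of the vertices, each of size between (1/3 − 3ε)n and
(1/3 + ε)n, with every vertex sending at most 4εn edges outside its own clique. -/
theorem erdos_34_stability :
    ∀ ε : ℝ, 0 < ε → ε < 1/30 →
      ∃ n₀ : ℕ, ∀ n : ℕ, n₀ ≤ n →
        ∀ G : SimpleGraph (Fin n), IndepBound G 3 →
          (cliqueCount G 3 : ℝ) < (1/9 + ε ^ 5) * (n.choose 3) →
          ∃ Cs : Fin 3 → Finset (Fin n),
            (∀ i j : Fin 3, i ≠ j → Disjoint (Cs i) (Cs j)) ∧
            (∀ i : Fin 3, G.IsClique ((Cs i : Finset (Fin n)) : Set (Fin n))) ∧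
            ((1 - 100 * ε ^ 3) * n ≤ ((Finset.univ.biUnion Cs).card : ℝ)) ∧
            (∀ i : Fin 3, (1/3 - 3 * ε) * n ≤ ((Cs i).card : ℝ) ∧
              ((Cs i).card : ℝ) ≤ (1/3 + ε) * n) ∧
            (∀ i : Fin 3, ∀ v ∈ Cs i,
              (({u : Fin n | u ∈ Finset.univ.biUnion Cs ∧ u ∉ Cs i ∧ G.Adj v u}).ncard : ℝ)
                ≤ 4 * ε * n) := by
  intro ε hε hε'
  refine ⟨⌈30 / ε ^ 5⌉₊, fun n hn G hG ht => ?_⟩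
  have hn' : 30 ≤ ε ^ 5 * (Fintype.card (Fin n) : ℝ) := by
    rw [Fintype.card_fin]
    have := Nat.ceil_le.1 hn
    rwa [div_le_iff₀' (by positivity)] at this
  have h := Erdos34.nearExtremal_adjOrEq hε hε' hn' hG (by rwa [Fintype.card_fin])
  obtain ⟨C, hd, hq, hc, hs, hx⟩ := h.exists_cliques
  simp only [Fintype.card_fin] at hc hs hx
  refine ⟨C, hd, fun i u hu v hv huv => ?_, hc, hs, fun i v hv => le_trans ?_ (hx i v hv)⟩
  · exact (Erdos34.adjOrEq_eq_true.1 (hq i u hu v hv)).resolve_left huv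
  · rw [Nat.cast_le, ← Set.ncard_coe_finset]
    refine Set.ncard_le_ncard (fun u hu => ?_) (Finset.finite_toSet _)
    exact Finset.mem_coe.2 (Finset.mem_filter.2 ⟨Finset.mem_sdiff.2 ⟨hu.1, hu.2.1⟩,
      Erdos34.adjOrEq_eq_true.2 (Or.inr hu.2.2)⟩)
end

section
/- For every real ε > 0 there exists n₀ such that for all n ≥ n₀, every simple graph G on n vertices with independence number at most 3 contains at least (1/9 − ε)·C(n,3) triangles. -/
/-- Test vector of an extension of an independent triple.  Here and below the arguments record the
adjacency of the new vertex to the three roots. -/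
def emptyVec : Bool → Bool → Bool → ℤ
  | false, false, false => 2
  | true, true, true => -1
  | _, _, _ => 0

/-- Test vectors for roots spanning one edge, between the first two. -/
def edgeVec : Bool → Bool → Bool → Fin 5 → ℤ
  | false, false, false => ![1, 0, 0, 0, 0]
  | false, false, true => ![0, 1, 0, 0, 0]
  | true, true, false => ![0, 0, 1, 0, 0]
  | true, false, false | false, true, false => ![0, 0, 0, 1, 0]
  | true, false, true | false, true, true => ![0, 0, 0, 0, 1]
  | true, true, true => ![0, 0, 0, -1, -1]

/-- Test vectors for roots spanning a path centred at the first. -/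
def pathVec : Bool → Bool → Bool → Fin 6 → ℤ
  | false, false, false => ![1, 0, 0, 0, 0, 0]
  | false, true, false => ![0, 1, 0, 0, 1, 0]
  | false, false, true => ![0, 1, 0, 0, -1, 0]
  | true, false, false => ![0, 0, 1, 0, 0, 0]
  | true, true, false => ![0, 0, 0, 1, 0, 1]
  | true, false, true => ![0, 0, 0, 1, 0, -1]
  | false, true, true => ![0, 0, 0, -2, 0, 0]
  | true, true, true => ![0, 0, -1, 2, 0, 0]

/-- Positive definite form on the coordinates of `edgeVec`. -/
def edgeForm (p q : Fin 5 → ℤ) : ℤ :=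
  p 0 * (792 * q 0 - 450 * q 1 - 84 * q 2 + 462 * q 3 - 90 * q 4) +
  p 1 * (-450 * q 0 + 846 * q 1 - 630 * q 2 - 96 * q 3 + 288 * q 4) +
  p 2 * (-84 * q 0 - 630 * q 1 + 1296 * q 2 - 414 * q 3 - 474 * q 4) +
  p 3 * (462 * q 0 - 96 * q 1 - 414 * q 2 + 414 * q 3 + 81 * q 4) +
  p 4 * (-90 * q 0 + 288 * q 1 - 474 * q 2 + 81 * q 3 + 204 * q 4)

/-- Positive definite form on the coordinates of `pathVec`. -/
def pathForm (p q : Fin 6 → ℤ) : ℤ :=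
  p 0 * (204 * q 0 - 174 * q 1 + 186 * q 2 + 162 * q 3) +
  p 1 * (-174 * q 0 + 198 * q 1 - 228 * q 2 - 186 * q 3) +
  p 2 * (186 * q 0 - 228 * q 1 + 420 * q 2 + 195 * q 3) +
  p 3 * (162 * q 0 - 186 * q 1 + 195 * q 2 + 180 * q 3) +
  p 4 * (546 * q 4 - 54 * q 5) + p 5 * (-54 * q 4 + 252 * q 5)

theorem edgeForm_self_nonneg (p : Fin 5 → ℤ) : 0 ≤ edgeForm p p := by
  unfold edgeForm
  generalize p 0 = a, p 1 = b, p 2 = c, p 3 = d, p 4 = e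
  linarith [sq_nonneg (132*a-75*b-14*c+77*d-15*e), sq_nonneg (4329*b-4970*c+1221*d+1737*e),
    sq_nonneg (183626*c-62715*d-76338*e), sq_nonneg (3503918*d-512313*e), sq_nonneg e]

theorem pathForm_self_nonneg (p : Fin 6 → ℤ) : 0 ≤ pathForm p p := by
  unfold pathForm
  generalize p 0 = a, p 1 = b, p 2 = c, p 3 = d, p 4 = e, p 5 = f
  linarith [sq_nonneg (34*a-29*b+31*c+27*d), sq_nonneg (281*b-393*c-271*d),
    sq_nonneg (2874*c-367*d), sq_nonneg d, sq_nonneg (91*e-9*f), sq_nonneg f]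

/-- Contribution of roots `x, y, z` in this order with extensions `u, v`; the arguments are the
adjacencies `xy, xz, yz`, then those of `u` and of `v` to the roots. -/
def rootedTerm (xy xz yz xu yu zu xv yv zv : Bool) : ℤ :=
  match xy, xz, yz with
  | true, false, false => edgeForm (edgeVec xu yu zu) (edgeVec xv yv zv)
  | true, true, false => pathForm (pathVec xu yu zu) (pathVec xv yv zv)
  | _, _, _ => 0

/-- Weighted indicator that the roots `x, y, z` are independent, minus the nonnegative forms;
the arguments are as in `rootedTerm`. -/
def localTerm (xy xz yz xu yu zu xv yv zv : Bool) : ℤ :=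
  (bif xy || xz || yz then -60 else 480 - 120 * emptyVec xu yu zu * emptyVec xv yv zv) -
  rootedTerm xy xz yz xu yu zu xv yv zv - rootedTerm yz xy xz yu zu xu yv zv xv -
  rootedTerm xz yz xy zu xu yu zv xv yv

/-- On every `K₄`-free graph with five vertices, the local terms over all choices of three
roots have a nonnegative sum. -/
theorem localTerm_sum_nonneg : ∀ a01 a02 a03 a04 a12 a13 a14 a23 a24 a34 : Bool,
    (a01 && a02 && a03 && a12 && a13 && a23) = false →
    (a01 && a02 && a04 && a12 && a14 && a24) = false →
    (a01 && a03 && a04 && a13 && a14 && a34) = false →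
    (a02 && a03 && a04 && a23 && a24 && a34) = false →
    (a12 && a13 && a14 && a23 && a24 && a34) = false →
    0 ≤ localTerm a01 a02 a12 a03 a13 a23 a04 a14 a24 +
      localTerm a01 a03 a13 a02 a12 a23 a04 a14 a34 +
      localTerm a01 a04 a14 a02 a12 a24 a03 a13 a34 +
      localTerm a02 a03 a23 a01 a12 a13 a04 a24 a34 +
      localTerm a02 a04 a24 a01 a12 a14 a03 a23 a34 +
      localTerm a03 a04 a34 a01 a13 a14 a02 a23 a24 +
      localTerm a12 a13 a23 a01 a02 a03 a14 a24 a34 +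
      localTerm a12 a14 a24 a01 a02 a04 a13 a23 a34 +
      localTerm a13 a14 a34 a01 a03 a04 a12 a23 a24 +
      localTerm a23 a24 a34 a02 a03 a04 a12 a13 a14 := by
  decide +kernel

open Finset

/-- The local term at the roots `x, y, z` and the two further vertices `u, v` of a graph. -/
def adjTerm {V : Type*} (H : SimpleGraph V) [DecidableRel H.Adj] (x y z u v : V) : ℤ :=
  localTerm (H.Adj x y) (H.Adj x z) (H.Adj y z) (H.Adj x u) (H.Adj y u) (H.Adj z u)
    (H.Adj x v) (H.Adj y v) (H.Adj z v)

theorem SimpleGraph.CliqueFree.not_adj_four {V : Type*} {H : SimpleGraph V}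
    (hH : H.CliqueFree 4) (x y z u : V) :
    ¬ (H.Adj x y ∧ H.Adj x z ∧ H.Adj x u ∧ H.Adj y z ∧ H.Adj y u ∧ H.Adj z u) := by
  classical
  rintro ⟨hxy, hxz, hxu, hyz, hyu, hzu⟩
  refine hH {x, y, z, u} ((SimpleGraph.is3Clique_triple_iff.2 ⟨hyz, hyu, hzu⟩).insert ?_)
  simp [hxy, hxz, hxu]

theorem adjTerm_sum_nonneg {V : Type*} {H : SimpleGraph V} [DecidableRel H.Adj]
    (hH : H.CliqueFree 4) (x y z u v : V) :
    0 ≤ adjTerm H x y z u v + adjTerm H x y u z v + adjTerm H x y v z u +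
      adjTerm H x z u y v + adjTerm H x z v y u + adjTerm H x u v y z +
      adjTerm H y z u x v + adjTerm H y z v x u + adjTerm H y u v x z +
      adjTerm H z u v x y := by
  have key := localTerm_sum_nonneg (H.Adj x y) (H.Adj x z) (H.Adj x u) (H.Adj x v)
    (H.Adj y z) (H.Adj y u) (H.Adj y v) (H.Adj z u) (H.Adj z v) (H.Adj u v)
    (by simpa [and_assoc] using hH.not_adj_four x y z u)
    (by simpa [and_assoc] using hH.not_adj_four x y z v)
    (by simpa [and_assoc] using hH.not_adj_four x y u v)
    (by simpa [and_assoc] using hH.not_adj_four x z u v)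
    (by simpa [and_assoc] using hH.not_adj_four y z u v)
  simpa only [adjTerm, H.adj_comm z y, H.adj_comm u y, H.adj_comm u z, H.adj_comm v y,
    H.adj_comm v z, H.adj_comm v u, H.adj_comm y x, H.adj_comm z x, H.adj_comm u x,
    H.adj_comm v x] using key

theorem sum_comp_perm_five {V : Type*} [Fintype V] (f : V → V → V → V → V → ℤ)
    (σ : Equiv.Perm (Fin 5)) :
    ∑ t : Fin 5 → V, f (t (σ 0)) (t (σ 1)) (t (σ 2)) (t (σ 3)) (t (σ 4)) =
      ∑ t : Fin 5 → V, f (t 0) (t 1) (t 2) (t 3) (t 4) :=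
  Equiv.sum_comp (Equiv.arrowCongr σ.symm (Equiv.refl V))
    fun t : Fin 5 → V => f (t 0) (t 1) (t 2) (t 3) (t 4)

theorem sum_pi_fin_succ {V : Type*} [Fintype V] {k : ℕ} (g : (Fin (k + 1) → V) → ℤ) :
    ∑ t, g t = ∑ x, ∑ s : Fin k → V, g (Fin.cons x s) := by
  rw [← Fintype.sum_prod_type', ← (Fin.consEquiv fun _ => V).sum_comp]
  rfl

theorem sum_pi_fin_five {V : Type*} [Fintype V] (f : V → V → V → V → V → ℤ) :
    ∑ t : Fin 5 → V, f (t 0) (t 1) (t 2) (t 3) (t 4) =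
      ∑ x, ∑ y, ∑ z, ∑ u, ∑ v, f x y z u v := by
  simp only [sum_pi_fin_succ, Fintype.sum_unique]
  rfl

theorem sum_adjTerm_nonneg {V : Type*} [Fintype V] {H : SimpleGraph V} [DecidableRel H.Adj]
    (hH : H.CliqueFree 4) : 0 ≤ ∑ x, ∑ y, ∑ z, ∑ u, ∑ v, adjTerm H x y z u v := by
  have h := sum_nonneg fun (t : Fin 5 → V) (_ : t ∈ univ) =>
    adjTerm_sum_nonneg hH (t 0) (t 1) (t 2) (t 3) (t 4)
  have perm (p q : Fin 5 → Fin 5) (hpq : Function.LeftInverse q p)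
      (hqp : Function.RightInverse q p) :=
    sum_comp_perm_five (adjTerm H) ⟨p, q, hpq, hqp⟩
  simp only [sum_add_distrib] at h
  have h₂ := perm ![0, 1, 3, 2, 4] ![0, 1, 3, 2, 4] (by decide) (by decide)
  have h₃ := perm ![0, 1, 4, 2, 3] ![0, 1, 3, 4, 2] (by decide) (by decide)
  have h₄ := perm ![0, 2, 3, 1, 4] ![0, 3, 1, 2, 4] (by decide) (by decide)
  have h₅ := perm ![0, 2, 4, 1, 3] ![0, 3, 1, 4, 2] (by decide) (by decide)
  have h₆ := perm ![0, 3, 4, 1, 2] ![0, 3, 4, 1, 2] (by decide) (by decide)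
  have h₇ := perm ![1, 2, 3, 0, 4] ![3, 0, 1, 2, 4] (by decide) (by decide)
  have h₈ := perm ![1, 2, 4, 0, 3] ![3, 0, 1, 4, 2] (by decide) (by decide)
  have h₉ := perm ![1, 3, 4, 0, 2] ![3, 0, 4, 1, 2] (by decide) (by decide)
  have h₁₀ := perm ![2, 3, 4, 0, 1] ![3, 4, 0, 1, 2] (by decide) (by decide)
  simp only [Equiv.coe_fn_mk, Matrix.cons_val] at h₂ h₃ h₄ h₅ h₆ h₇ h₈ h₉ h₁₀
  rw [← sum_pi_fin_five]
  linarith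

theorem edgeForm_sum_sum {ι : Type*} [Fintype ι] (p : ι → Fin 5 → ℤ) :
    ∑ u, ∑ v, edgeForm (p u) (p v) =
      edgeForm (fun i => ∑ u, p u i) (fun i => ∑ u, p u i) := by
  simp only [edgeForm, sum_add_distrib, sum_sub_distrib, ← mul_sum, ← sum_mul]

theorem pathForm_sum_sum {ι : Type*} [Fintype ι] (p : ι → Fin 6 → ℤ) :
    ∑ u, ∑ v, pathForm (p u) (p v) =
      pathForm (fun i => ∑ u, p u i) (fun i => ∑ u, p u i) := by
  simp only [pathForm, sum_add_distrib, sum_sub_distrib, ← mul_sum, ← sum_mul]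

theorem sum_rootedTerm_nonneg {ι : Type*} [Fintype ι] (b₁ b₂ b₃ : Bool) (f g h : ι → Bool) :
    0 ≤ ∑ u, ∑ v, rootedTerm b₁ b₂ b₃ (f u) (g u) (h u) (f v) (g v) (h v) := by
  unfold rootedTerm
  split
  · rw [edgeForm_sum_sum fun u => edgeVec (f u) (g u) (h u)]
    exact edgeForm_self_nonneg _
  · rw [pathForm_sum_sum fun u => pathVec (f u) (g u) (h u)]
    exact pathForm_self_nonneg _
  · simp

theorem sum_localTerm_le {ι : Type*} [Fintype ι] (b₁ b₂ b₃ : Bool) (f g h : ι → Bool) :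
    ∑ u, ∑ v, localTerm b₁ b₂ b₃ (f u) (g u) (h u) (f v) (g v) (h v) ≤
      (Fintype.card ι : ℤ) ^ 2 * (bif b₁ || b₂ || b₃ then -60 else 480) := by
  have h₁ := sum_rootedTerm_nonneg b₁ b₂ b₃ f g h
  have h₂ := sum_rootedTerm_nonneg b₃ b₁ b₂ g h f
  have h₃ := sum_rootedTerm_nonneg b₂ b₃ b₁ h f g
  simp only [localTerm, sum_sub_distrib]
  cases b₁ || b₂ || b₃
  · simp only [cond_false, sum_sub_distrib, ← mul_sum, ← sum_mul, sum_const, card_univ,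
      nsmul_eq_mul]
    nlinarith [sq_nonneg (∑ u, emptyVec (f u) (g u) (h u))]
  · simp only [cond_true, sum_const, card_univ, nsmul_eq_mul]
    linarith

/-- In a graph without `K₄`, at least one ninth of all ordered triples of (not necessarily
distinct) vertices span no edge. -/
theorem SimpleGraph.CliqueFree.card_pow_three_le {V : Type*} [Fintype V] {H : SimpleGraph V}
    [DecidableRel H.Adj] (hH : H.CliqueFree 4) :
    Fintype.card V ^ 3 ≤
      9 * #{t : V × V × V | ¬ H.Adj t.1 t.2.1 ∧ ¬ H.Adj t.1 t.2.2 ∧ ¬ H.Adj t.2.1 t.2.2} := by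
  rcases (Fintype.card V).eq_zero_or_pos with h0 | hpos
  · simp [h0]
  set I := #{t : V × V × V | ¬ H.Adj t.1 t.2.1 ∧ ¬ H.Adj t.1 t.2.2 ∧ ¬ H.Adj t.2.1 t.2.2} with hI
  have hsum : ∑ x : V, ∑ y, ∑ z,
      (bif H.Adj x y || H.Adj x z || H.Adj y z then (-60 : ℤ) else 480) =
        540 * I - 60 * (Fintype.card V : ℤ) ^ 3 := by
    have hI' : (I : ℤ) = ∑ x : V, ∑ y, ∑ z,
        if ¬ H.Adj x y ∧ ¬ H.Adj x z ∧ ¬ H.Adj y z then (1 : ℤ) else 0 := by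
      rw [hI, card_filter, Nat.cast_sum]
      simp only [Fintype.sum_prod_type, Nat.cast_ite, Nat.cast_one, Nat.cast_zero]
    have hc : (Fintype.card V : ℤ) ^ 3 = ∑ _x : V, ∑ _y : V, ∑ _z : V, 1 := by
      simp [pow_succ, mul_assoc]
    rw [hI', hc]
    simp only [mul_sum, ← sum_sub_distrib]
    refine sum_congr rfl fun x _ => sum_congr rfl fun y _ => sum_congr rfl fun z _ => ?_
    by_cases h₁ : H.Adj x y <;> by_cases h₂ : H.Adj x z <;> by_cases h₃ : H.Adj y z <;>
      simp [h₁, h₂, h₃]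
  have hle : ∑ x, ∑ y, ∑ z, ∑ u, ∑ v, adjTerm H x y z u v ≤
      (Fintype.card V : ℤ) ^ 2 * (540 * I - 60 * (Fintype.card V : ℤ) ^ 3) := by
    rw [← hsum]
    simp only [mul_sum]
    exact sum_le_sum fun x _ => sum_le_sum fun y _ => sum_le_sum fun z _ =>
      sum_localTerm_le _ _ _ (fun u => H.Adj x u) (fun u => H.Adj y u) (fun u => H.Adj z u)
  have hnn : (0 : ℤ) ≤ 540 * I - 60 * (Fintype.card V : ℤ) ^ 3 :=
    nonneg_of_mul_nonneg_right ((sum_adjTerm_nonneg hH).trans hle) (by positivity)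
  zify
  linarith

theorem IndepBound.compl_cliqueFree {V : Type*} {G : SimpleGraph V} {m : ℕ}
    (hG : IndepBound G m) : Gᶜ.CliqueFree (m + 1) := by
  intro s hs
  have := hG s fun u hu v hv huv => (hs.isClique hu hv huv).2
  have := hs.card_eq
  omega

/-- Each triangle gives at most six ordered triples of pairwise adjacent vertices. -/
theorem card_adj_triples_le {V : Type*} [Fintype V] [DecidableEq V] (G : SimpleGraph V)
    [DecidableRel G.Adj] :
    #{t : V × V × V | G.Adj t.1 t.2.1 ∧ G.Adj t.1 t.2.2 ∧ G.Adj t.2.1 t.2.2} ≤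
      6 * cliqueCount G 3 := by
  have hcount : cliqueCount G 3 = #(G.cliqueFinset 3) := by
    rw [cliqueCount, Nat.card_eq_fintype_card]
    exact Fintype.card_of_subtype _ fun s => by
      rw [SimpleGraph.mem_cliqueFinset_iff, SimpleGraph.isNClique_iff, and_comm]
  rw [hcount]
  refine card_le_mul_card_image_of_maps_to (f := fun t => {t.1, t.2.1, t.2.2}) ?_ 6 ?_
  · rintro ⟨x, y, z⟩ ht
    simp only [mem_filter_univ] at ht
    rw [SimpleGraph.mem_cliqueFinset_iff, SimpleGraph.is3Clique_triple_iff]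
    exact ht
  · intro s hs
    rw [SimpleGraph.mem_cliqueFinset_iff, SimpleGraph.is3Clique_iff] at hs
    obtain ⟨a, b, c, -, -, -, rfl⟩ := hs
    refine (card_le_card (t := {(a, b, c), (a, c, b), (b, a, c), (b, c, a), (c, a, b),
      (c, b, a)}) ?_).trans card_le_six
    rintro ⟨x, y, z⟩ ht
    simp only [mem_filter, mem_univ, true_and] at ht
    obtain ⟨⟨h₁, h₂, h₃⟩, h⟩ := ht
    have h₁ := h₁.ne
    have h₂ := h₂.ne
    have h₃ := h₃.ne
    have hx : x ∈ ({a, b, c} : Finset V) := h ▸ by simp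
    have hy : y ∈ ({a, b, c} : Finset V) := h ▸ by simp
    have hz : z ∈ ({a, b, c} : Finset V) := h ▸ by simp
    simp only [mem_insert, mem_singleton] at hx hy hz
    simp only [mem_insert, mem_singleton, Prod.mk.injEq]
    grind

/-- Ordered triples with a repeated entry number at most `3n²`. -/
theorem card_repeated_triples_le (V : Type*) [Fintype V] [DecidableEq V] :
    #{t : V × V × V | t.1 = t.2.1 ∨ t.1 = t.2.2 ∨ t.2.1 = t.2.2} ≤ 3 * Fintype.card V ^ 2 := by
  have hsub : ({t : V × V × V | t.1 = t.2.1 ∨ t.1 = t.2.2 ∨ t.2.1 = t.2.2} : Finset _) ⊆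
      univ.image (fun p : V × V => (p.1, p.1, p.2)) ∪
        (univ.image (fun p : V × V => (p.1, p.2, p.1)) ∪
          univ.image (fun p : V × V => (p.1, p.2, p.2))) := by
    rintro ⟨x, y, z⟩ ht
    simp only [mem_filter_univ] at ht
    simp only [mem_union, mem_image, mem_univ, true_and, Prod.mk.injEq, Prod.exists]
    grind
  have himg (f : V × V → V × V × V) : #(univ.image f) ≤ Fintype.card V ^ 2 :=
    card_image_le.trans (by simp [sq])
  refine (card_le_card hsub).trans ((card_union_le _ _).trans ?_)
  have := card_union_le (univ.image (fun p : V × V => (p.1, p.2, p.1)))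
    (univ.image (fun p : V × V => (p.1, p.2, p.2)))
  have h₁ := himg fun p => (p.1, p.1, p.2)
  have h₂ := himg fun p => (p.1, p.2, p.1)
  have h₃ := himg fun p => (p.1, p.2, p.2)
  omega

/-- A graph on `n` vertices with independence number at most three has at least
`n³/54 - n²/2` triangles. -/
theorem IndepBound.card_pow_three_le {V : Type*} [Fintype V] {G : SimpleGraph V}
    (hG : IndepBound G 3) :
    Fintype.card V ^ 3 ≤ 54 * cliqueCount G 3 + 27 * Fintype.card V ^ 2 := by
  classical
  have hsub : ({t : V × V × V | ¬ Gᶜ.Adj t.1 t.2.1 ∧ ¬ Gᶜ.Adj t.1 t.2.2 ∧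
        ¬ Gᶜ.Adj t.2.1 t.2.2} : Finset _) ⊆
      ({t : V × V × V | G.Adj t.1 t.2.1 ∧ G.Adj t.1 t.2.2 ∧ G.Adj t.2.1 t.2.2} : Finset _) ∪
        ({t : V × V × V | t.1 = t.2.1 ∨ t.1 = t.2.2 ∨ t.2.1 = t.2.2} : Finset _) := by
    intro t ht
    simp only [mem_filter_univ, SimpleGraph.compl_adj] at ht
    simp only [mem_union, mem_filter_univ]
    tauto
  have h₁ := hG.compl_cliqueFree.card_pow_three_le
  have h₂ := (card_le_card hsub).trans (card_union_le _ _)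
  have h₃ := card_adj_triples_le G
  have h₄ := card_repeated_triples_le V
  omega

/-- For every real ε > 0 there exists n₀ such that for all n ≥ n₀, every simple graph G
on n vertices with independence number at most 3 contains at least (1/9 − ε)·C(n,3)
triangles. -/
theorem erdos_34_asymptotic :
    ∀ ε : ℝ, 0 < ε → ∃ n₀ : ℕ, ∀ n : ℕ, n₀ ≤ n →
      ∀ G : SimpleGraph (Fin n), IndepBound G 3 →
        ((1 : ℝ)/9 - ε) * (n.choose 3) ≤ (cliqueCount G 3 : ℝ) := by
  intro ε hε
  refine ⟨⌈3 / ε⌉₊, fun n hn G hG => ?_⟩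
  have hn : 3 ≤ n * ε := (div_le_iff₀ hε).1 (Nat.ceil_le.1 hn)
  rcases le_or_gt (1 / 9 - ε) 0 with h | h
  · exact (mul_nonpos_of_nonpos_of_nonneg h (by positivity)).trans (by positivity)
  have hmain : (n : ℝ) ^ 3 ≤ 54 * cliqueCount G 3 + 27 * n ^ 2 := by
    exact_mod_cast Fintype.card_fin n ▸ hG.card_pow_three_le
  have hchoose : (n.choose 3 : ℝ) ≤ n ^ 3 / 6 := by
    simpa [Nat.factorial] using Nat.choose_le_pow_div (α := ℝ) 3 n
  calc (1 / 9 - ε) * (n.choose 3 : ℝ) ≤ (1 / 9 - ε) * (n ^ 3 / 6) := by gcongr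
    _ ≤ cliqueCount G 3 := by nlinarith [mul_le_mul_of_nonneg_left hn (sq_nonneg (n : ℝ))]
end
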